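/- arXiv:1005.0672 — 2 statements merged into one kernel-verified Lean document; each statement's English description precedes it below -/
import Mathlib

section
/- Let N(ξ,η) denote the number of GL₂(ℤ)-equivalence classes of irreducible integral binary cubic forms f satisfying ξ < Disc(f) < η. Then N(0,X) = (π²/72)·X + O(X^{5/6}) and N(−X,0) = (π²/24)·X + O(X^{5/6}). -/
open Filter Asymptotics Real

/-- An integral binary cubic form `ax³ + bx²y + cxy² + dy³`, recorded as `(a,b,c,d)`. -/
abbrev BinaryCubic := ℤ × ℤ × ℤ × ℤ

/-- The homogeneous polynomial associated to a binary cubic form over a commutative ring. -/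
noncomputable def toPoly {A : Type*} [CommRing A] (f : A × A × A × A) :
    MvPolynomial (Fin 2) A :=
  MvPolynomial.C f.1 * MvPolynomial.X 0 ^ 3 +
    MvPolynomial.C f.2.1 * MvPolynomial.X 0 ^ 2 * MvPolynomial.X 1 +
    MvPolynomial.C f.2.2.1 * MvPolynomial.X 0 * MvPolynomial.X 1 ^ 2 +
    MvPolynomial.C f.2.2.2 * MvPolynomial.X 1 ^ 3

/-- `ActsTo γ f g` means `g = γ · f` under the twisted action
`(γ · f)(x,y) = (det γ)⁻¹ · f((x,y)·γ)`, expressed without inverses as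
`(det γ) · (γ·f)(x,y) = f((x,y)·γ)`. -/
def ActsTo {A : Type*} [CommRing A] (γ : Matrix (Fin 2) (Fin 2) A)
    (f g : A × A × A × A) : Prop :=
  MvPolynomial.C γ.det * toPoly g =
    MvPolynomial.bind₁
      (fun j : Fin 2 =>
        MvPolynomial.C (γ 0 j) * MvPolynomial.X 0 + MvPolynomial.C (γ 1 j) * MvPolynomial.X 1)
      (toPoly f)

/-- `GL₂(ℤ)`-equivalence of integral binary cubic forms (twisted action). -/
def FormEquiv (f g : BinaryCubic) : Prop :=
  ∃ γ : Matrix (Fin 2) (Fin 2) ℤ, IsUnit γ.det ∧ ActsTo γ f g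

/-- The discriminant of a binary cubic form `(a,b,c,d)`:
`b²c² − 4ac³ − 4b³d − 27a²d² + 18abcd`. -/
def discF (f : BinaryCubic) : ℤ :=
  f.2.1 ^ 2 * f.2.2.1 ^ 2 - 4 * f.1 * f.2.2.1 ^ 3 - 4 * f.2.1 ^ 3 * f.2.2.2 -
    27 * f.1 ^ 2 * f.2.2.2 ^ 2 + 18 * f.1 * f.2.1 * f.2.2.1 * f.2.2.2

/-- Irreducibility of a binary cubic form, as a polynomial over `ℚ`. -/
def IrredForm (f : BinaryCubic) : Prop :=
  Irreducible (MvPolynomial.map (Int.castRingHom ℚ) (toPoly f))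

/-- The number of `GL₂(ℤ)`-equivalence classes of integral binary cubic forms
satisfying a property `P` (assumed `GL₂(ℤ)`-invariant). -/
noncomputable def countClasses (P : BinaryCubic → Prop) : ℕ :=
  Nat.card (Quot fun f g : { f : BinaryCubic // P f } => FormEquiv f.1 g.1)

section

open MeasureTheory Set

theorem IsPreconnected.subset_or_disjoint_of_disjoint_frontier {α : Type*} [TopologicalSpace α]
    {C S : Set α} (hC : IsPreconnected C) (h : Disjoint C (frontier S)) : C ⊆ S ∨ Disjoint C S := by
  have hcov : C ⊆ interior S ∪ (closure S)ᶜ := by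
    intro x hx
    by_contra hcon
    simp only [mem_union, mem_compl_iff, not_or, not_not] at hcon
    exact disjoint_left.1 h hx ⟨hcon.2, hcon.1⟩
  have hdis : Disjoint (interior S) (closure S)ᶜ :=
    disjoint_compl_right_iff_subset.2 (interior_subset.trans subset_closure)
  rcases hC.subset_or_subset isOpen_interior isClosed_closure.isOpen_compl hdis hcov with h1 | h1
  · exact Or.inl (h1.trans interior_subset)
  · exact Or.inr (disjoint_of_subset_right subset_closure (disjoint_left.2 fun x hx => h1 hx))

theorem abs_sum_indicator_sub_integral_le {S : Set ℝ} {F : Finset ℝ} (hF : frontier S ⊆ F)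
    (hinteg : Integrable (S.indicator (1 : ℝ → ℝ))) {K : Finset ℤ}
    (hK : ∀ n : ℤ, (n : ℝ) ∈ S → n ∈ K) :
    |∑ n ∈ K, S.indicator (1 : ℝ → ℝ) n - ∫ t, S.indicator (1 : ℝ → ℝ) t| ≤ 2 * F.card := by
  have h1 : HasSum (fun n : ℤ => S.indicator (1 : ℝ → ℝ) n)
      (∑ n ∈ K, S.indicator (1 : ℝ → ℝ) n) := by
    apply hasSum_sum_of_ne_finset_zero
    intro n hn
    exact indicator_of_notMem (fun h => hn (hK n h)) _
  have h2 := hinteg.hasSum_intervalIntegral 0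
  have h3 : HasSum (fun n : ℤ => ∑ p ∈ F, ((if n = ⌊p⌋ then (1 : ℝ) else 0) +
      (if n = ⌈p⌉ - 1 then (1 : ℝ) else 0))) (∑ p ∈ F, ((1 : ℝ) + 1)) :=
    hasSum_sum fun p _ => (hasSum_ite_eq _ _).add (hasSum_ite_eq _ _)
  have h4 : ∑ p ∈ F, ((1 : ℝ) + 1) = 2 * F.card := by
    rw [Finset.sum_const, nsmul_eq_mul]; ring
  rw [h4] at h3
  refine (h1.sub h2).norm_le_of_bounded h3 fun n => ?_
  have hle : (n : ℝ) ≤ n + 1 := by linarith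
  rw [zero_add, intervalIntegral.integral_of_le hle, Real.norm_eq_abs]
  have hnn : ∀ p ∈ F, (0 : ℝ) ≤ (if n = ⌊p⌋ then (1 : ℝ) else 0) +
      (if n = ⌈p⌉ - 1 then (1 : ℝ) else 0) := fun p _ => by positivity
  by_cases hd : Disjoint (Icc (n : ℝ) (n + 1)) (frontier S)
  · have hz : S.indicator (1 : ℝ → ℝ) n - ∫ t in Ioc (n : ℝ) (n + 1), S.indicator (1 : ℝ → ℝ) t
        = 0 := by
      rcases isPreconnected_Icc.subset_or_disjoint_of_disjoint_frontier hd with h | h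
      · rw [indicator_of_mem (h (left_mem_Icc.2 hle)),
          setIntegral_congr_fun (g := fun _ => (1 : ℝ)) measurableSet_Ioc
            fun x hx => indicator_of_mem (h (Ioc_subset_Icc_self hx)) _]
        simp
      · rw [indicator_of_notMem (disjoint_left.1 h (left_mem_Icc.2 hle)),
          setIntegral_congr_fun (g := fun _ => (0 : ℝ)) measurableSet_Ioc
            fun x hx => indicator_of_notMem (disjoint_left.1 h (Ioc_subset_Icc_self hx)) _]
        simp
    rw [hz, abs_zero]
    exact Finset.sum_nonneg hnn
  · obtain ⟨p, hp, hpf⟩ := not_disjoint_iff.1 hd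
    have hb : ∀ x, S.indicator (1 : ℝ → ℝ) x ∈ Icc (0 : ℝ) 1 := fun x => by
      by_cases hx : x ∈ S <;> simp [hx]
    have hi : (∫ t in Ioc (n : ℝ) (n + 1), S.indicator (1 : ℝ → ℝ) t) ∈ Icc (0 : ℝ) 1 := by
      constructor
      · exact setIntegral_nonneg measurableSet_Ioc fun x _ => (hb x).1
      · refine (setIntegral_mono hinteg.integrableOn (by simp) fun x => (hb x).2).trans ?_
        simp
    have hone : (1 : ℝ) ≤ (if n = ⌊p⌋ then (1 : ℝ) else 0) +
        (if n = ⌈p⌉ - 1 then (1 : ℝ) else 0) := by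
      rcases hp.2.lt_or_eq with h | h
      · rw [if_pos (Int.floor_eq_iff.2 ⟨hp.1, h⟩).symm]
        split_ifs <;> norm_num
      · have : n = ⌈p⌉ - 1 := by
          rw [h]; simp [Int.ceil_add_one]
        rw [if_pos this]
        split_ifs <;> norm_num
    refine le_trans ?_ (hone.trans (Finset.single_le_sum hnn (hF hpf)))
    rw [abs_le]
    constructor <;> linarith [(hb n).1, (hb n).2, hi.1, hi.2]

/-- Lattice points in a bounded region of `ℝ³` whose axis-parallel lines satisfy a
one-dimensional discrepancy bound. -/
theorem abs_sum_sub_integral_le_of_slices {φ : ℝ × ℝ × ℝ → ℝ} {h B C D : ℝ} (hh : 0 ≤ h)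
    (hB : 0 ≤ B) (hC : 0 ≤ C) {I J K : Finset ℤ}
    (hinteg : Integrable φ) (hm : Measurable φ) (hbd : ∀ p, |φ p| ≤ 1)
    (hsupp : ∀ b c d, φ (b, c, d) ≠ 0 → |b| ≤ B ∧ |c| ≤ C ∧ |d| ≤ D)
    (h1 : ∀ c d, |∑ n ∈ I, φ ((n : ℝ), c, d) - ∫ b, φ (b, c, d)| ≤ h)
    (h2 : ∀ b d, |∑ n ∈ J, φ (b, (n : ℝ), d) - ∫ c, φ (b, c, d)| ≤ h)
    (h3 : ∀ b c, |∑ n ∈ K, φ (b, c, (n : ℝ)) - ∫ d, φ (b, c, d)| ≤ h) :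
    |∑ i ∈ I, ∑ j ∈ J, ∑ k ∈ K, φ ((i : ℝ), (j : ℝ), (k : ℝ)) - ∫ p, φ p| ≤
      h * (J.card * K.card + 2 * B * K.card + 2 * B * (2 * C)) := by
  have hsuppI : ∀ b c d, φ (b, c, d) ≠ 0 → b ∈ Icc (-B) B ∧ c ∈ Icc (-C) C ∧ d ∈ Icc (-D) D := by
    intro b c d hb
    obtain ⟨u, v, w⟩ := hsupp b c d hb
    exact ⟨abs_le.1 u, abs_le.1 v, abs_le.1 w⟩
  have key : ∀ (g : ℝ → ℝ) (M : ℝ), Measurable g → (∀ x, |g x| ≤ 1) →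
      (∀ x, g x ≠ 0 → x ∈ Icc (-M) M) → Integrable g := by
    intro g M hg hg1 hgs
    have : g = (Icc (-M) M).indicator g := by
      ext x
      by_cases hx : x ∈ Icc (-M) M
      · simp [hx]
      · rw [indicator_of_notMem hx]; by_contra hne; exact hx (hgs x hne)
    rw [this, integrable_indicator_iff measurableSet_Icc]
    exact Measure.integrableOn_of_bounded (M := 1) (by simp) hg.aestronglyMeasurable
      (ae_of_all _ fun x => hg1 x)
  have iB : ∀ c d, Integrable fun b => φ (b, c, d) := fun c d =>
    key _ B (by fun_prop) (fun x => hbd _) fun x hx => (hsuppI _ _ _ hx).1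
  have iC : ∀ b d, Integrable fun c => φ (b, c, d) := fun b d =>
    key _ C (by fun_prop) (fun x => hbd _) fun x hx => (hsuppI _ _ _ hx).2.1
  -- a function bounded by `e` and supported in `[-M, M]` has integral at most `2 M e`
  have bnd : ∀ (g : ℝ → ℝ) (M e : ℝ), 0 ≤ M → 0 ≤ e → (∀ x, |g x| ≤ e) →
      (∀ x, g x ≠ 0 → x ∈ Icc (-M) M) → |∫ x, g x| ≤ 2 * M * e := by
    intro g M e hM he hg hgs
    have : g = (Icc (-M) M).indicator g := by
      ext x
      by_cases hx : x ∈ Icc (-M) M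
      · simp [hx]
      · rw [indicator_of_notMem hx]; by_contra hne; exact hx (hgs x hne)
    rw [this, integral_indicator measurableSet_Icc]
    have := norm_setIntegral_le_of_norm_le_const (μ := volume) (s := Icc (-M) M) (f := g) (C := e)
      (by simp) (fun x _ => hg x)
    refine this.trans (le_of_eq ?_)
    rw [measureReal_def, Real.volume_Icc, ENNReal.toReal_ofReal (by linarith)]; ring
  have hinteg2 : Integrable fun b => ∫ p : ℝ × ℝ, φ (b, p) := hinteg.integral_prod_left
  have iCD : ∀ b, Integrable fun p : ℝ × ℝ => φ (b, p) := by
    intro b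
    have : (fun p : ℝ × ℝ => φ (b, p)) = (Icc (-C) C ×ˢ Icc (-D) D).indicator
        (fun p : ℝ × ℝ => φ (b, p)) := by
      ext ⟨x, y⟩
      by_cases hx : (x, y) ∈ Icc (-C) C ×ˢ Icc (-D) D
      · rw [indicator_of_mem hx]
      · rw [indicator_of_notMem hx]; by_contra hne; exact hx (hsuppI _ _ _ hne).2
    rw [this, integrable_indicator_iff (measurableSet_Icc.prod measurableSet_Icc)]
    exact Measure.integrableOn_of_bounded (M := 1)
      ((isCompact_Icc.prod isCompact_Icc).measure_lt_top.ne)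
      (hm.comp (g := φ) (f := fun p : ℝ × ℝ => (b, p)) (by fun_prop)).aestronglyMeasurable
      (ae_of_all _ fun x => hbd _)
  -- replace the sums by integrals one variable at a time
  have e1 : |∑ i ∈ I, ∑ j ∈ J, ∑ k ∈ K, φ ((i : ℝ), (j : ℝ), (k : ℝ)) -
      ∫ b, ∑ j ∈ J, ∑ k ∈ K, φ (b, (j : ℝ), (k : ℝ))| ≤ h * (J.card * K.card) := by
    rw [integral_finsetSum _ fun j _ => integrable_finsetSum _ fun k _ => iB _ _,
      Finset.sum_comm, ← Finset.sum_sub_distrib]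
    refine (Finset.abs_sum_le_sum_abs _ _).trans ?_
    have : ∀ j ∈ J, |∑ i ∈ I, ∑ k ∈ K, φ ((i : ℝ), (j : ℝ), (k : ℝ)) -
        ∫ b, ∑ k ∈ K, φ (b, (j : ℝ), (k : ℝ))| ≤ K.card * h := by
      intro j _
      rw [integral_finsetSum _ fun k _ => iB _ _, Finset.sum_comm, ← Finset.sum_sub_distrib]
      refine (Finset.abs_sum_le_sum_abs _ _).trans ?_
      refine (Finset.sum_le_sum fun (k : ℤ) _ => h1 (j : ℝ) (k : ℝ)).trans ?_
      simp
    refine (Finset.sum_le_sum this).trans ?_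
    simp only [Finset.sum_const, nsmul_eq_mul]
    exact le_of_eq (by ring)
  have i1 : Integrable fun b => ∑ j ∈ J, ∑ k ∈ K, φ (b, (j : ℝ), (k : ℝ)) :=
    integrable_finsetSum _ fun j _ => integrable_finsetSum _ fun k _ => iB _ _
  have hmK : ∀ k : ℝ, Integrable fun b => ∫ c, φ (b, c, k) := by
    intro k
    have : Integrable (fun p : ℝ × ℝ => φ (p.1, p.2, k)) := by
      have : (fun p : ℝ × ℝ => φ (p.1, p.2, k)) = (Icc (-B) B ×ˢ Icc (-C) C).indicator
          (fun p : ℝ × ℝ => φ (p.1, p.2, k)) := by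
        ext ⟨x, y⟩
        by_cases hx : (x, y) ∈ Icc (-B) B ×ˢ Icc (-C) C
        · rw [indicator_of_mem hx]
        · rw [indicator_of_notMem hx]; by_contra hne
          exact hx ⟨(hsuppI _ _ _ hne).1, (hsuppI _ _ _ hne).2.1⟩
      rw [this, integrable_indicator_iff (measurableSet_Icc.prod measurableSet_Icc)]
      exact Measure.integrableOn_of_bounded (M := 1)
        ((isCompact_Icc.prod isCompact_Icc).measure_lt_top.ne)
        (hm.comp (g := φ) (f := fun p : ℝ × ℝ => (p.1, p.2, k)) (by fun_prop)).aestronglyMeasurable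
        (ae_of_all _ fun x => hbd _)
    exact this.integral_prod_left
  have i2 : Integrable fun b => ∑ k ∈ K, ∫ c, φ (b, c, (k : ℝ)) :=
    integrable_finsetSum _ fun k _ => hmK k
  have e2 : |(∫ b, ∑ j ∈ J, ∑ k ∈ K, φ (b, (j : ℝ), (k : ℝ))) -
      ∫ b, ∑ k ∈ K, ∫ c, φ (b, c, (k : ℝ))| ≤ 2 * B * (K.card * h) := by
    rw [← integral_sub i1 i2]
    apply bnd _ B _ hB (by positivity)
    · intro b
      rw [Finset.sum_comm, ← Finset.sum_sub_distrib]
      refine (Finset.abs_sum_le_sum_abs _ _).trans ?_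
      refine (Finset.sum_le_sum fun (k : ℤ) _ => h2 b (k : ℝ)).trans ?_
      simp
    · intro b hne
      by_contra hb
      apply hne
      have : ∀ c d, φ (b, c, d) = 0 := fun c d => by
        by_contra h0; exact hb (hsuppI _ _ _ h0).1
      simp [this]
  have e3 : |(∫ b, ∑ k ∈ K, ∫ c, φ (b, c, (k : ℝ))) - ∫ b, ∫ p : ℝ × ℝ, φ (b, p)| ≤
      2 * B * (2 * C * h) := by
    rw [← integral_sub i2 hinteg2]
    apply bnd _ B _ hB (by positivity)
    · intro b
      rw [← integral_finsetSum K fun (k : ℤ) _ => iC b (k : ℝ)]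
      have : ∫ p : ℝ × ℝ, φ (b, p) = ∫ c, ∫ d, φ (b, c, d) := integral_prod _ (iCD b)
      rw [this, ← integral_sub (integrable_finsetSum K fun (k : ℤ) _ => iC b (k : ℝ))
        (iCD b).integral_prod_left]
      apply bnd _ C _ hC hh (fun c => h3 b c)
      intro c hne
      by_contra hb
      apply hne
      have : ∀ d, φ (b, c, d) = 0 := fun d => by
        by_contra h0; exact hb (hsuppI _ _ _ h0).2.1
      simp [this]
    · intro b hne
      by_contra hb
      apply hne
      have : ∀ p, φ (b, p) = 0 := fun p => by
        by_contra h0; exact hb (hsuppI _ _ _ h0).1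
      simp [this]
  have e4 : ∫ p, φ p = ∫ b, ∫ p : ℝ × ℝ, φ (b, p) := integral_prod _ hinteg
  rw [e4]
  refine (abs_sub_le _ _ _).trans ((add_le_add e1 ((abs_sub_le _ _ _).trans
    (add_le_add e2 e3))).trans (le_of_eq (by ring)))

/-- The frontier of `S ⊆ ℝ` has at most `n` points. -/
def FewEnds (n : ℕ) (S : Set ℝ) : Prop := ∃ F : Finset ℝ, F.card ≤ n ∧ frontier S ⊆ F

theorem FewEnds.inter {m n : ℕ} {S T : Set ℝ} (hS : FewEnds m S) (hT : FewEnds n T) :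
    FewEnds (m + n) (S ∩ T) := by
  obtain ⟨F, hF, hSF⟩ := hS
  obtain ⟨G, hG, hTG⟩ := hT
  refine ⟨F ∪ G, (Finset.card_union_le _ _).trans (add_le_add hF hG), ?_⟩
  refine (frontier_inter_subset S T).trans ?_
  rw [Finset.coe_union]
  exact union_subset_union (inter_subset_left.trans hSF) (inter_subset_right.trans hTG)

/-- `g` is a polynomial function of degree at most four. -/
def IsQuartic (g : ℝ → ℝ) : Prop :=
  ∃ e₀ e₁ e₂ e₃ e₄ : ℝ, ∀ t, g t = e₀ + e₁ * t + e₂ * t ^ 2 + e₃ * t ^ 3 + e₄ * t ^ 4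

theorem IsQuartic.exists_zeros {g : ℝ → ℝ} (hg : IsQuartic g) :
    (∃ e, ∀ t, g t = e) ∨ ∃ F : Finset ℝ, F.card ≤ 4 ∧ {t | g t = 0} ⊆ F := by
  obtain ⟨e₀, e₁, e₂, e₃, e₄, h⟩ := hg
  let p : Polynomial ℝ := Polynomial.C e₀ + Polynomial.C e₁ * Polynomial.X +
    Polynomial.C e₂ * Polynomial.X ^ 2 + Polynomial.C e₃ * Polynomial.X ^ 3 +
    Polynomial.C e₄ * Polynomial.X ^ 4
  have hp : ∀ t, p.eval t = g t := fun t => by simp [p, h]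
  have hd : p.natDegree ≤ 4 := by simp only [p]; compute_degree
  by_cases h0 : p = 0
  · left
    exact ⟨0, fun t => by rw [← hp, h0, Polynomial.eval_zero]⟩
  · right
    refine ⟨p.roots.toFinset, (Multiset.toFinset_card_le _).trans
      ((Polynomial.card_roots' p).trans hd), fun t ht => ?_⟩
    simp only [Finset.mem_coe, Multiset.mem_toFinset, Polynomial.mem_roots h0, Polynomial.IsRoot,
      hp]
    exact ht

theorem IsQuartic.continuous {g : ℝ → ℝ} (hg : IsQuartic g) : Continuous g := by
  obtain ⟨e₀, e₁, e₂, e₃, e₄, h⟩ := hg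
  rw [funext h]
  fun_prop

theorem IsQuartic.fewEnds_pos {g : ℝ → ℝ} (hg : IsQuartic g) : FewEnds 4 {t | 0 < g t} := by
  rcases hg.exists_zeros with ⟨e, he⟩ | ⟨F, hF, hz⟩
  · exact ⟨∅, by simp, by by_cases h : 0 < e <;> simp [he, h]⟩
  · refine ⟨F, hF, (frontier_lt_subset_eq continuous_const hg.continuous).trans
      (Subset.trans (fun t ht => ?_) hz)⟩
    exact ht.symm

theorem IsQuartic.fewEnds_nonneg {g : ℝ → ℝ} (hg : IsQuartic g) : FewEnds 4 {t | 0 ≤ g t} := by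
  rcases hg.exists_zeros with ⟨e, he⟩ | ⟨F, hF, hz⟩
  · exact ⟨∅, by simp, by by_cases h : 0 ≤ e <;> simp [he, h]⟩
  · refine ⟨F, hF, (frontier_le_subset_eq continuous_const hg.continuous).trans
      (Subset.trans (fun t ht => ?_) hz)⟩
    exact ht.symm

/-- A measurable region of `ℝ³` whose sections by axis-parallel lines have at most `n`
frontier points. -/
structure SliceRegion (n : ℕ) (R : Set (ℝ × ℝ × ℝ)) : Prop where
  meas : MeasurableSet R
  fst : ∀ c d, FewEnds n {b | (b, c, d) ∈ R}
  snd : ∀ b d, FewEnds n {c | (b, c, d) ∈ R}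
  thd : ∀ b c, FewEnds n {d | (b, c, d) ∈ R}

theorem SliceRegion.inter {m n : ℕ} {R T : Set (ℝ × ℝ × ℝ)} (hR : SliceRegion m R)
    (hT : SliceRegion n T) : SliceRegion (m + n) (R ∩ T) where
  meas := hR.meas.inter hT.meas
  fst c d := (hR.fst c d).inter (hT.fst c d)
  snd b d := (hR.snd b d).inter (hT.snd b d)
  thd b c := (hR.thd b c).inter (hT.thd b c)

/-- A continuous function on `ℝ³` which is a quartic polynomial in each variable separately. -/
structure SliceQuartic (q : ℝ × ℝ × ℝ → ℝ) : Prop where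
  cont : Continuous q
  fst : ∀ c d, IsQuartic fun b => q (b, c, d)
  snd : ∀ b d, IsQuartic fun c => q (b, c, d)
  thd : ∀ b c, IsQuartic fun d => q (b, c, d)

theorem SliceQuartic.pos {q : ℝ × ℝ × ℝ → ℝ} (hq : SliceQuartic q) :
    SliceRegion 4 {v | 0 < q v} where
  meas := measurableSet_lt measurable_const hq.cont.measurable
  fst c d := (hq.fst c d).fewEnds_pos
  snd b d := (hq.snd b d).fewEnds_pos
  thd b c := (hq.thd b c).fewEnds_pos

theorem SliceQuartic.nonneg {q : ℝ × ℝ × ℝ → ℝ} (hq : SliceQuartic q) :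
    SliceRegion 4 {v | 0 ≤ q v} where
  meas := measurableSet_le measurable_const hq.cont.measurable
  fst c d := (hq.fst c d).fewEnds_nonneg
  snd b d := (hq.snd b d).fewEnds_nonneg
  thd b c := (hq.thd b c).fewEnds_nonneg

/-- The integral points of a region of `ℝ³`. -/
def latticePoints (R : Set (ℝ × ℝ × ℝ)) : Set (ℤ × ℤ × ℤ) :=
  {v | ((v.1 : ℝ), (v.2.1 : ℝ), (v.2.2 : ℝ)) ∈ R}

theorem mem_Icc_neg_floor {n : ℤ} {B : ℝ} (h : |(n : ℝ)| ≤ B) : n ∈ Finset.Icc (-⌊B⌋) ⌊B⌋ := by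
  rw [Finset.mem_Icc, ← abs_le, Int.le_floor]
  push_cast
  exact h

theorem card_Icc_neg_floor_le {B : ℝ} (hB : 0 ≤ B) :
    ((Finset.Icc (-⌊B⌋) ⌊B⌋).card : ℝ) ≤ 2 * B + 1 := by
  have h0 : 0 ≤ ⌊B⌋ := Int.floor_nonneg.2 hB
  have h : ((Finset.Icc (-⌊B⌋) ⌊B⌋).card : ℤ) = 2 * ⌊B⌋ + 1 := by
    rw [Int.card_Icc, Int.toNat_of_nonneg (by omega)]; ring
  have h' : ((Finset.Icc (-⌊B⌋) ⌊B⌋).card : ℝ) = 2 * ⌊B⌋ + 1 := by exact_mod_cast h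
  rw [h']
  linarith [Int.floor_le B]

theorem latticePoints_subset_box {R : Set (ℝ × ℝ × ℝ)} {B C D : ℝ}
    (hbox : ∀ b c d, (b, c, d) ∈ R → |b| ≤ B ∧ |c| ≤ C ∧ |d| ≤ D) :
    latticePoints R ⊆ ((Finset.Icc (-⌊B⌋) ⌊B⌋) ×ˢ (Finset.Icc (-⌊C⌋) ⌊C⌋) ×ˢ
      (Finset.Icc (-⌊D⌋) ⌊D⌋) : Finset (ℤ × ℤ × ℤ)) := by
  rintro ⟨b, c, d⟩ hv
  obtain ⟨h1, h2, h3⟩ := hbox _ _ _ hv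
  simp only [Finset.coe_product, mem_prod, Finset.mem_coe]
  exact ⟨mem_Icc_neg_floor h1, mem_Icc_neg_floor h2, mem_Icc_neg_floor h3⟩

theorem SliceRegion.abs_ncard_sub_volume_le {n : ℕ} {R : Set (ℝ × ℝ × ℝ)} (hR : SliceRegion n R)
    {B C D : ℝ} (hB : 0 ≤ B) (hC : 0 ≤ C) (hD : 0 ≤ D)
    (hbox : ∀ b c d, (b, c, d) ∈ R → |b| ≤ B ∧ |c| ≤ C ∧ |d| ≤ D) :
    |((latticePoints R).ncard : ℝ) - volume.real R| ≤
      2 * n * ((2 * C + 1) * (2 * D + 1) + 2 * B * (2 * D + 1) + 2 * B * (2 * C)) := by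
  classical
  set φ : ℝ × ℝ × ℝ → ℝ := R.indicator 1 with hφ
  have hm : Measurable φ := measurable_one.indicator hR.meas
  have hbd : ∀ p, |φ p| ≤ 1 := fun p => by by_cases h : p ∈ R <;> simp [hφ, h]
  have hsupp : ∀ b c d, φ (b, c, d) ≠ 0 → |b| ≤ B ∧ |c| ≤ C ∧ |d| ≤ D := fun b c d h =>
    hbox b c d (mem_of_indicator_ne_zero h)
  have hfin : volume R ≠ ⊤ := by
    refine ((measure_mono (t := Icc (-B) B ×ˢ Icc (-C) C ×ˢ Icc (-D) D) ?_).trans_lt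
      (isCompact_Icc.prod (isCompact_Icc.prod isCompact_Icc)).measure_lt_top).ne
    rintro ⟨b, c, d⟩ h
    obtain ⟨h1, h2, h3⟩ := hbox b c d h
    exact ⟨abs_le.1 h1, abs_le.1 h2, abs_le.1 h3⟩
  have hinteg : Integrable φ := by
    rw [hφ, integrable_indicator_iff hR.meas]
    exact integrableOn_const hfin
  have slice : ∀ (S : Set ℝ) (M : ℝ), MeasurableSet S → FewEnds n S → (∀ t ∈ S, |t| ≤ M) →
      |∑ k ∈ Finset.Icc (-⌊M⌋) ⌊M⌋, S.indicator (1 : ℝ → ℝ) ((k : ℤ) : ℝ) -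
        ∫ t, S.indicator (1 : ℝ → ℝ) t| ≤ 2 * n := by
    intro S M hS ⟨F, hF, hfr⟩ hM
    refine (abs_sum_indicator_sub_integral_le hfr ?_ ?_).trans ?_
    · rw [integrable_indicator_iff hS]
      refine integrableOn_const ((measure_mono (t := Icc (-M) M) ?_).trans_lt
        isCompact_Icc.measure_lt_top).ne
      exact fun t ht => abs_le.1 (hM t ht)
    · intro k hk
      rw [Finset.mem_Icc, ← abs_le, Int.le_floor]
      push_cast
      exact hM _ hk
    · exact_mod_cast Nat.mul_le_mul_left 2 hF
  have main := abs_sum_sub_integral_le_of_slices (φ := φ) (h := 2 * n) (by positivity) hB hC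
    (I := Finset.Icc (-⌊B⌋) ⌊B⌋) (J := Finset.Icc (-⌊C⌋) ⌊C⌋) (K := Finset.Icc (-⌊D⌋) ⌊D⌋)
    hinteg hm hbd hsupp
    (fun c d => slice {b | (b, c, d) ∈ R} B
      (hR.meas.preimage (f := fun b : ℝ => (b, c, d)) (by fun_prop))
      (hR.fst c d) fun t ht => (hbox _ _ _ ht).1)
    (fun b d => slice {c | (b, c, d) ∈ R} C
      (hR.meas.preimage (f := fun c : ℝ => (b, c, d)) (by fun_prop))
      (hR.snd b d) fun t ht => (hbox _ _ _ ht).2.1)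
    (fun b c => slice {d | (b, c, d) ∈ R} D
      (hR.meas.preimage (f := fun d : ℝ => (b, c, d)) (by fun_prop))
      (hR.thd b c) fun t ht => (hbox _ _ _ ht).2.2)
  have hvol : ∫ p, φ p = volume.real R := by
    rw [hφ, integral_indicator_one hR.meas]
  have hcard : ((latticePoints R).ncard : ℝ) = ∑ i ∈ Finset.Icc (-⌊B⌋) ⌊B⌋,
      ∑ j ∈ Finset.Icc (-⌊C⌋) ⌊C⌋, ∑ k ∈ Finset.Icc (-⌊D⌋) ⌊D⌋,
        φ ((i : ℝ), (j : ℝ), (k : ℝ)) := by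
    have hset : latticePoints R = (((Finset.Icc (-⌊B⌋) ⌊B⌋) ×ˢ (Finset.Icc (-⌊C⌋) ⌊C⌋) ×ˢ
        (Finset.Icc (-⌊D⌋) ⌊D⌋)).filter fun v => v ∈ latticePoints R : Finset (ℤ × ℤ × ℤ)) := by
      ext v
      rw [Finset.mem_coe, Finset.mem_filter]
      exact ⟨fun h => ⟨latticePoints_subset_box hbox h, h⟩, fun h => h.2⟩
    rw [hset, ncard_coe_finset, Finset.card_filter]
    push_cast
    rw [Finset.sum_product]
    refine Finset.sum_congr rfl fun i _ => ?_
    rw [Finset.sum_product]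
    refine Finset.sum_congr rfl fun j _ => Finset.sum_congr rfl fun k _ => ?_
    by_cases h : ((i : ℝ), (j : ℝ), (k : ℝ)) ∈ R
    · rw [if_pos (show (i, j, k) ∈ latticePoints R from h), hφ, indicator_of_mem h]; rfl
    · rw [if_neg (show (i, j, k) ∉ latticePoints R from h), hφ, indicator_of_notMem h]
  rw [hvol, ← hcard] at main
  refine main.trans ?_
  have := card_Icc_neg_floor_le hC
  have := card_Icc_neg_floor_le hD
  gcongr

theorem abs_sum_cube_sub_le {m : ℝ} (hm : 0 < m) {N : ℕ}
    (hN : ∀ a : ℕ, (a : ℝ) ^ 2 < m → a ≤ N) :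
    |∑ a ∈ Finset.Icc 1 N, (if (a : ℝ) ^ 2 < m then (a : ℝ) ^ 3 else 0) - m ^ 2 / 4| ≤
      min (m ^ 2) (m ^ ((8 : ℝ) / 5)) := by
  set M := √m with hM
  have hM0 : 0 < M := Real.sqrt_pos.2 hm
  have hmM : m = M ^ 2 := (Real.sq_sqrt hm.le).symm
  have hlt : ∀ a : ℕ, (a : ℝ) ^ 2 < m ↔ (a : ℝ) < M := fun a => by
    rw [hmM]; exact pow_lt_pow_iff_left₀ (by positivity) hM0.le two_ne_zero
  set K : ℕ := ⌈M⌉₊ - 1 with hK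
  have hceil : 1 ≤ ⌈M⌉₊ := Nat.one_le_iff_ne_zero.2 (Nat.ceil_pos.2 hM0).ne'
  have hKlt : (K : ℝ) < M := by
    have : K < ⌈M⌉₊ := by omega
    exact Nat.lt_ceil.1 this
  have hMK : M ≤ K + 1 := by
    have : M ≤ (⌈M⌉₊ : ℝ) := Nat.le_ceil M
    have h2 : ((K + 1 : ℕ) : ℝ) = (⌈M⌉₊ : ℝ) := by congr 1; omega
    push_cast at h2; linarith
  have hsum : ∑ a ∈ Finset.Icc 1 N, (if (a : ℝ) ^ 2 < m then (a : ℝ) ^ 3 else 0) =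
      ∑ a ∈ Finset.Icc 1 K, (a : ℝ) ^ 3 := by
    rw [← Finset.sum_filter]
    refine Finset.sum_congr ?_ fun _ _ => rfl
    ext a
    simp only [Finset.mem_filter, Finset.mem_Icc, hlt]
    constructor
    · rintro ⟨⟨h1, _⟩, h3⟩
      exact ⟨h1, by have := Nat.lt_ceil.2 h3; omega⟩
    · rintro ⟨h1, h2⟩
      have h3 : (a : ℝ) < M := lt_of_le_of_lt (by exact_mod_cast h2) hKlt
      exact ⟨⟨h1, hN a ((hlt a).2 h3)⟩, h3⟩
  have hcube : ∀ n : ℕ, ∑ a ∈ Finset.Icc 1 n, (a : ℝ) ^ 3 = ((n : ℝ) * (n + 1)) ^ 2 / 4 := by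
    intro n
    induction n with
    | zero => simp
    | succ k ih => rw [Finset.sum_Icc_succ_top (by omega), ih]; push_cast; ring
  rw [hsum, hcube]
  have h85 : m ^ ((8 : ℝ) / 5) = M ^ ((16 : ℝ) / 5) := by
    rw [hmM, ← Real.rpow_natCast M 2, ← Real.rpow_mul hM0.le]; norm_num
  rcases le_or_gt M 1 with h1 | h1
  · have hK0 : K = 0 := by
      have : ⌈M⌉₊ ≤ 1 := Nat.ceil_le.2 (by simpa using h1)
      omega
    have h2 : m ^ 2 ≤ m ^ ((8 : ℝ) / 5) := by
      rw [← Real.rpow_natCast m 2]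
      exact Real.rpow_le_rpow_of_exponent_ge hm (by rw [hmM]; nlinarith) (by norm_num)
    rw [hK0, min_eq_left h2]
    have : 0 ≤ m ^ 2 := by positivity
    rw [abs_le]; constructor <;> simp <;> linarith
  · have hK0 : (0 : ℝ) ≤ K := K.cast_nonneg
    have h3 : |((K : ℝ) * (K + 1)) ^ 2 / 4 - m ^ 2 / 4| ≤ M ^ 3 := by
      have a1 : (K : ℝ) * (K + 1) ≤ M * (M + 1) := by nlinarith
      have a2 : (M - 1) * M ≤ (K : ℝ) * (K + 1) := by nlinarith
      have a3 : ((K : ℝ) * (K + 1)) ^ 2 ≤ (M * (M + 1)) ^ 2 :=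
        pow_le_pow_left₀ (by positivity) a1 2
      have a4 : ((M - 1) * M) ^ 2 ≤ ((K : ℝ) * (K + 1)) ^ 2 :=
        pow_le_pow_left₀ (by nlinarith) a2 2
      have a5 : M ^ 2 ≤ M ^ 3 := pow_le_pow_right₀ h1.le (by norm_num)
      rw [hmM, abs_le]
      constructor <;> nlinarith [sq_nonneg M]
    refine h3.trans (le_min ?_ ?_)
    · rw [hmM, ← pow_mul]; exact pow_le_pow_right₀ h1.le (by norm_num)
    · rw [h85, ← Real.rpow_natCast M 3]
      exact Real.rpow_le_rpow_of_exponent_le h1.le (by norm_num)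

/-- Half of the standard fundamental domain, in real coordinates, without its boundary. -/
def openHalfDomain : Set (ℝ × ℝ) := {p | 0 < p.1 ∧ p.1 < 1 / 2 ∧ 1 < p.1 ^ 2 + p.2 ^ 2 ∧ 0 < p.2}

/-- Half of the standard fundamental domain, in real coordinates, with its boundary. -/
def closedHalfDomain : Set (ℝ × ℝ) :=
  {p | 0 ≤ p.1 ∧ p.1 ≤ 1 / 2 ∧ 1 ≤ p.1 ^ 2 + p.2 ^ 2 ∧ 0 < p.2}

theorem measurableSet_openHalfDomain : MeasurableSet openHalfDomain :=
  (measurableSet_lt measurable_const measurable_fst).inter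
    ((measurableSet_lt measurable_fst measurable_const).inter
    ((measurableSet_lt (g := fun p : ℝ × ℝ => p.1 ^ 2 + p.2 ^ 2) measurable_const
      (by fun_prop)).inter
    (measurableSet_lt measurable_const measurable_snd)))

theorem measurableSet_closedHalfDomain : MeasurableSet closedHalfDomain :=
  (measurableSet_le measurable_const measurable_fst).inter
    ((measurableSet_le measurable_fst measurable_const).inter
    ((measurableSet_le (g := fun p : ℝ × ℝ => p.1 ^ 2 + p.2 ^ 2) measurable_const
      (by fun_prop)).inter
    (measurableSet_lt measurable_const measurable_snd)))

theorem openHalfDomain_subset_closedHalfDomain : openHalfDomain ⊆ closedHalfDomain :=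
  fun _ h => ⟨h.1.le, h.2.1.le, h.2.2.1.le, h.2.2.2⟩

theorem closedHalfDomain_ae_eq_openHalfDomain :
    closedHalfDomain =ᵐ[volume] openHalfDomain := by
  refine ae_eq_set.2 ⟨?_, by rw [sdiff_eq_empty.2 openHalfDomain_subset_closedHalfDomain,
    measure_empty]⟩
  rw [Measure.volume_eq_prod, Measure.measure_prod_null
    (measurableSet_closedHalfDomain.diff measurableSet_openHalfDomain)]
  filter_upwards [compl_mem_ae_iff.2 (Set.Finite.measure_zero (s := {(0 : ℝ), 1 / 2})
    (by simp) volume)] with x hx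
  simp only [mem_compl_iff, mem_insert_iff, mem_singleton_iff, not_or] at hx
  refine measure_mono_null (t := {√(1 - x ^ 2)}) ?_ (by simp)
  rintro y ⟨⟨h1, h2, h3, h4⟩, h5⟩
  have h1' : 0 < x := lt_of_le_of_ne h1 (Ne.symm hx.1)
  have h2' : x < 1 / 2 := lt_of_le_of_ne h2 hx.2
  have h6 : x ^ 2 + y ^ 2 = 1 := by
    refine le_antisymm (not_lt.1 fun h => h5 ⟨h1', h2', h, h4⟩) h3
  rw [mem_singleton_iff, eq_comm, Real.sqrt_eq_iff_eq_sq (by nlinarith) (le_of_lt h4)]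
  linarith

theorem openHalfDomain_subset_prod : openHalfDomain ⊆ Ioo 0 (1 / 2) ×ˢ Ioi (1 / 2) := by
  rintro ⟨x, y⟩ ⟨h1, h2, h3, h4⟩
  refine ⟨⟨h1, h2⟩, ?_⟩
  simp only [mem_Ioi] at *
  nlinarith

theorem integrableOn_rpow_neg_two {c : ℝ} (hc : 0 < c) :
    IntegrableOn (fun y : ℝ => y ^ (-2 : ℝ)) (Ioi c) :=
  integrableOn_Ioi_rpow_of_lt (by norm_num) hc

theorem integrableOn_openHalfDomain :
    IntegrableOn (fun p : ℝ × ℝ => p.2 ^ (-2 : ℝ)) openHalfDomain := by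
  refine IntegrableOn.mono_set ?_ openHalfDomain_subset_prod
  rw [IntegrableOn, Measure.volume_eq_prod, ← Measure.prod_restrict]
  have := Integrable.mul_prod (μ := volume.restrict (Ioo (0 : ℝ) (1 / 2)))
    (f := fun _ : ℝ => (1 : ℝ)) (integrable_const 1)
    (integrableOn_rpow_neg_two (c := 1 / 2) (by norm_num))
  simpa using this

theorem integral_openHalfDomain : ∫ p in openHalfDomain, p.2 ^ (-2 : ℝ) = π / 6 := by
  have key : ∀ x : ℝ, ∫ y, openHalfDomain.indicator (fun p : ℝ × ℝ => p.2 ^ (-2 : ℝ)) (x, y) =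
      (Ioc (0 : ℝ) (1 / 2)).indicator (fun x => 1 / √(1 - x ^ 2)) x -
      ({1 / 2} : Set ℝ).indicator (fun x => 1 / √(1 - x ^ 2)) x := by
    intro x
    by_cases hx : x ∈ Ioo (0 : ℝ) (1 / 2)
    · obtain ⟨h1, h2⟩ := hx
      have hpos : 0 < √(1 - x ^ 2) := Real.sqrt_pos.2 (by nlinarith)
      have e : (fun y => openHalfDomain.indicator (fun p : ℝ × ℝ => p.2 ^ (-2 : ℝ)) (x, y)) =
          (Ioi √(1 - x ^ 2)).indicator fun y => y ^ (-2 : ℝ) := by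
        ext y
        have : (x, y) ∈ openHalfDomain ↔ y ∈ Ioi √(1 - x ^ 2) := by
          simp only [openHalfDomain, mem_ofPred_eq, mem_Ioi, h1, h2, true_and]
          constructor
          · rintro ⟨h3, h4⟩
            rw [Real.sqrt_lt' h4]; linarith
          · intro h
            have h4 := hpos.trans h
            rw [Real.sqrt_lt' h4] at h
            exact ⟨by linarith, h4⟩
        by_cases hy : y ∈ Ioi √(1 - x ^ 2)
        · rw [indicator_of_mem hy, indicator_of_mem (this.2 hy)]
        · rw [indicator_of_notMem hy, indicator_of_notMem (mt this.1 hy)]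
      rw [e, integral_indicator measurableSet_Ioi, integral_Ioi_rpow_of_lt (by norm_num) hpos,
        indicator_of_mem (show x ∈ Ioc (0 : ℝ) (1 / 2) from ⟨h1, h2.le⟩),
        indicator_of_notMem (by simpa using h2.ne)]
      rw [show (-2 : ℝ) + 1 = -1 by norm_num, Real.rpow_neg_one]
      simp
    · have e : (fun y => openHalfDomain.indicator (fun p : ℝ × ℝ => p.2 ^ (-2 : ℝ)) (x, y)) =
          fun _ => 0 := by
        ext y
        exact indicator_of_notMem (fun h => hx ⟨h.1, h.2.1⟩) _
      rw [e, integral_zero]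
      by_cases h : x = 1 / 2
      · subst h; rw [indicator_of_mem (by norm_num), indicator_of_mem (by simp), sub_self]
      · rw [indicator_of_notMem fun h' => hx ⟨h'.1, lt_of_le_of_ne h'.2 h⟩,
          indicator_of_notMem (by simpa using h), sub_self]
  have hcont : ContinuousOn (fun x : ℝ => 1 / √(1 - x ^ 2)) (uIcc 0 (1 / 2)) := by
    refine continuousOn_const.div (by fun_prop) fun x hx => ?_
    rw [uIcc_of_le (by norm_num)] at hx
    exact (Real.sqrt_pos.2 (by nlinarith [hx.1, hx.2])).ne'
  have hftc : ∫ x in (0 : ℝ)..(1 / 2), 1 / √(1 - x ^ 2) = π / 6 := by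
    rw [intervalIntegral.integral_eq_sub_of_hasDerivAt (f := Real.arcsin)]
    · rw [Real.arcsin_zero, sub_zero, ← Real.sin_pi_div_six, Real.arcsin_sin] <;>
        linarith [Real.pi_pos]
    · intro x hx
      rw [uIcc_of_le (by norm_num)] at hx
      exact Real.hasDerivAt_arcsin (by linarith [hx.1]) (by linarith [hx.2])
    · exact hcont.intervalIntegrable
  rw [← integral_indicator measurableSet_openHalfDomain, Measure.volume_eq_prod, integral_prod]
  · simp_rw [key]
    have hz : ({1 / 2} : Set ℝ).indicator (fun x : ℝ => 1 / √(1 - x ^ 2)) =ᵐ[volume] 0 := by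
      filter_upwards [compl_mem_ae_iff.2 (Set.Finite.measure_zero (s := {(1 : ℝ) / 2})
        (by simp) volume)] with x hx
      exact indicator_of_notMem hx _
    rw [← hftc, intervalIntegral.integral_of_le (by norm_num),
      ← integral_indicator measurableSet_Ioc]
    refine integral_congr_ae ?_
    filter_upwards [hz] with x hx
    rw [hx]; simp
  · rw [← Measure.volume_eq_prod]
    exact (integrable_indicator_iff measurableSet_openHalfDomain).2 integrableOn_openHalfDomain

/-- The parameters `(t, x, y)` lying over the open half domain. -/
def paramDomain : Set (ℝ × ℝ × ℝ) := univ ×ˢ openHalfDomain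

/-- The part of `√|D| / a²` depending on the parameters only, up to a constant. -/
noncomputable def paramSize (v : ℝ × ℝ × ℝ) : ℝ := v.2.2 ^ 3 * (1 + v.1 ^ 2)

theorem measurableSet_paramDomain : MeasurableSet paramDomain :=
  MeasurableSet.univ.prod measurableSet_openHalfDomain

theorem volume_restrict_paramDomain : (volume : Measure (ℝ × ℝ × ℝ)).restrict paramDomain =
    (volume : Measure ℝ).prod (volume.restrict openHalfDomain) := by
  rw [paramDomain, Measure.volume_eq_prod, ← Measure.prod_restrict, Measure.restrict_univ]

theorem snd_snd_gt_of_mem_paramDomain {v : ℝ × ℝ × ℝ} (hv : v ∈ paramDomain) :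
    43 / 50 < v.2.2 := by
  obtain ⟨-, h1, h2, h3, h4⟩ := hv
  nlinarith

theorem paramSize_gt_of_mem_paramDomain {v : ℝ × ℝ × ℝ} (hv : v ∈ paramDomain) :
    1 / 2 < paramSize v := by
  have h := snd_snd_gt_of_mem_paramDomain hv
  have h3 : (43 / 50 : ℝ) ^ 3 < v.2.2 ^ 3 := pow_lt_pow_left₀ h (by norm_num) (by norm_num)
  rw [paramSize]
  nlinarith [sq_nonneg v.1]

theorem measurable_paramSize : Measurable paramSize := by
  unfold paramSize; fun_prop

theorem integrableOn_paramDomain_main :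
    IntegrableOn (fun v : ℝ × ℝ × ℝ => (1 + v.1 ^ 2)⁻¹ * v.2.2 ^ (-2 : ℝ)) paramDomain := by
  rw [IntegrableOn, volume_restrict_paramDomain]
  exact Integrable.mul_prod integrable_inv_one_add_sq integrableOn_openHalfDomain

theorem integral_paramDomain_main :
    ∫ v in paramDomain, (1 + v.1 ^ 2)⁻¹ * v.2.2 ^ (-2 : ℝ) = π * (π / 6) := by
  rw [volume_restrict_paramDomain, ← integral_openHalfDomain, ← integral_univ_inv_one_add_sq]
  exact integral_prod_mul (fun t : ℝ => (1 + t ^ 2)⁻¹) fun p : ℝ × ℝ => p.2 ^ (-2 : ℝ)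

theorem min_rpow_integral_le {Y : ℝ} (hY : 0 < Y) :
    IntegrableOn (fun y : ℝ => min (Y ^ 2 * y ^ (-2 : ℝ)) (Y ^ (8 / 5 : ℝ) * y ^ (-(4 / 5) : ℝ)))
      (Ioi 0) ∧
    ∫ y in Ioi 0, min (Y ^ 2 * y ^ (-2 : ℝ)) (Y ^ (8 / 5 : ℝ) * y ^ (-(4 / 5) : ℝ)) ≤
      6 * Y ^ (5 / 3 : ℝ) := by
  set g : ℝ → ℝ := fun y => min (Y ^ 2 * y ^ (-2 : ℝ)) (Y ^ (8 / 5 : ℝ) * y ^ (-(4 / 5) : ℝ))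
  set y₀ := Y ^ (1 / 3 : ℝ) with hy₀
  have hy₀0 : 0 < y₀ := by positivity
  have hgm : Measurable g := by fun_prop
  have hg0 : ∀ y ∈ Ioi (0 : ℝ), 0 ≤ g y := fun y (hy : 0 < y) =>
    le_min (by positivity) (by positivity)
  have i1 : IntegrableOn (fun y : ℝ => Y ^ (8 / 5 : ℝ) * y ^ (-(4 / 5) : ℝ)) (Ioc 0 y₀) := by
    refine Integrable.const_mul ?_ _
    exact (intervalIntegrable_iff_integrableOn_Ioc_of_le hy₀0.le).1
      (intervalIntegral.intervalIntegrable_rpow' (by norm_num))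
  have i2 : IntegrableOn (fun y : ℝ => Y ^ 2 * y ^ (-2 : ℝ)) (Ioi y₀) :=
    (integrableOn_rpow_neg_two hy₀0).const_mul _
  have j1 : IntegrableOn g (Ioc 0 y₀) := by
    refine i1.mono' hgm.aestronglyMeasurable ?_
    filter_upwards [ae_restrict_mem measurableSet_Ioc] with y hy
    rw [Real.norm_of_nonneg (hg0 y hy.1)]
    exact min_le_right _ _
  have j2 : IntegrableOn g (Ioi y₀) := by
    refine i2.mono' hgm.aestronglyMeasurable ?_
    filter_upwards [ae_restrict_mem measurableSet_Ioi] with y hy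
    rw [Real.norm_of_nonneg (hg0 y (hy₀0.trans hy))]
    exact min_le_left _ _
  have hun : Ioi (0 : ℝ) = Ioc 0 y₀ ∪ Ioi y₀ := (Ioc_union_Ioi_eq_Ioi hy₀0.le).symm
  refine ⟨by rw [hun]; exact j1.union j2, ?_⟩
  rw [hun, setIntegral_union (Ioc_disjoint_Ioi le_rfl) measurableSet_Ioi j1 j2]
  have k1 : ∫ y in Ioc 0 y₀, g y ≤ 5 * Y ^ (5 / 3 : ℝ) := by
    calc ∫ y in Ioc 0 y₀, g y ≤ ∫ y in Ioc 0 y₀, Y ^ (8 / 5 : ℝ) * y ^ (-(4 / 5) : ℝ) :=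
          setIntegral_mono j1 i1 fun y => min_le_right _ _
      _ = 5 * Y ^ (5 / 3 : ℝ) := by
          rw [integral_const_mul, ← intervalIntegral.integral_of_le hy₀0.le,
            integral_rpow (Or.inl (by norm_num)), hy₀, ← Real.rpow_mul hY.le,
            Real.zero_rpow (by norm_num),
            show (5 / 3 : ℝ) = 8 / 5 + 1 / 3 * (-(4 / 5) + 1) by norm_num, Real.rpow_add hY]
          ring
  have k2 : ∫ y in Ioi y₀, g y ≤ Y ^ (5 / 3 : ℝ) := by
    calc ∫ y in Ioi y₀, g y ≤ ∫ y in Ioi y₀, Y ^ 2 * y ^ (-2 : ℝ) :=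
          setIntegral_mono j2 i2 fun y => min_le_left _ _
      _ = Y ^ (5 / 3 : ℝ) := by
          rw [integral_const_mul, integral_Ioi_rpow_of_lt (by norm_num) hy₀0, hy₀,
            ← Real.rpow_mul hY.le, ← Real.rpow_natCast,
            show (5 / 3 : ℝ) = (2 : ℕ) + 1 / 3 * (-2 + 1) by norm_num, Real.rpow_add hY]
          ring
  linarith

theorem exists_integral_paramDomain_error : ∃ K : ℝ, ∀ Y : ℝ, 0 < Y →
    IntegrableOn (fun v : ℝ × ℝ × ℝ => v.2.2 * paramSize v *
      min ((Y / paramSize v) ^ 2) ((Y / paramSize v) ^ (8 / 5 : ℝ))) paramDomain ∧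
    ∫ v in paramDomain, v.2.2 * paramSize v *
      min ((Y / paramSize v) ^ 2) ((Y / paramSize v) ^ (8 / 5 : ℝ)) ≤ K * Y ^ (5 / 3 : ℝ) := by
  set f : ℝ → ℝ := fun t => (1 + t ^ 2) ^ (-(3 / 5) : ℝ)
  have hf : Integrable f := by
    have := integrable_rpow_neg_one_add_norm_sq (E := ℝ) (μ := volume) (r := 6 / 5)
      (by simp; norm_num)
    simp only [Real.norm_eq_abs, sq_abs] at this
    convert this using 3
    norm_num
  have hf0 : ∀ t, 0 ≤ f t := fun t => by positivity
  refine ⟨(∫ t, f t) * 3, fun Y hY => ?_⟩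
  obtain ⟨hg, hgI⟩ := min_rpow_integral_le hY
  set g : ℝ → ℝ := fun y => min (Y ^ 2 * y ^ (-2 : ℝ)) (Y ^ (8 / 5 : ℝ) * y ^ (-(4 / 5) : ℝ))
  have hg0 : ∀ y ∈ Ioi (0 : ℝ), 0 ≤ g y := fun y (hy : 0 < y) =>
    le_min (by positivity) (by positivity)
  set e : ℝ × ℝ × ℝ → ℝ := fun v => v.2.2 * paramSize v *
      min ((Y / paramSize v) ^ 2) ((Y / paramSize v) ^ (8 / 5 : ℝ))
  have hG : Integrable (fun p : ℝ × ℝ => g p.2)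
      ((volume.restrict (Ioo (0 : ℝ) (1 / 2))).prod (volume.restrict (Ioi (0 : ℝ)))) := by
    simpa using Integrable.mul_prod (μ := volume.restrict (Ioo (0 : ℝ) (1 / 2)))
      (f := fun _ : ℝ => (1 : ℝ)) (integrable_const 1) hg
  have hGI : ∫ p : ℝ × ℝ, g p.2 ∂((volume.restrict (Ioo (0 : ℝ) (1 / 2))).prod
      (volume.restrict (Ioi (0 : ℝ)))) ≤ 3 * Y ^ (5 / 3 : ℝ) := by
    have := integral_prod_mul (μ := volume.restrict (Ioo (0 : ℝ) (1 / 2)))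
      (ν := volume.restrict (Ioi (0 : ℝ))) (fun _ : ℝ => (1 : ℝ)) g
    simp only [one_mul] at this
    rw [this]
    simp
    linarith
  have hsub : openHalfDomain ⊆ Ioo 0 (1 / 2) ×ˢ Ioi 0 :=
    fun p h => ⟨⟨h.1, h.2.1⟩, h.2.2.2⟩
  have hG' : IntegrableOn (fun p : ℝ × ℝ => g p.2) (Ioo 0 (1 / 2) ×ˢ Ioi 0) := by
    rwa [IntegrableOn, Measure.volume_eq_prod, ← Measure.prod_restrict]
  have hGF : IntegrableOn (fun p : ℝ × ℝ => g p.2) openHalfDomain := hG'.mono_set hsub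
  have hGFI : ∫ p in openHalfDomain, g p.2 ≤ 3 * Y ^ (5 / 3 : ℝ) := by
    refine le_trans (setIntegral_mono_set hG' ?_ hsub.eventuallyLE) ?_
    · filter_upwards [ae_restrict_mem (measurableSet_Ioo.prod measurableSet_Ioi)] with p hp
      exact hg0 _ hp.2
    · rwa [Measure.volume_eq_prod, ← Measure.prod_restrict]
  have hFG : IntegrableOn (fun v : ℝ × ℝ × ℝ => f v.1 * g v.2.2) paramDomain := by
    rw [IntegrableOn, volume_restrict_paramDomain]
    exact Integrable.mul_prod hf hGF
  have hFGI : ∫ v in paramDomain, f v.1 * g v.2.2 ≤ (∫ t, f t) * 3 * Y ^ (5 / 3 : ℝ) := by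
    rw [volume_restrict_paramDomain,
      integral_prod_mul (μ := volume) (ν := volume.restrict openHalfDomain) f
      (fun p : ℝ × ℝ => g p.2), mul_assoc]
    exact mul_le_mul_of_nonneg_left hGFI (integral_nonneg hf0)
  have hpt : ∀ v ∈ paramDomain, 0 ≤ e v ∧ e v ≤ f v.1 * g v.2.2 := by
    intro v hv
    have hs : 0 < paramSize v := lt_trans (by norm_num) (paramSize_gt_of_mem_paramDomain hv)
    have hy : 0 < v.2.2 := lt_trans (by norm_num) (snd_snd_gt_of_mem_paramDomain hv)
    refine ⟨mul_nonneg (by positivity) (le_min (by positivity) (by positivity)), ?_⟩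
    set y := v.2.2
    set u := 1 + v.1 ^ 2 with hu
    have hu1 : 1 ≤ u := by nlinarith [sq_nonneg v.1]
    have hu0 : 0 < u := by linarith
    have hps₀ : paramSize v = y ^ 3 * u := rfl
    have hps : paramSize v = y ^ (3 : ℝ) * u := by
      rw [hps₀, show (3 : ℝ) = (3 : ℕ) by norm_num, Real.rpow_natCast]
    have hfu : f v.1 = u ^ (-(3 / 5) : ℝ) := rfl
    have h1 : y * paramSize v * (Y / paramSize v) ^ 2 = Y ^ 2 * y ^ (-2 : ℝ) * u ^ (-1 : ℝ) := by
      rw [Real.rpow_neg hy.le, Real.rpow_neg hu0.le, hps₀, Real.rpow_one,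
        show (2 : ℝ) = (2 : ℕ) by norm_num, Real.rpow_natCast]
      field_simp
    have h2 : y * paramSize v * (Y / paramSize v) ^ (8 / 5 : ℝ) =
        Y ^ (8 / 5 : ℝ) * y ^ (-(4 / 5) : ℝ) * u ^ (-(3 / 5) : ℝ) := by
      rw [hps, Real.div_rpow hY.le (by positivity), Real.mul_rpow (by positivity) hu0.le,
        ← Real.rpow_mul hy.le,
        show (-(4 / 5) : ℝ) = 1 + 3 - 3 * (8 / 5) by norm_num,
        show (-(3 / 5) : ℝ) = 1 - 8 / 5 by norm_num, Real.rpow_sub hy, Real.rpow_sub hu0,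
        Real.rpow_add hy, Real.rpow_one, Real.rpow_one]
      field_simp
    change y * paramSize v * _ ≤ _
    rw [mul_min_of_nonneg _ _ (by positivity), h1, h2, hfu]
    change _ ≤ _ * min _ _
    rw [mul_min_of_nonneg _ _ (by positivity)]
    refine min_le_min ?_ (by rw [mul_comm])
    rw [mul_comm]
    refine mul_le_mul_of_nonneg_right ?_ (by positivity)
    exact Real.rpow_le_rpow_of_exponent_le hu1 (by norm_num)
  have he : IntegrableOn e paramDomain := by
    refine hFG.mono' ?_ ?_
    · have := measurable_paramSize
      exact Measurable.aestronglyMeasurable (by fun_prop)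
    · filter_upwards [ae_restrict_mem measurableSet_paramDomain] with v hv
      rw [Real.norm_of_nonneg (hpt v hv).1]
      exact (hpt v hv).2
  exact ⟨he, (setIntegral_mono_on he hFG measurableSet_paramDomain
    fun v hv => (hpt v hv).2).trans hFGI⟩

/-- The parameters with `a² · paramSize < Y`. -/
def paramRegion (a Y : ℝ) : Set (ℝ × ℝ × ℝ) := paramDomain ∩ {v | a ^ 2 * paramSize v < Y}

theorem measurableSet_paramRegion (a Y : ℝ) : MeasurableSet (paramRegion a Y) :=
  measurableSet_paramDomain.inter (measurableSet_lt
    (measurable_paramSize.const_mul _) measurable_const)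

theorem exists_sum_integral_paramRegion : ∃ K : ℝ, ∀ Y : ℝ, 0 < Y → ∀ N : ℕ,
    (∀ a : ℕ, (a : ℝ) ^ 2 < 2 * Y → a ≤ N) →
    |∑ a ∈ Finset.Icc 1 N, (a : ℝ) ^ 3 * (∫ v in paramRegion a Y, v.2.2 * paramSize v) -
      π ^ 2 / 24 * Y ^ 2| ≤ K * Y ^ (5 / 3 : ℝ) := by
  obtain ⟨K, hK⟩ := exists_integral_paramDomain_error
  refine ⟨K, fun Y hY N hN => ?_⟩
  obtain ⟨hE, hEI⟩ := hK Y hY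
  have hs : ∀ v ∈ paramDomain, 0 < paramSize v := fun v hv =>
    lt_trans (by norm_num) (paramSize_gt_of_mem_paramDomain hv)
  have hy : ∀ v ∈ paramDomain, 0 < v.2.2 := fun v hv =>
    lt_trans (by norm_num) (snd_snd_gt_of_mem_paramDomain hv)
  set φ : ℕ → ℝ × ℝ × ℝ → ℝ := fun a v =>
    v.2.2 * paramSize v * (if (a : ℝ) ^ 2 < Y / paramSize v then (a : ℝ) ^ 3 else 0)
  set ψ : ℝ × ℝ × ℝ → ℝ := fun v => v.2.2 * paramSize v * ((Y / paramSize v) ^ 2 / 4)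
  have hψe : EqOn ψ (fun v => Y ^ 2 / 4 * ((1 + v.1 ^ 2)⁻¹ * v.2.2 ^ (-2 : ℝ))) paramDomain := by
    intro v hv
    have h1 := hy v hv
    simp only [ψ, paramSize]
    have h2 : 0 < 1 + v.1 ^ 2 := by positivity
    rw [Real.rpow_neg h1.le, show (2 : ℝ) = (2 : ℕ) by norm_num, Real.rpow_natCast]
    field_simp
  have hψ : IntegrableOn ψ paramDomain :=
    (integrableOn_congr_fun hψe measurableSet_paramDomain).2
      (integrableOn_paramDomain_main.const_mul _)
  have hψI : ∫ v in paramDomain, ψ v = π ^ 2 / 24 * Y ^ 2 := by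
    rw [setIntegral_congr_fun measurableSet_paramDomain hψe, integral_const_mul,
      integral_paramDomain_main]
    ring
  have hφm : ∀ a, Measurable (φ a) := fun a => by
    have hm := measurable_paramSize
    refine Measurable.mul (by fun_prop) (Measurable.ite ?_ measurable_const measurable_const)
    exact measurableSet_lt measurable_const (by fun_prop)
  have hφ : ∀ a ∈ Finset.Icc 1 N, IntegrableOn (φ a) paramDomain := by
    intro a ha
    have ha1 : (1 : ℝ) ≤ a := by exact_mod_cast (Finset.mem_Icc.1 ha).1
    refine (hψ.const_mul (4 * (a : ℝ) ^ 3)).mono' (hφm a).aestronglyMeasurable ?_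
    filter_upwards [ae_restrict_mem measurableSet_paramDomain] with v hv
    have h1 := hs v hv
    have h2 := hy v hv
    simp only [φ, ψ]
    split_ifs with h
    · rw [Real.norm_of_nonneg (by positivity)]
      have h3 : 1 ≤ Y / paramSize v := by nlinarith
      have h4 : 1 ≤ (Y / paramSize v) ^ 2 := one_le_pow₀ h3
      calc v.2.2 * paramSize v * (a : ℝ) ^ 3
          ≤ v.2.2 * paramSize v * (a : ℝ) ^ 3 * (Y / paramSize v) ^ 2 :=
            le_mul_of_one_le_right (by positivity) h4
        _ = _ := by ring
    · rw [mul_zero, norm_zero]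
      positivity
  have hφI : ∀ a ∈ Finset.Icc 1 N, (a : ℝ) ^ 3 * ∫ v in paramRegion a Y, v.2.2 * paramSize v =
      ∫ v in paramDomain, φ a v := by
    intro a ha
    rw [paramRegion, ← integral_const_mul, ← setIntegral_indicator
      (measurableSet_lt (measurable_paramSize.const_mul _) measurable_const)]
    refine setIntegral_congr_fun measurableSet_paramDomain fun v hv => ?_
    have h1 := hs v hv
    simp only [φ, lt_div_iff₀ h1]
    by_cases h : (a : ℝ) ^ 2 * paramSize v < Y
    · rw [indicator_of_mem (show v ∈ {v | (a : ℝ) ^ 2 * paramSize v < Y} from h), if_pos h,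
        mul_comm]
    · rw [indicator_of_notMem (show v ∉ {v | (a : ℝ) ^ 2 * paramSize v < Y} from h), if_neg h,
        mul_zero]
  rw [Finset.sum_congr rfl hφI, ← integral_finsetSum _ hφ, ← hψI,
    ← integral_sub (integrable_finsetSum _ hφ) hψ]
  refine (abs_integral_le_integral_abs).trans (le_trans (setIntegral_mono_on ?_ hE
    measurableSet_paramDomain fun v hv => ?_) hEI)
  · exact ((integrable_finsetSum _ hφ).sub hψ).abs
  · have h1 := hs v hv
    have h2 := hy v hv
    simp only [φ, ψ]
    rw [← Finset.mul_sum, ← mul_sub, abs_mul, abs_of_pos (by positivity)]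
    refine mul_le_mul_of_nonneg_left (abs_sum_cube_sub_le (by positivity) fun a ha =>
      hN a (ha.trans ?_)) (by positivity)
    rw [div_lt_iff₀ h1]
    nlinarith [paramSize_gt_of_mem_paramDomain hv]

theorem det_prod_prod (f : ℝ × ℝ × ℝ →L[ℝ] ℝ × ℝ × ℝ) : f.det =
    Matrix.det !![(f (1, 0, 0)).1, (f (0, 1, 0)).1, (f (0, 0, 1)).1;
      (f (1, 0, 0)).2.1, (f (0, 1, 0)).2.1, (f (0, 0, 1)).2.1;
      (f (1, 0, 0)).2.2, (f (0, 1, 0)).2.2, (f (0, 0, 1)).2.2] := by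
  let e : (ℝ × ℝ × ℝ) ≃ₗ[ℝ] (Fin 3 → ℝ) :=
    { toFun := fun v => ![v.1, v.2.1, v.2.2]
      invFun := fun w => (w 0, w 1, w 2)
      map_add' := fun v w => by ext i; fin_cases i <;> rfl
      map_smul' := fun c v => by ext i; fin_cases i <;> rfl
      left_inv := fun v => rfl
      right_inv := fun w => by ext i; fin_cases i <;> rfl }
  let b : Module.Basis (Fin 3) ℝ (ℝ × ℝ × ℝ) := Module.Basis.ofEquivFun e
  have hb : ∀ i, b i = ((Pi.single i 1 : Fin 3 → ℝ) 0, (Pi.single i 1 : Fin 3 → ℝ) 1,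
      (Pi.single i 1 : Fin 3 → ℝ) 2) := fun i => by
    simp only [b, Module.Basis.coe_ofEquivFun]; rfl
  have hr : ∀ v i, b.repr v i = ![v.1, v.2.1, v.2.2] i := fun v i => rfl
  rw [ContinuousLinearMap.det, ← LinearMap.det_toMatrix b]
  congr 1
  ext i j
  rw [LinearMap.toMatrix_apply, hr, hb]
  fin_cases i <;> fin_cases j <;> simp

theorem volume_real_image {f : ℝ × ℝ × ℝ → ℝ × ℝ × ℝ} {f' : ℝ × ℝ × ℝ → ℝ × ℝ × ℝ →L[ℝ] ℝ × ℝ × ℝ}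
    {S : Set (ℝ × ℝ × ℝ)} (hS : MeasurableSet S) (hf : ∀ v, HasFDerivAt f (f' v) v)
    (hinj : InjOn f S) : volume.real (f '' S) = ∫ v in S, |(f' v).det| := by
  have : (volume : Measure (ℝ × ℝ)).IsAddHaarMeasure :=
    Measure.prod.instIsAddHaarMeasure volume volume
  have : (volume : Measure (ℝ × ℝ × ℝ)).IsAddHaarMeasure :=
    Measure.prod.instIsAddHaarMeasure volume volume
  have := integral_image_eq_integral_abs_det_fderiv_smul volume hS
    (fun v _ => (hf v).hasFDerivWithinAt) hinj fun _ => (1 : ℝ)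
  simpa using this

/-- The discriminant of the real binary cubic form `(a, b, c, d)`. -/
def discR (a : ℝ) (u : ℝ × ℝ × ℝ) : ℝ :=
  u.1 ^ 2 * u.2.1 ^ 2 - 4 * a * u.2.1 ^ 3 - 4 * u.1 ^ 3 * u.2.2 - 27 * a ^ 2 * u.2.2 ^ 2 +
    18 * a * u.1 * u.2.1 * u.2.2

/-- `(b', c', d')` are the last coefficients, and `a'` the first, of the twisted transform of
`(a, b, c, d)` by a matrix `(p, q; r, s)` of determinant `±1`. -/
def Transforms (p q r s a : ℝ) (u : ℝ × ℝ × ℝ) (a' : ℝ) (u' : ℝ × ℝ × ℝ) : Prop :=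
  a' = (p * s - q * r) * (a * p ^ 3 + u.1 * p ^ 2 * q + u.2.1 * p * q ^ 2 + u.2.2 * q ^ 3) ∧
  u'.1 = (p * s - q * r) * (3 * a * p ^ 2 * r + u.1 * (p ^ 2 * s + 2 * p * q * r) +
    u.2.1 * (q ^ 2 * r + 2 * p * q * s) + 3 * u.2.2 * q ^ 2 * s) ∧
  u'.2.1 = (p * s - q * r) * (3 * a * p * r ^ 2 + u.1 * (q * r ^ 2 + 2 * p * r * s) +
    u.2.1 * (p * s ^ 2 + 2 * q * r * s) + 3 * u.2.2 * q * s ^ 2) ∧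
  u'.2.2 = (p * s - q * r) * (a * r ^ 3 + u.1 * r ^ 2 * s + u.2.1 * r * s ^ 2 + u.2.2 * s ^ 3)

/-- A chart for the real binary cubic forms of positive leading coefficient whose discriminant has
the sign `σ`. The parameters `(t, x, y)` of a form include the real and imaginary part of a complex
point `x + iy` of the upper half plane, the zero of the covariant `cov`; the functions `q₁`, `q₂`,
`q₃` detect membership of that point in half of the standard fundamental domain. -/
structure FormChart (σ κ J : ℝ) where
  chart : ℝ → ℝ × ℝ × ℝ → ℝ × ℝ × ℝ
  q₁ : ℝ → ℝ × ℝ × ℝ → ℝ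
  q₂ : ℝ → ℝ × ℝ × ℝ → ℝ
  q₃ : ℝ → ℝ × ℝ × ℝ → ℝ
  slice₁ : ∀ a, SliceQuartic (q₁ a)
  slice₂ : ∀ a, SliceQuartic (q₂ a)
  slice₃ : ∀ a, SliceQuartic (q₃ a)
  disc : ∀ a v, σ * discR a (chart a v) = (κ * (a ^ 2 * paramSize v)) ^ 2
  sign₁ : ∀ a v, 0 < a → 0 < v.2.2 → ∃ k > 0, q₁ a (chart a v) = k * v.2.1
  sign₂ : ∀ a v, 0 < a → 0 < v.2.2 → ∃ k > 0, q₂ a (chart a v) = k * (1 / 2 - v.2.1)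
  sign₃ : ∀ a v, 0 < a → 0 < v.2.2 →
    ∃ k > 0, q₃ a (chart a v) = k * (v.2.1 ^ 2 + v.2.2 ^ 2 - 1)
  injOn : ∀ a, 0 < a → InjOn (chart a) {v | 0 < v.2.2}
  surj : ∀ a u, 0 < a → 0 < σ * discR a u → ∃ v, 0 < v.2.2 ∧ chart a v = u
  vol : ∀ a S, 0 < a → MeasurableSet S → S ⊆ {v | 0 < v.2.2} →
    volume.real (chart a '' S) = J * a ^ 3 * ∫ v in S, v.2.2 * paramSize v
  bound₁ : ∀ a v, 0 < a → |v.2.1| ≤ 1 / 2 → 43 / 50 ≤ v.2.2 →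
    |(chart a v).1| ≤ 9 * (a * v.2.2 * (1 + |v.1|))
  bound₂ : ∀ a v, 0 < a → |v.2.1| ≤ 1 / 2 → 43 / 50 ≤ v.2.2 →
    |(chart a v).2.1| ≤ 9 * (a * v.2.2 ^ 2 * (1 + |v.1|))
  bound₃ : ∀ a v, 0 < a → |v.2.1| ≤ 1 / 2 → 43 / 50 ≤ v.2.2 →
    |(chart a v).2.2| ≤ 9 * (a * v.2.2 ^ 3 * (1 + |v.1|))
  cov : ℝ → ℝ × ℝ × ℝ → ℂ → ℂ → ℂ
  cov_smul : ∀ a u z w k, k ≠ 0 → (cov a u (k * z) (k * w) = 0 ↔ cov a u z w = 0)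
  cov_transforms : ∀ p q r s a u a' u' z w, (p * s - q * r) ^ 2 = 1 →
    Transforms p q r s a u a' u' →
    (cov a' u' z w = 0 ↔ cov a u (p * z + r * w) (q * z + s * w) = 0)
  cov_neg : ∀ a u z w, cov (-a) (-u) z w = 0 ↔ cov a u z w = 0
  cov_chart : ∀ a v (z : ℂ), 0 < a → 0 < v.2.2 → 0 < z.im →
    (cov a (chart a v) z 1 = 0 ↔ z.re = v.2.1 ∧ z.im = v.2.2)
  cov_conj : ∀ a u z w,
    cov a u (starRingEnd ℂ z) (starRingEnd ℂ w) = starRingEnd ℂ (cov a u z w)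

/-- The form `a (X - rY)(X² - 2xXY + (x² + y²)Y²)` with `r = yt + x`, without its first
coefficient. -/
def negMap (a : ℝ) (v : ℝ × ℝ × ℝ) : ℝ × ℝ × ℝ :=
  (-a * (v.2.2 * v.1 + 3 * v.2.1),
    a * (3 * v.2.1 ^ 2 + v.2.2 ^ 2 + 2 * (v.2.2 * v.1) * v.2.1),
    -a * (v.2.2 * v.1 + v.2.1) * (v.2.1 ^ 2 + v.2.2 ^ 2))

theorem negMap_injOn {a : ℝ} (ha : 0 < a) : InjOn (negMap a) {v | 0 < v.2.2} := by
  rintro ⟨t, x, y⟩ (hy : 0 < y) ⟨t', x', y'⟩ (hy' : 0 < y') h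
  simp only [negMap, Prod.mk.injEq] at h
  obtain ⟨h1, h2, h3⟩ := h
  have e1 : y * t + 3 * x = y' * t' + 3 * x' := mul_left_cancel₀ (neg_ne_zero.2 ha.ne') h1
  have e2 := mul_left_cancel₀ ha.ne' h2
  have e3 : (y * t + x) * (x ^ 2 + y ^ 2) = (y' * t' + x') * (x' ^ 2 + y' ^ 2) :=
    mul_left_cancel₀ (neg_ne_zero.2 ha.ne') (by linarith)
  have hr : y * t + x = y' * t' + x' := by
    have hz : (y * t + x - (y' * t' + x')) * ((y * t + x - x') ^ 2 + y' ^ 2) = 0 := by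
      linear_combination (y * t + x) ^ 2 * e1 - (y * t + x) * e2 + e3
    have hp : (y * t + x - x') ^ 2 + y' ^ 2 ≠ 0 := by positivity
    linarith [(mul_eq_zero.1 hz).resolve_right hp]
  have hx : x = x' := by linarith
  subst hx
  have hty : y * t = y' * t' := by linarith
  have hyy : y ^ 2 = y' ^ 2 := by
    linear_combination e2 - 2 * x * hty
  have hy2 : y = y' := (pow_left_inj₀ hy.le hy'.le two_ne_zero).1 hyy
  subst hy2
  rw [mul_left_cancel₀ hy.ne' hty]

theorem exists_real_cubic_root {a : ℝ} (ha : 0 < a) (b c d : ℝ) :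
    ∃ r : ℝ, a * r ^ 3 + b * r ^ 2 + c * r + d = 0 := by
  set M := 1 + (|b| + |c| + |d|) / a with hM
  have hM1 : 1 ≤ M := by
    have : 0 ≤ (|b| + |c| + |d|) / a := by positivity
    linarith
  have haM : a * M = a + |b| + |c| + |d| := by rw [hM]; field_simp; ring
  have hM2 : 1 ≤ M ^ 2 := one_le_pow₀ hM1
  have key : |b| * M ^ 2 + |c| * M + |d| ≤ a * M ^ 3 := by
    have h1 : a * M ^ 3 = (a + |b| + |c| + |d|) * M ^ 2 := by rw [← haM]; ring
    rw [h1]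
    have h2 : M ≤ M ^ 2 := by nlinarith
    have h3 : |c| * M ≤ |c| * M ^ 2 := mul_le_mul_of_nonneg_left h2 (abs_nonneg c)
    have h4 : |d| ≤ |d| * M ^ 2 := le_mul_of_one_le_right (abs_nonneg d) hM2
    nlinarith [mul_pos ha (by linarith : 0 < M ^ 2)]
  have hb := abs_le.1 (le_refl |b|)
  have hc := abs_le.1 (le_refl |c|)
  have hd := abs_le.1 (le_refl |d|)
  have hcont : ContinuousOn (fun r : ℝ => a * r ^ 3 + b * r ^ 2 + c * r + d) (Icc (-M) M) := by
    fun_prop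
  obtain ⟨r, -, hr⟩ := intermediate_value_Icc (by linarith) hcont
    (show (0 : ℝ) ∈ Icc _ _ by
      constructor
      · have e1 : b * M ^ 2 ≤ |b| * M ^ 2 := mul_le_mul_of_nonneg_right hb.2 (by linarith)
        have e2 : -|c| * M ≤ c * M := mul_le_mul_of_nonneg_right hc.1 (by linarith)
        show a * (-M) ^ 3 + b * (-M) ^ 2 + c * (-M) + d ≤ 0
        nlinarith [hd.2]
      · have e1 : -|b| * M ^ 2 ≤ b * M ^ 2 := mul_le_mul_of_nonneg_right hb.1 (by linarith)
        have e2 : -|c| * M ≤ c * M := mul_le_mul_of_nonneg_right hc.1 (by linarith)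
        show 0 ≤ a * M ^ 3 + b * M ^ 2 + c * M + d
        nlinarith [hd.1])
  exact ⟨r, hr⟩

theorem negMap_surj {a : ℝ} (u : ℝ × ℝ × ℝ) (ha : 0 < a) (h : 0 < -1 * discR a u) :
    ∃ v : ℝ × ℝ × ℝ, 0 < v.2.2 ∧ negMap a v = u := by
  obtain ⟨b, c, d⟩ := u
  obtain ⟨r, hr⟩ := exists_real_cubic_root ha b c d
  set x := -(b / a + r) / 2 with hx
  set q := c / a - 2 * r * x with hq
  have hb : b = -a * (r + 2 * x) := by rw [hx]; field_simp; ring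
  have hc : c = a * (q + 2 * r * x) := by rw [hq]; field_simp; ring
  have hd : d = -a * r * q := by
    rw [hb, hc] at hr
    linear_combination hr
  have hD : -1 * discR a (b, c, d) =
      4 * a ^ 4 * ((q - x ^ 2) * (q - 2 * r * x + r ^ 2) ^ 2) := by
    rw [discR, hb, hc, hd]; ring
  have hpos : 0 < q - x ^ 2 := by
    rw [hD] at h
    have h2 := (mul_pos_iff_of_pos_left (show 0 < 4 * a ^ 4 by positivity)).1 h
    exact pos_of_mul_pos_left h2 (sq_nonneg _)
  have hy : 0 < √(q - x ^ 2) := Real.sqrt_pos.2 hpos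
  have hy2 : √(q - x ^ 2) ^ 2 = q - x ^ 2 := Real.sq_sqrt hpos.le
  refine ⟨((r - x) / √(q - x ^ 2), x, √(q - x ^ 2)), hy, ?_⟩
  have hm : √(q - x ^ 2) * ((r - x) / √(q - x ^ 2)) = r - x := mul_div_cancel₀ _ hy.ne'
  simp only [negMap, hm, hy2, Prod.mk.injEq]
  refine ⟨?_, ?_, ?_⟩
  · rw [hb]; ring
  · rw [hc]; ring
  · rw [hd]; ring

theorem hasFDerivAt_coords (v : ℝ × ℝ × ℝ) :
    HasFDerivAt (fun v : ℝ × ℝ × ℝ => v.1) (ContinuousLinearMap.fst ℝ ℝ (ℝ × ℝ)) v ∧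
    HasFDerivAt (fun v : ℝ × ℝ × ℝ => v.2.1) ((ContinuousLinearMap.fst ℝ ℝ ℝ).comp
      (ContinuousLinearMap.snd ℝ ℝ (ℝ × ℝ))) v ∧
    HasFDerivAt (fun v : ℝ × ℝ × ℝ => v.2.2) ((ContinuousLinearMap.snd ℝ ℝ ℝ).comp
      (ContinuousLinearMap.snd ℝ ℝ (ℝ × ℝ))) v :=
  ⟨hasFDerivAt_fst, ((ContinuousLinearMap.fst ℝ ℝ ℝ).comp
      (ContinuousLinearMap.snd ℝ ℝ (ℝ × ℝ))).hasFDerivAt, ((ContinuousLinearMap.snd ℝ ℝ ℝ).comp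
      (ContinuousLinearMap.snd ℝ ℝ (ℝ × ℝ))).hasFDerivAt⟩

theorem negMap_vol {a : ℝ} {S : Set (ℝ × ℝ × ℝ)} (ha : 0 < a) (hS : MeasurableSet S)
    (hpos : S ⊆ {v | 0 < v.2.2}) :
    volume.real (negMap a '' S) = 4 * a ^ 3 * ∫ v in S, v.2.2 * paramSize v := by
  have hder : ∀ v, ∃ f' : ℝ × ℝ × ℝ →L[ℝ] ℝ × ℝ × ℝ, HasFDerivAt (negMap a) f' v ∧
      f'.det = 4 * a ^ 3 * (v.2.2 * paramSize v) := by
    intro v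
    obtain ⟨ht, hx, hy⟩ := hasFDerivAt_coords v
    have h1 := ((hy.mul ht).add (hx.const_mul 3)).const_mul (-a)
    have h2 := ((((hx.pow 2).const_mul 3).add (hy.pow 2)).add
      (((hy.mul ht).const_mul 2).mul hx)).const_mul a
    have h3 := (((hy.mul ht).add hx).const_mul (-a)).mul ((hx.pow 2).add (hy.pow 2))
    refine ⟨_, h1.prodMk (h2.prodMk h3), ?_⟩
    rw [det_prod_prod, Matrix.det_fin_three, paramSize]
    simp
    ring
  choose f' hf' hdet using hder
  rw [volume_real_image hS hf' ((negMap_injOn ha).mono hpos), ← integral_const_mul]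
  refine setIntegral_congr_fun hS fun v hv => ?_
  have hy : 0 < v.2.2 := hpos hv
  show |(f' v).det| = _
  rw [hdet, abs_of_nonneg]
  rw [paramSize]
  positivity

theorem neg_transforms (p q r s a : ℝ) (u : ℝ × ℝ × ℝ) (a' : ℝ) (u' : ℝ × ℝ × ℝ) (z w : ℂ)
    (hT : Transforms p q r s a u a' u') :
    a' * z ^ 3 + u'.1 * z ^ 2 * w + u'.2.1 * z * w ^ 2 + u'.2.2 * w ^ 3 =
      (p * s - q * r) * (a * (p * z + r * w) ^ 3 + u.1 * (p * z + r * w) ^ 2 * (q * z + s * w) +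
        u.2.1 * (p * z + r * w) * (q * z + s * w) ^ 2 + u.2.2 * (q * z + s * w) ^ 3) := by
  obtain ⟨h1, h2, h3, h4⟩ := hT
  rw [h1, h2, h3, h4]
  push_cast
  ring

theorem negMap_cov {a : ℝ} {v : ℝ × ℝ × ℝ} {z : ℂ} (ha : 0 < a) (hy : 0 < v.2.2)
    (hz : 0 < z.im) :
    (a * z ^ 3 + (negMap a v).1 * z ^ 2 * 1 + (negMap a v).2.1 * z * 1 ^ 2 +
      (negMap a v).2.2 * 1 ^ 3 : ℂ) = 0 ↔ z.re = v.2.1 ∧ z.im = v.2.2 := by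
  obtain ⟨t, x, y⟩ := v
  have e : (a * z ^ 3 + (negMap a (t, x, y)).1 * z ^ 2 * 1 + (negMap a (t, x, y)).2.1 * z * 1 ^ 2 +
      (negMap a (t, x, y)).2.2 * 1 ^ 3 : ℂ) =
      a * ((z - (y * t + x : ℝ)) * ((z - (x + y * Complex.I)) * (z - (x - y * Complex.I)))) := by
    simp only [negMap]
    push_cast
    linear_combination ((a : ℂ) * y ^ 2 * (z - (y * t + x))) * Complex.I_sq
  rw [e]
  have h1 : (a : ℂ) ≠ 0 := by exact_mod_cast ha.ne'
  have h2 : z - (y * t + x : ℝ) ≠ 0 := fun h => by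
    have := congrArg Complex.im h
    simp at this
    exact hz.ne' this
  have h3 : z - (x - y * Complex.I) ≠ 0 := fun h => by
    have := congrArg Complex.im h
    simp at this
    simp only at hy
    linarith
  rw [mul_eq_zero_iff_left h1, mul_eq_zero_iff_left h2, mul_eq_zero_iff_right h3,
    sub_eq_zero, Complex.ext_iff]
  simp

/-- The chart for forms of negative discriminant. -/
noncomputable def negChart : FormChart (-1) 2 4 where
  chart := negMap
  q₁ a u := a * u.2.2 - u.1 * u.2.1
  q₂ a u := (a + u.1) ^ 2 + u.2.1 * (a + u.1) - a * u.2.2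
  q₃ a u := u.2.2 ^ 2 - a ^ 2 + a * u.2.1 - u.1 * u.2.2
  slice₁ a := ⟨by fun_prop,
    fun c d => ⟨a * d, -c, 0, 0, 0, fun t => by ring⟩,
    fun b d => ⟨a * d, -b, 0, 0, 0, fun t => by ring⟩,
    fun b c => ⟨-b * c, a, 0, 0, 0, fun t => by ring⟩⟩
  slice₂ a := ⟨by fun_prop,
    fun c d => ⟨a ^ 2 + c * a - a * d, 2 * a + c, 1, 0, 0, fun t => by ring⟩,
    fun b d => ⟨(a + b) ^ 2 - a * d, a + b, 0, 0, 0, fun t => by ring⟩,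
    fun b c => ⟨(a + b) ^ 2 + c * (a + b), -a, 0, 0, 0, fun t => by ring⟩⟩
  slice₃ a := ⟨by fun_prop,
    fun c d => ⟨d ^ 2 - a ^ 2 + a * c, -d, 0, 0, 0, fun t => by ring⟩,
    fun b d => ⟨d ^ 2 - a ^ 2 - b * d, a, 0, 0, 0, fun t => by ring⟩,
    fun b c => ⟨-a ^ 2 + a * c, -b, 1, 0, 0, fun t => by ring⟩⟩
  disc a v := by simp only [discR, negMap, paramSize]; ring
  sign₁ a v ha hy := by
    refine ⟨2 * a ^ 2 * ((v.2.2 * v.1 + 2 * v.2.1) ^ 2 + v.2.2 ^ 2), by positivity, ?_⟩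
    simp only [negMap]; ring
  sign₂ a v ha hy := by
    refine ⟨2 * a ^ 2 * ((v.2.2 * v.1 + 2 * v.2.1 - 1) ^ 2 + v.2.2 ^ 2), by positivity, ?_⟩
    simp only [negMap]; ring
  sign₃ a v ha hy := by
    refine ⟨a ^ 2 * ((1 - (v.2.2 * v.1 + v.2.1) * v.2.1) ^ 2 +
      ((v.2.2 * v.1 + v.2.1) * v.2.2) ^ 2), ?_, ?_⟩
    · refine mul_pos (by positivity) ?_
      by_cases h : v.2.2 * v.1 + v.2.1 = 0
      · rw [h]; norm_num
      · positivity
    · simp only [negMap]; ring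
  injOn _ ha := negMap_injOn ha
  surj _ u ha h := negMap_surj u ha h
  vol _ _ ha hS hpos := negMap_vol ha hS hpos
  bound₁ a v ha hx hy := by
    have h0 : |v.2.2 * v.1 + 3 * v.2.1| ≤ 9 * (v.2.2 * (1 + |v.1|)) := by
      have h1 := abs_add_le (v.2.2 * v.1) (3 * v.2.1)
      rw [abs_mul, abs_mul, abs_of_pos (by linarith : 0 < v.2.2), abs_of_pos (by norm_num :
        (0 : ℝ) < 3)] at h1
      nlinarith [abs_nonneg v.1, mul_nonneg (by linarith : 0 ≤ v.2.2) (abs_nonneg v.1)]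
    rw [negMap, abs_mul, abs_neg, abs_of_pos ha]
    nlinarith
  bound₂ a v ha hx hy := by
    have h0 : |3 * v.2.1 ^ 2 + v.2.2 ^ 2 + 2 * (v.2.2 * v.1) * v.2.1| ≤
        9 * (v.2.2 ^ 2 * (1 + |v.1|)) := by
      have h1 := abs_add_le (3 * v.2.1 ^ 2 + v.2.2 ^ 2) (2 * (v.2.2 * v.1) * v.2.1)
      have hy0 : 0 < v.2.2 := by linarith
      rw [abs_of_nonneg (by positivity : 0 ≤ 3 * v.2.1 ^ 2 + v.2.2 ^ 2), abs_mul, abs_mul,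
        abs_mul, abs_of_pos hy0, abs_of_pos (by norm_num : (0 : ℝ) < 2)] at h1
      have h2 : v.2.1 ^ 2 ≤ 1 / 4 := by rw [← sq_abs]; nlinarith [abs_nonneg v.2.1]
      have h3 : v.2.2 * |v.1| * |v.2.1| ≤ v.2.2 * |v.1| * (1 / 2) :=
        mul_le_mul_of_nonneg_left hx (by positivity)
      have h4 : v.2.2 * |v.1| * (43 / 50) ≤ v.2.2 * |v.1| * v.2.2 :=
        mul_le_mul_of_nonneg_left hy (by positivity)
      nlinarith [mul_nonneg hy0.le (abs_nonneg v.1)]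
    rw [negMap, abs_mul, abs_of_pos ha]
    nlinarith
  bound₃ a v ha hx hy := by
    have hy0 : 0 < v.2.2 := by linarith
    have h0 : |v.2.2 * v.1 + v.2.1| ≤ 2 * (v.2.2 * (1 + |v.1|)) := by
      have h1 := abs_add_le (v.2.2 * v.1) v.2.1
      rw [abs_mul, abs_of_pos hy0] at h1
      nlinarith [mul_nonneg hy0.le (abs_nonneg v.1)]
    have h2 : v.2.1 ^ 2 ≤ 1 / 4 := by rw [← sq_abs]; nlinarith [abs_nonneg v.2.1]
    have h3 : v.2.1 ^ 2 + v.2.2 ^ 2 ≤ 2 * v.2.2 ^ 2 := by nlinarith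
    rw [negMap, abs_mul, abs_mul, abs_neg, abs_of_pos ha,
      abs_of_nonneg (by positivity : 0 ≤ v.2.1 ^ 2 + v.2.2 ^ 2)]
    calc a * |v.2.2 * v.1 + v.2.1| * (v.2.1 ^ 2 + v.2.2 ^ 2)
        ≤ a * (2 * (v.2.2 * (1 + |v.1|))) * (2 * v.2.2 ^ 2) := by gcongr
      _ = 4 * (a * v.2.2 ^ 3 * (1 + |v.1|)) := by ring
      _ ≤ _ := by gcongr; norm_num
  cov a u z w := a * z ^ 3 + u.1 * z ^ 2 * w + u.2.1 * z * w ^ 2 + u.2.2 * w ^ 3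
  cov_smul a u z w k hk := by
    have e : a * (k * z) ^ 3 + u.1 * (k * z) ^ 2 * (k * w) + u.2.1 * (k * z) * (k * w) ^ 2 +
      u.2.2 * (k * w) ^ 3 = k ^ 3 *
        (a * z ^ 3 + u.1 * z ^ 2 * w + u.2.1 * z * w ^ 2 + u.2.2 * w ^ 3) := by ring
    rw [e, mul_eq_zero_iff_left (pow_ne_zero 3 hk)]
  cov_transforms p q r s a u a' u' z w h hT := by
    rw [neg_transforms p q r s a u a' u' z w hT, mul_eq_zero_iff_left]
    intro h0
    have : (p * s - q * r : ℝ) = 0 := by exact_mod_cast h0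
    rw [this] at h
    norm_num at h
  cov_neg a u z w := by
    have e : ((-a : ℝ) : ℂ) * z ^ 3 + ((-u).1 : ℝ) * z ^ 2 * w + ((-u).2.1 : ℝ) * z * w ^ 2 +
        ((-u).2.2 : ℝ) * w ^ 3 =
        -(a * z ^ 3 + u.1 * z ^ 2 * w + u.2.1 * z * w ^ 2 + u.2.2 * w ^ 3) := by
      simp only [Prod.fst_neg, Prod.snd_neg]
      push_cast
      ring
    rw [e, neg_eq_zero]
  cov_chart a v z ha hy hz := negMap_cov ha hy hz
  cov_conj a u z w := by simp

/-- The form of positive discriminant with first coefficient `a` (omitted) whose Hessian vanishes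
at `x + iy`, and whose second coefficient is `3a (yt - x)`. -/
def posMap (a : ℝ) (v : ℝ × ℝ × ℝ) : ℝ × ℝ × ℝ :=
  (3 * a * (v.2.2 * v.1 - v.2.1),
    3 * a * (v.2.1 ^ 2 - v.2.2 ^ 2 - 2 * (v.2.2 * v.1) * v.2.1),
    a * (-v.2.1 ^ 3 + 3 * v.2.1 * v.2.2 ^ 2 + 3 * (v.2.2 * v.1) * v.2.1 ^ 2 -
      v.2.2 * v.1 * v.2.2 ^ 2))

/-- The first coefficient of the Hessian covariant of a binary cubic form. -/
def hessA (a : ℝ) (u : ℝ × ℝ × ℝ) : ℝ := u.1 ^ 2 - 3 * a * u.2.1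

/-- The second coefficient of the Hessian covariant of a binary cubic form. -/
def hessB (a : ℝ) (u : ℝ × ℝ × ℝ) : ℝ := u.1 * u.2.1 - 9 * a * u.2.2

/-- The third coefficient of the Hessian covariant of a binary cubic form. -/
def hessC (_ : ℝ) (u : ℝ × ℝ × ℝ) : ℝ := u.2.1 ^ 2 - 3 * u.1 * u.2.2

theorem hessA_posMap (a : ℝ) (v : ℝ × ℝ × ℝ) :
    hessA a (posMap a v) = 9 * a ^ 2 * (v.2.2 ^ 2 * (v.1 ^ 2 + 1)) := by
  simp only [hessA, posMap]; ring

theorem hessB_posMap (a : ℝ) (v : ℝ × ℝ × ℝ) :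
    hessB a (posMap a v) = -2 * v.2.1 * hessA a (posMap a v) := by
  simp only [hessA, hessB, posMap]; ring

theorem hessC_posMap (a : ℝ) (v : ℝ × ℝ × ℝ) :
    hessC a (posMap a v) = (v.2.1 ^ 2 + v.2.2 ^ 2) * hessA a (posMap a v) := by
  simp only [hessA, hessC, posMap]; ring

theorem hessA_posMap_pos {a : ℝ} {v : ℝ × ℝ × ℝ} (ha : 0 < a) (hy : 0 < v.2.2) :
    0 < hessA a (posMap a v) := by
  rw [hessA_posMap]; positivity

theorem posMap_injOn {a : ℝ} (ha : 0 < a) : InjOn (posMap a) {v | 0 < v.2.2} := by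
  intro v hv v' hv' h
  have hA := hessA_posMap_pos ha hv
  have hx : v.2.1 = v'.2.1 := by
    have h1 := hessB_posMap a v
    have h2 := hessB_posMap a v'
    rw [← h] at h2
    have h3 : v.2.1 * hessA a (posMap a v) = v'.2.1 * hessA a (posMap a v) := by linarith
    exact mul_right_cancel₀ hA.ne' h3
  have hy : v.2.2 = v'.2.2 := by
    have h1 := hessC_posMap a v
    have h2 := hessC_posMap a v'
    rw [← h, h1, ← hx] at h2
    have h3 := mul_right_cancel₀ hA.ne' h2
    exact (pow_left_inj₀ (le_of_lt hv) (le_of_lt hv') two_ne_zero).1 (by linarith)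
  have ht : v.1 = v'.1 := by
    have h1 := congrArg Prod.fst h
    simp only [posMap] at h1
    have h2 := mul_left_cancel₀ (by positivity : 3 * a ≠ 0) h1
    rw [← hx, ← hy] at h2
    exact mul_left_cancel₀ (ne_of_gt hv) (by linarith)
  exact Prod.ext ht (Prod.ext hx hy)

theorem posMap_surj {a : ℝ} (u : ℝ × ℝ × ℝ) (ha : 0 < a) (h : 0 < 1 * discR a u) :
    ∃ v : ℝ × ℝ × ℝ, 0 < v.2.2 ∧ posMap a v = u := by
  obtain ⟨b, c, d⟩ := u
  rw [one_mul] at h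
  set D := discR a (b, c, d) with hD
  set A := b ^ 2 - 3 * a * c with hA
  set G := 2 * b ^ 3 - 9 * a * b * c + 27 * a ^ 2 * d with hG
  have hsyz : 4 * A ^ 3 = G ^ 2 + 27 * a ^ 2 * D := by
    rw [hA, hG, hD, discR]; ring
  have hApos : 0 < A := by
    have h3 : 0 < A ^ 3 := by
      have : 0 < 27 * a ^ 2 * D := by positivity
      nlinarith [sq_nonneg G]
    by_contra hneg
    have := pow_nonneg (neg_nonneg.2 (not_lt.1 hneg)) 3
    nlinarith
  set x := (9 * a * d - b * c) / (2 * A) with hx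
  set ρ := G / (6 * a * A) with hρ
  have hxA : 2 * A * x = 9 * a * d - b * c := by rw [hx]; field_simp
  have hρA : 6 * a * A * ρ = G := by rw [hρ]; field_simp
  have hy0 : 0 < √(3 * D) / (2 * A) := div_pos (Real.sqrt_pos.2 (by positivity)) (by positivity)
  set y := √(3 * D) / (2 * A) with hy
  have hyA : 4 * A ^ 2 * y ^ 2 = 3 * D := by
    rw [hy, div_pow, Real.sq_sqrt (by positivity)]; field_simp; norm_num
  have hn : (4 * A ^ 2) ≠ 0 := by positivity
  clear_value y ρ x G A D
  have hA2 : A = 9 * a ^ 2 * (ρ ^ 2 + y ^ 2) := by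
    apply mul_left_cancel₀ hn
    linear_combination hsyz - (6 * a * A * ρ + G) * hρA - 9 * a ^ 2 * hyA
  have hb : b = 3 * a * (ρ - x) := by
    apply mul_left_cancel₀ (by positivity : 2 * A ≠ 0)
    linear_combination -hρA + 3 * a * hxA + 2 * b * hA - hG
  have hc : 3 * a * (x ^ 2 - y ^ 2 - 2 * ρ * x) = c := by
    apply mul_left_cancel₀ (by positivity : 3 * a ≠ 0)
    linear_combination (-b - 3 * a * (ρ - x)) * hb + hA2 - hA
  have hd : a * (-x ^ 3 + 3 * x * y ^ 2 + 3 * ρ * x ^ 2 - ρ * y ^ 2) = d := by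
    apply mul_left_cancel₀ (by positivity : 9 * a ≠ 0)
    rw [hA2] at hxA
    linear_combination hxA + 3 * a * (ρ - x) * hc - c * hb
  refine ⟨(ρ / y, x, y), hy0, ?_⟩
  have hm : y * (ρ / y) = ρ := mul_div_cancel₀ _ hy0.ne'
  simp only [posMap, hm, Prod.mk.injEq]
  exact ⟨hb.symm, hc, hd⟩

theorem posMap_vol {a : ℝ} {S : Set (ℝ × ℝ × ℝ)} (ha : 0 < a) (hS : MeasurableSet S)
    (hpos : S ⊆ {v | 0 < v.2.2}) :
    volume.real (posMap a '' S) = 36 * a ^ 3 * ∫ v in S, v.2.2 * paramSize v := by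
  have hder : ∀ v, ∃ f' : ℝ × ℝ × ℝ →L[ℝ] ℝ × ℝ × ℝ, HasFDerivAt (posMap a) f' v ∧
      f'.det = 36 * a ^ 3 * (v.2.2 * paramSize v) := by
    intro v
    obtain ⟨ht, hx, hy⟩ := hasFDerivAt_coords v
    have hr := hy.mul ht
    have h1 := (hr.sub hx).const_mul (3 * a)
    have h2 := (((hx.pow 2).sub (hy.pow 2)).sub ((hr.const_mul 2).mul hx)).const_mul (3 * a)
    have h3 := (((((hx.pow 3).neg).add ((hx.const_mul 3).mul (hy.pow 2))).add
      ((hr.const_mul 3).mul (hx.pow 2))).sub (hr.mul (hy.pow 2))).const_mul a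
    refine ⟨_, h1.prodMk (h2.prodMk h3), ?_⟩
    rw [det_prod_prod, Matrix.det_fin_three, paramSize]
    simp
    ring
  choose f' hf' hdet using hder
  rw [volume_real_image hS hf' ((posMap_injOn ha).mono hpos), ← integral_const_mul]
  refine setIntegral_congr_fun hS fun v hv => ?_
  have hy : 0 < v.2.2 := hpos hv
  show |(f' v).det| = _
  rw [hdet, abs_of_nonneg]
  rw [paramSize]
  positivity

theorem posMap_cov {a : ℝ} {v : ℝ × ℝ × ℝ} {z : ℂ} (ha : 0 < a) (hy : 0 < v.2.2)
    (hz : 0 < z.im) :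
    (hessA a (posMap a v) * z ^ 2 + hessB a (posMap a v) * z * 1 +
      hessC a (posMap a v) * 1 ^ 2 : ℂ) = 0 ↔ z.re = v.2.1 ∧ z.im = v.2.2 := by
  have hA := hessA_posMap_pos ha hy
  rw [hessB_posMap, hessC_posMap]
  obtain ⟨t, x, y⟩ := v
  set A := hessA a (posMap a (t, x, y))
  have e : (A * z ^ 2 + (-2 * x * A : ℝ) * z * 1 + ((x ^ 2 + y ^ 2) * A : ℝ) * 1 ^ 2 : ℂ) =
      A * ((z - (x + y * Complex.I)) * (z - (x - y * Complex.I))) := by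
    push_cast
    linear_combination ((A : ℂ) * y ^ 2) * Complex.I_sq
  rw [e]
  have h1 : (A : ℂ) ≠ 0 := by exact_mod_cast hA.ne'
  have h3 : z - (x - y * Complex.I) ≠ 0 := fun h => by
    have := congrArg Complex.im h
    simp at this
    simp only at hy
    linarith
  rw [mul_eq_zero_iff_left h1, mul_eq_zero_iff_right h3, sub_eq_zero, Complex.ext_iff]
  simp

theorem pos_transforms (p q r s a : ℝ) (u : ℝ × ℝ × ℝ) (a' : ℝ) (u' : ℝ × ℝ × ℝ) (z w : ℂ)
    (h : (p * s - q * r) ^ 2 = 1) (hT : Transforms p q r s a u a' u') :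
    hessA a' u' * z ^ 2 + hessB a' u' * z * w + hessC a' u' * w ^ 2 =
      hessA a u * (p * z + r * w) ^ 2 + hessB a u * (p * z + r * w) * (q * z + s * w) +
        hessC a u * (q * z + s * w) ^ 2 := by
  obtain ⟨h1, h2, h3, h4⟩ := hT
  have hA : hessA a' u' = (p * s - q * r) ^ 2 * (p * s - q * r) ^ 2 *
      (hessA a u * p ^ 2 + hessB a u * p * q + hessC a u * q ^ 2) := by
    simp only [hessA, hessB, hessC, h1, h2, h3]; ring
  have hB : hessB a' u' = (p * s - q * r) ^ 2 * (p * s - q * r) ^ 2 *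
      (2 * hessA a u * p * r + hessB a u * (p * s + q * r) + 2 * hessC a u * q * s) := by
    simp only [hessA, hessB, hessC, h1, h2, h3, h4]; ring
  have hC : hessC a' u' = (p * s - q * r) ^ 2 * (p * s - q * r) ^ 2 *
      (hessA a u * r ^ 2 + hessB a u * r * s + hessC a u * s ^ 2) := by
    simp only [hessA, hessB, hessC, h2, h3, h4]; ring
  rw [h, one_mul, one_mul] at hA hB hC
  rw [hA, hB, hC]
  push_cast
  ring

theorem abs_param_bound {x y r : ℝ} (hx : |x| ≤ 1 / 2) (hy : 43 / 50 ≤ y) :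
    |r - x| ≤ |r| + 3 / 4 * y ∧ |x ^ 2 - y ^ 2 - 2 * r * x| ≤ 4 / 3 * (y ^ 2 + |r| * y) ∧
    |-x ^ 3 + 3 * x * y ^ 2 + 3 * r * x ^ 2 - r * y ^ 2| ≤ 3 * (y ^ 3 + |r| * y ^ 2) := by
  have hy0 : 0 < y := by linarith
  have h2 : x ^ 2 ≤ 1 / 4 := by rw [← sq_abs]; nlinarith [abs_nonneg x]
  have hyy : 1 / 3 * (1 : ℝ) ≤ 1 / 2 * y ^ 2 := by nlinarith
  have hr := abs_nonneg r
  have hry : |r| * (43 / 50) ≤ |r| * y := mul_le_mul_of_nonneg_left hy hr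
  refine ⟨?_, ?_, ?_⟩
  · have := abs_sub r x
    linarith
  · have h3 := abs_sub (x ^ 2 - y ^ 2) (2 * r * x)
    have h4 : |x ^ 2 - y ^ 2| ≤ 4 / 3 * y ^ 2 := by rw [abs_le]; constructor <;> nlinarith
    have h5 : |2 * r * x| ≤ |r| := by
      rw [abs_mul, abs_mul, abs_of_pos (by norm_num : (0 : ℝ) < 2)]
      nlinarith [mul_le_mul_of_nonneg_left hx hr]
    linarith
  · have e : -x ^ 3 + 3 * x * y ^ 2 + 3 * r * x ^ 2 - r * y ^ 2 =
      x * (3 * y ^ 2 - x ^ 2) + r * (3 * x ^ 2 - y ^ 2) := by ring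
    rw [e]
    refine (abs_add_le _ _).trans ?_
    rw [abs_mul, abs_mul]
    have h3 : |3 * y ^ 2 - x ^ 2| ≤ 3 * y ^ 2 := by
      rw [abs_le]; constructor <;> nlinarith [sq_nonneg x]
    have h4 : |3 * x ^ 2 - y ^ 2| ≤ 3 * y ^ 2 := by
      rw [abs_le]; constructor <;> nlinarith [sq_nonneg x]
    have h5 : |x| * |3 * y ^ 2 - x ^ 2| ≤ y * (3 * y ^ 2) :=
      mul_le_mul (by linarith) h3 (abs_nonneg _) hy0.le
    have h6 : |r| * |3 * x ^ 2 - y ^ 2| ≤ |r| * (3 * y ^ 2) :=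
      mul_le_mul_of_nonneg_left h4 hr
    linarith

/-- The chart for forms of positive discriminant. -/
noncomputable def posChart : FormChart 1 (6 * √3) 36 where
  chart := posMap
  q₁ a u := -hessB a u
  q₂ a u := hessA a u + hessB a u
  q₃ a u := hessC a u - hessA a u
  slice₁ a := ⟨by unfold hessB; fun_prop,
    fun c d => ⟨9 * a * d, -c, 0, 0, 0, fun t => by simp only [hessB]; ring⟩,
    fun b d => ⟨9 * a * d, -b, 0, 0, 0, fun t => by simp only [hessB]; ring⟩,
    fun b c => ⟨-b * c, 9 * a, 0, 0, 0, fun t => by simp only [hessB]; ring⟩⟩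
  slice₂ a := ⟨by unfold hessA hessB; fun_prop,
    fun c d => ⟨-3 * a * c - 9 * a * d, c, 1, 0, 0, fun t => by simp only [hessA, hessB]; ring⟩,
    fun b d => ⟨b ^ 2 - 9 * a * d, -3 * a + b, 0, 0, 0, fun t => by
      simp only [hessA, hessB]; ring⟩,
    fun b c => ⟨b ^ 2 - 3 * a * c + b * c, -9 * a, 0, 0, 0, fun t => by
      simp only [hessA, hessB]; ring⟩⟩
  slice₃ a := ⟨by unfold hessA hessC; fun_prop,
    fun c d => ⟨c ^ 2 + 3 * a * c, -3 * d, -1, 0, 0, fun t => by simp only [hessA, hessC]; ring⟩,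
    fun b d => ⟨-3 * b * d - b ^ 2, 3 * a, 1, 0, 0, fun t => by simp only [hessA, hessC]; ring⟩,
    fun b c => ⟨c ^ 2 - b ^ 2 + 3 * a * c, -3 * b, 0, 0, 0, fun t => by
      simp only [hessA, hessC]; ring⟩⟩
  disc a v := by
    rw [mul_pow, mul_pow, Real.sq_sqrt (by norm_num)]
    simp only [discR, posMap, paramSize]; ring
  sign₁ a v ha hy := ⟨2 * hessA a (posMap a v), by have := hessA_posMap_pos ha hy; positivity,
    by rw [hessB_posMap]; ring⟩
  sign₂ a v ha hy := ⟨2 * hessA a (posMap a v), by have := hessA_posMap_pos ha hy; positivity,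
    by rw [hessB_posMap]; ring⟩
  sign₃ a v ha hy := ⟨hessA a (posMap a v), hessA_posMap_pos ha hy, by rw [hessC_posMap]; ring⟩
  injOn _ ha := posMap_injOn ha
  surj _ u ha h := posMap_surj u ha h
  vol _ _ ha hS hpos := posMap_vol ha hS hpos
  bound₁ a v ha hx hy := by
    have hy0 : 0 < v.2.2 := by linarith
    have h := (abs_param_bound (r := v.2.2 * v.1) hx hy).1
    rw [abs_mul v.2.2, abs_of_pos hy0] at h
    rw [posMap, abs_mul, abs_of_pos (by positivity : 0 < 3 * a)]
    calc 3 * a * |v.2.2 * v.1 - v.2.1| ≤ 3 * a * (3 * (v.2.2 * (1 + |v.1|))) := by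
          gcongr
          nlinarith [mul_nonneg hy0.le (abs_nonneg v.1)]
      _ = _ := by ring
  bound₂ a v ha hx hy := by
    have hy0 : 0 < v.2.2 := by linarith
    have h := (abs_param_bound (r := v.2.2 * v.1) hx hy).2.1
    rw [abs_mul v.2.2 v.1, abs_of_pos hy0] at h
    rw [posMap, abs_mul, abs_of_pos (by positivity : 0 < 3 * a)]
    calc 3 * a * |v.2.1 ^ 2 - v.2.2 ^ 2 - 2 * (v.2.2 * v.1) * v.2.1|
        ≤ 3 * a * (3 * (v.2.2 ^ 2 * (1 + |v.1|))) := by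
          gcongr
          nlinarith [mul_nonneg (sq_nonneg v.2.2) (abs_nonneg v.1)]
      _ = _ := by ring
  bound₃ a v ha hx hy := by
    have hy0 : 0 < v.2.2 := by linarith
    have h := (abs_param_bound (r := v.2.2 * v.1) hx hy).2.2
    rw [abs_mul v.2.2 v.1, abs_of_pos hy0] at h
    rw [posMap, abs_mul, abs_of_pos ha]
    calc a * |-v.2.1 ^ 3 + 3 * v.2.1 * v.2.2 ^ 2 + 3 * (v.2.2 * v.1) * v.2.1 ^ 2 -
          v.2.2 * v.1 * v.2.2 ^ 2| ≤ a * (9 * (v.2.2 ^ 3 * (1 + |v.1|))) := by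
          gcongr
          nlinarith [mul_nonneg (pow_nonneg hy0.le 3) (abs_nonneg v.1), pow_pos hy0 3]
      _ = _ := by ring
  cov a u z w := hessA a u * z ^ 2 + hessB a u * z * w + hessC a u * w ^ 2
  cov_smul a u z w k hk := by
    have e : hessA a u * (k * z) ^ 2 + hessB a u * (k * z) * (k * w) + hessC a u * (k * w) ^ 2 =
      k ^ 2 * (hessA a u * z ^ 2 + hessB a u * z * w + hessC a u * w ^ 2) := by ring
    rw [e, mul_eq_zero_iff_left (pow_ne_zero 2 hk)]
  cov_transforms p q r s a u a' u' z w h hT := by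
    rw [pos_transforms p q r s a u a' u' z w h hT]
  cov_neg a u z w := by
    have e1 : hessA (-a) (-u) = hessA a u := by
      simp only [hessA, Prod.fst_neg, Prod.snd_neg]; ring
    have e2 : hessB (-a) (-u) = hessB a u := by
      simp only [hessB, Prod.fst_neg, Prod.snd_neg]; ring
    have e3 : hessC (-a) (-u) = hessC a u := by
      simp only [hessC, Prod.fst_neg, Prod.snd_neg]; ring
    rw [e1, e2, e3]
  cov_chart a v z ha hy hz := posMap_cov ha hy hz
  cov_conj a u z w := by simp

namespace FormChart

variable {σ κ J : ℝ} (P : FormChart σ κ J)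

/-- The forms with first coefficient `a`, with `0 < σD < X` and with covariant point in the
interior of half of the fundamental domain. -/
def openRegion (a X : ℝ) : Set (ℝ × ℝ × ℝ) :=
  {u | 0 < σ * discR a u} ∩ ({u | 0 < X - σ * discR a u} ∩
    ({u | 0 < P.q₁ a u} ∩ ({u | 0 < P.q₂ a u} ∩ {u | 0 < P.q₃ a u})))

/-- The forms with first coefficient `a`, with `0 < σD < X` and with covariant point in half of
the fundamental domain, boundary included. -/
def closedRegion (a X : ℝ) : Set (ℝ × ℝ × ℝ) :=
  {u | 0 < σ * discR a u} ∩ ({u | 0 < X - σ * discR a u} ∩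
    ({u | 0 ≤ P.q₁ a u} ∩ ({u | 0 ≤ P.q₂ a u} ∩ {u | 0 ≤ P.q₃ a u})))

theorem openRegion_subset_closedRegion (a X : ℝ) : P.openRegion a X ⊆ P.closedRegion a X := by
  intro u h
  simp only [openRegion, closedRegion, mem_inter_iff, mem_ofPred_eq] at h ⊢
  exact ⟨h.1, h.2.1, h.2.2.1.le, h.2.2.2.1.le, h.2.2.2.2.le⟩

theorem sliceQuartic_disc (a e m : ℝ) : SliceQuartic fun u => e + m * discR a u :=
  ⟨by unfold discR; fun_prop,
    fun c d => ⟨e + m * (-4 * a * c ^ 3 - 27 * a ^ 2 * d ^ 2), m * (18 * a * c * d), m * c ^ 2,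
      -4 * m * d, 0, fun t => by simp only [discR]; ring⟩,
    fun b d => ⟨e + m * (-4 * b ^ 3 * d - 27 * a ^ 2 * d ^ 2), m * (18 * a * b * d), m * b ^ 2,
      -4 * m * a, 0, fun t => by simp only [discR]; ring⟩,
    fun b c => ⟨e + m * (b ^ 2 * c ^ 2 - 4 * a * c ^ 3), m * (18 * a * b * c - 4 * b ^ 3),
      -27 * m * a ^ 2, 0, 0, fun t => by simp only [discR]; ring⟩⟩

theorem sliceRegion_disc (a X : ℝ) : SliceRegion 4 {u | 0 < σ * discR a u} ∧
    SliceRegion 4 {u | 0 < X - σ * discR a u} := by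
  constructor
  · simpa using (sliceQuartic_disc a 0 σ).pos
  · simpa [sub_eq_add_neg] using (sliceQuartic_disc a X (-σ)).pos

theorem sliceRegion_openRegion (a X : ℝ) : SliceRegion 20 (P.openRegion a X) :=
  (sliceRegion_disc a X).1.inter ((sliceRegion_disc a X).2.inter
    ((P.slice₁ a).pos.inter ((P.slice₂ a).pos.inter (P.slice₃ a).pos)))

theorem sliceRegion_closedRegion (a X : ℝ) : SliceRegion 20 (P.closedRegion a X) :=
  (sliceRegion_disc a X).1.inter ((sliceRegion_disc a X).2.inter
    ((P.slice₁ a).nonneg.inter ((P.slice₂ a).nonneg.inter (P.slice₃ a).nonneg)))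

/-- The parameters of the forms in `closedRegion`. -/
def closedParams (a Y : ℝ) : Set (ℝ × ℝ × ℝ) :=
  (univ ×ˢ closedHalfDomain) ∩ {v | a ^ 2 * paramSize v < Y}

theorem paramSize_pos {v : ℝ × ℝ × ℝ} (hv : 0 < v.2.2) : 0 < paramSize v := by
  rw [paramSize]; positivity

theorem disc_pos (hκ : 0 < κ) {a : ℝ} (ha : 0 < a) {v : ℝ × ℝ × ℝ} (hv : 0 < v.2.2) :
    0 < σ * discR a (P.chart a v) := by
  rw [P.disc]
  have := paramSize_pos hv
  positivity

theorem disc_lt_iff (hκ : 0 < κ) {a X : ℝ} (ha : 0 < a) {v : ℝ × ℝ × ℝ} (hv : 0 < v.2.2) :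
    0 < X - σ * discR a (P.chart a v) ↔ a ^ 2 * paramSize v < √X / κ := by
  have := paramSize_pos hv
  rw [P.disc, sub_pos, ← Real.lt_sqrt (by positivity), lt_div_iff₀ hκ, mul_comm]

theorem chart_mem_openRegion_iff (hκ : 0 < κ) {a X : ℝ} (ha : 0 < a) {v : ℝ × ℝ × ℝ}
    (hv : 0 < v.2.2) : P.chart a v ∈ P.openRegion a X ↔ v ∈ paramRegion a (√X / κ) := by
  obtain ⟨k₁, hk₁, e₁⟩ := P.sign₁ a v ha hv
  obtain ⟨k₂, hk₂, e₂⟩ := P.sign₂ a v ha hv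
  obtain ⟨k₃, hk₃, e₃⟩ := P.sign₃ a v ha hv
  simp only [openRegion, mem_inter_iff, mem_ofPred_eq, P.disc_lt_iff hκ ha hv,
    P.disc_pos hκ ha hv, e₁, e₂, e₃, mul_pos_iff_of_pos_left hk₁, mul_pos_iff_of_pos_left hk₂,
    mul_pos_iff_of_pos_left hk₃, paramRegion, paramDomain, mem_prod, mem_univ,
    openHalfDomain, hv]
  simp only [sub_pos]
  tauto

theorem chart_mem_closedRegion_iff (hκ : 0 < κ) {a X : ℝ} (ha : 0 < a) {v : ℝ × ℝ × ℝ}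
    (hv : 0 < v.2.2) : P.chart a v ∈ P.closedRegion a X ↔ v ∈ closedParams a (√X / κ) := by
  obtain ⟨k₁, hk₁, e₁⟩ := P.sign₁ a v ha hv
  obtain ⟨k₂, hk₂, e₂⟩ := P.sign₂ a v ha hv
  obtain ⟨k₃, hk₃, e₃⟩ := P.sign₃ a v ha hv
  simp only [closedRegion, mem_inter_iff, mem_ofPred_eq, P.disc_lt_iff hκ ha hv,
    P.disc_pos hκ ha hv, e₁, e₂, e₃, mul_nonneg_iff_of_pos_left hk₁,
    mul_nonneg_iff_of_pos_left hk₂, mul_nonneg_iff_of_pos_left hk₃, sub_nonneg, closedParams,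
    mem_prod, mem_univ, closedHalfDomain, hv]
  tauto

theorem openRegion_eq (hκ : 0 < κ) {a : ℝ} (ha : 0 < a) (X : ℝ) :
    P.openRegion a X = P.chart a '' paramRegion a (√X / κ) := by
  ext u
  constructor
  · intro hu
    obtain ⟨v, hv, rfl⟩ := P.surj a u ha hu.1
    exact ⟨v, (P.chart_mem_openRegion_iff hκ ha hv).1 hu, rfl⟩
  · rintro ⟨v, hv, rfl⟩
    exact (P.chart_mem_openRegion_iff hκ ha hv.1.2.2.2.2).2 hv

theorem closedRegion_eq (hκ : 0 < κ) {a : ℝ} (ha : 0 < a) (X : ℝ) :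
    P.closedRegion a X = P.chart a '' closedParams a (√X / κ) := by
  ext u
  constructor
  · intro hu
    obtain ⟨v, hv, rfl⟩ := P.surj a u ha hu.1
    exact ⟨v, (P.chart_mem_closedRegion_iff hκ ha hv).1 hu, rfl⟩
  · rintro ⟨v, hv, rfl⟩
    exact (P.chart_mem_closedRegion_iff hκ ha hv.1.2.2.2.2).2 hv

theorem closedParams_ae_eq (a Y : ℝ) : closedParams a Y =ᵐ[volume] paramRegion a Y :=
  (Measure.set_prod_ae_eq ae_eq_rfl closedHalfDomain_ae_eq_openHalfDomain).inter ae_eq_rfl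

theorem volume_openRegion (hκ : 0 < κ) {a : ℝ} (ha : 0 < a) (X : ℝ) :
    volume.real (P.openRegion a X) =
      J * a ^ 3 * ∫ v in paramRegion a (√X / κ), v.2.2 * paramSize v := by
  rw [P.openRegion_eq hκ ha, P.vol a _ ha (measurableSet_paramRegion _ _)
    fun v hv => hv.1.2.2.2.2]

theorem volume_closedRegion (hκ : 0 < κ) {a : ℝ} (ha : 0 < a) (X : ℝ) :
    volume.real (P.closedRegion a X) =
      J * a ^ 3 * ∫ v in paramRegion a (√X / κ), v.2.2 * paramSize v := by
  rw [P.closedRegion_eq hκ ha, P.vol a _ ha _ fun v hv => hv.1.2.2.2.2,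
    setIntegral_congr_set (closedParams_ae_eq _ _)]
  exact (MeasurableSet.univ.prod measurableSet_closedHalfDomain).inter
    (measurableSet_lt (measurable_paramSize.const_mul _) measurable_const)

theorem closedRegion_bounds (hκ : 2 ≤ κ) {a L : ℝ} (ha : 0 < a) (hL : 0 < L) {u : ℝ × ℝ × ℝ}
    (hu : u ∈ P.closedRegion a (L ^ 4)) :
    a ≤ L ∧ |u.1| ≤ 18 * L ∧ a * |u.2.1| ^ 3 ≤ 18 ^ 3 * L ^ 4 ∧ a * |u.2.2| ≤ 18 * L ^ 2 := by
  rw [P.closedRegion_eq (by linarith) ha] at hu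
  obtain ⟨v, ⟨⟨-, h1, h2, h3, hy⟩, hs⟩, rfl⟩ := hu
  have hx : |v.2.1| ≤ 1 / 2 := by rw [abs_of_nonneg h1]; exact h2
  have hy' : 43 / 50 ≤ v.2.2 := by nlinarith
  have b1 := P.bound₁ a v ha hx hy'
  have b2 := P.bound₂ a v ha hx hy'
  have b3 := P.bound₃ a v ha hx hy'
  have hsq : √(L ^ 4) = L ^ 2 := by
    rw [show L ^ 4 = (L ^ 2) ^ 2 by ring, Real.sqrt_sq (by positivity)]
  have hs' : a ^ 2 * (v.2.2 ^ 3 * (1 + v.1 ^ 2)) ≤ L ^ 2 / 2 := by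
    have h4 : a ^ 2 * paramSize v < √(L ^ 4) / κ := hs
    rw [hsq] at h4
    refine h4.le.trans ?_
    gcongr
  set t := v.1
  set y := v.2.2
  set T := 1 + t ^ 2 with hT
  have hT1 : 1 ≤ T := by rw [hT]; nlinarith [sq_nonneg t]
  have ht2 : (1 + |t|) ^ 2 ≤ 2 * T := by
    rw [hT, ← sq_abs t]; nlinarith [sq_nonneg (|t| - 1)]
  have ht1 : 1 + |t| ≤ 2 * T := by rw [hT, ← sq_abs t]; nlinarith [sq_nonneg (|t| - 1)]
  have ht0 := abs_nonneg t
  have hy2 : (43 / 50) ^ 2 ≤ y ^ 2 := pow_le_pow_left₀ (by norm_num) hy' 2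
  have hy3 : (43 / 50) * y ^ 2 ≤ y ^ 3 := by nlinarith
  refine ⟨?_, ?_, ?_, ?_⟩
  · have h5 : a ^ 2 * (1 / 2 * 1) ≤ a ^ 2 * (y ^ 3 * T) := by
      gcongr
      nlinarith
    exact le_of_sq_le_sq (by linarith) hL.le
  · have h5 : (a * y * (1 + |t|)) ^ 2 ≤ (2 * L) ^ 2 := by
      calc (a * y * (1 + |t|)) ^ 2 = a ^ 2 * (y ^ 2 * (1 + |t|) ^ 2) := by ring
        _ ≤ a ^ 2 * (y ^ 2 * (2 * T)) := by gcongr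
        _ = 2 * (a ^ 2 * (y ^ 2 * T)) := by ring
        _ ≤ 2 * (a ^ 2 * ((2 * y ^ 3) * T)) := by gcongr; nlinarith
        _ ≤ _ := by nlinarith
    have h6 := le_of_sq_le_sq h5 (by positivity)
    linarith
  · calc a * |(P.chart a v).2.1| ^ 3 ≤ a * (9 * (a * y ^ 2 * (1 + |t|))) ^ 3 := by gcongr
      _ = 9 ^ 3 * (a ^ 4 * y ^ 6) * ((1 + |t|) ^ 2 * (1 + |t|)) := by ring
      _ ≤ 9 ^ 3 * (a ^ 4 * y ^ 6) * ((2 * T) * (2 * T)) := by gcongr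
      _ = 4 * 9 ^ 3 * (a ^ 2 * (y ^ 3 * T)) ^ 2 := by ring
      _ ≤ 4 * 9 ^ 3 * (L ^ 2 / 2) ^ 2 := by gcongr
      _ ≤ 18 ^ 3 * L ^ 4 := by nlinarith [pow_pos hL 4]
  · calc a * |(P.chart a v).2.2| ≤ a * (9 * (a * y ^ 3 * (1 + |t|))) := by gcongr
      _ = 9 * (a ^ 2 * y ^ 3 * (1 + |t|)) := by ring
      _ ≤ 9 * (a ^ 2 * y ^ 3 * (2 * T)) := by gcongr
      _ = 18 * (a ^ 2 * (y ^ 3 * T)) := by ring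
      _ ≤ 18 * L ^ 2 := by nlinarith [sq_nonneg L]

theorem closedRegion_box (hκ : 2 ≤ κ) {p q : ℝ} (hq : 0 < q) (hp : 0 < p) (b c d : ℝ)
    (hu : (b, c, d) ∈ P.closedRegion (q ^ 3) (p ^ 12)) :
    q ≤ p ∧ |b| ≤ 18 * p ^ 3 ∧ |c| ≤ 18 * (p ^ 4 / q) ∧ |d| ≤ 18 * (p ^ 6 / q ^ 3) := by
  rw [show p ^ 12 = (p ^ 3) ^ 4 by ring] at hu
  obtain ⟨h1, h2, h3, h4⟩ := P.closedRegion_bounds hκ (pow_pos hq 3) (pow_pos hp 3) hu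
  refine ⟨le_of_pow_le_pow_left₀ three_ne_zero hp.le h1, h2, ?_, ?_⟩
  · rw [← mul_div_assoc, le_div_iff₀ hq]
    refine le_of_pow_le_pow_left₀ three_ne_zero (by positivity) ?_
    calc (|c| * q) ^ 3 = q ^ 3 * |c| ^ 3 := by ring
      _ ≤ _ := h3
      _ = _ := by ring
  · rw [← mul_div_assoc, le_div_iff₀ (by positivity)]
    calc |d| * q ^ 3 = q ^ 3 * |d| := by ring
      _ ≤ _ := h4
      _ = _ := by ring

theorem abs_ncard_sub_volume_le_pow (hκ : 2 ≤ κ) {p q : ℝ} (hq : 1 ≤ q) (hqp : q ≤ p)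
    {R : Set (ℝ × ℝ × ℝ)} (hR : SliceRegion 20 R) (hsub : R ⊆ P.closedRegion (q ^ 3) (p ^ 12)) :
    |((latticePoints R).ncard : ℝ) - volume.real R| ≤ 160000 * (p ^ 10 / q ^ 4) := by
  have hq0 : 0 < q := by linarith
  have hp0 : 0 < p := by linarith
  refine (hR.abs_ncard_sub_volume_le (B := 18 * p ^ 3) (C := 18 * (p ^ 4 / q))
    (D := 18 * (p ^ 6 / q ^ 3)) (by positivity) (by positivity) (by positivity)
    fun b c d h => (P.closedRegion_box hκ hq0 hp0 b c d (hsub h)).2).trans ?_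
  have hb : 1 ≤ p ^ 3 := one_le_pow₀ (hq.trans hqp)
  have hbc : p ^ 3 ≤ p ^ 4 / q := by
    rw [le_div_iff₀ hq0, pow_succ p 3]
    gcongr
  have hbd : p ^ 3 ≤ p ^ 6 / q ^ 3 := by
    rw [le_div_iff₀ (by positivity), show p ^ 6 = p ^ 3 * p ^ 3 by ring]
    gcongr
  have hcd : p ^ 10 / q ^ 4 = p ^ 4 / q * (p ^ 6 / q ^ 3) := by
    field_simp
  rw [hcd]
  generalize p ^ 4 / q = c at *
  generalize p ^ 6 / q ^ 3 = d at *
  generalize p ^ 3 = b at *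
  push_cast
  nlinarith [mul_nonneg (sub_nonneg.2 hbc) (sub_nonneg.2 hbd),
    mul_nonneg (sub_nonneg.2 hb) (sub_nonneg.2 hbd),
    mul_nonneg (sub_nonneg.2 hb) (sub_nonneg.2 hbc),
    mul_nonneg (sub_nonneg.2 hbc) (sub_nonneg.2 (hb.trans hbd)),
    mul_nonneg (sub_nonneg.2 hbd) (sub_nonneg.2 (hb.trans hbc)), sq_nonneg (b - 1)]

theorem abs_ncard_sub_volume_le_rpow (hκ : 2 ≤ κ) {a X : ℝ} (ha : 1 ≤ a)
    (haX : a ≤ X ^ (1 / 4 : ℝ)) (hX : 0 ≤ X)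
    {R : Set (ℝ × ℝ × ℝ)} (hR : SliceRegion 20 R) (hsub : R ⊆ P.closedRegion a X) :
    |((latticePoints R).ncard : ℝ) - volume.real R| ≤
      160000 * (X ^ (5 / 6 : ℝ) * a ^ (-(4 / 3) : ℝ)) := by
  have ha0 : 0 ≤ a := by linarith
  have e1 : (a ^ (1 / 3 : ℝ)) ^ 3 = a := by
    rw [← rpow_natCast, ← rpow_mul ha0]; norm_num
  have e2 : (X ^ (1 / 12 : ℝ)) ^ 12 = X := by
    rw [← rpow_natCast, ← rpow_mul hX]; norm_num
  have h := P.abs_ncard_sub_volume_le_pow hκ (p := X ^ (1 / 12 : ℝ)) (q := a ^ (1 / 3 : ℝ))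
    (one_le_rpow ha (by norm_num)) ?_ hR (by rwa [e1, e2])
  · refine h.trans_eq ?_
    rw [← rpow_natCast, ← rpow_natCast, ← rpow_mul hX, ← rpow_mul ha0, rpow_neg ha0,
      div_eq_mul_inv]
    norm_num
  · refine (rpow_le_rpow ha0 haX (by norm_num)).trans_eq ?_
    rw [← rpow_mul hX]
    norm_num

theorem le_rpow_of_mem_closedRegion (hκ : 2 ≤ κ) {a X : ℝ} (ha : 0 < a) (hX : 0 < X)
    {u : ℝ × ℝ × ℝ} (hu : u ∈ P.closedRegion a X) : a ≤ X ^ (1 / 4 : ℝ) := by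
  have e : (X ^ (1 / 4 : ℝ)) ^ 4 = X := by
    rw [← rpow_natCast, ← rpow_mul hX.le]; norm_num
  rw [← e] at hu
  exact (P.closedRegion_bounds hκ ha (by positivity) hu).1

theorem exists_abs_sum_ncard_sub_le (hκ : 2 ≤ κ) {R : ℝ → ℝ → Set (ℝ × ℝ × ℝ)}
    (hR : ∀ a X, SliceRegion 20 (R a X)) (hsub : ∀ a X, R a X ⊆ P.closedRegion a X)
    (hvol : ∀ a X, 0 < a → volume.real (R a X) =
      J * a ^ 3 * ∫ v in paramRegion a (√X / κ), v.2.2 * paramSize v) :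
    ∃ K, ∀ X : ℝ, 1 ≤ X → |∑ a ∈ Finset.Icc 1 ⌊X ^ (1 / 4 : ℝ)⌋₊,
      ((latticePoints (R a X)).ncard : ℝ) - J * π ^ 2 / (24 * κ ^ 2) * X| ≤
        K * X ^ (5 / 6 : ℝ) := by
  obtain ⟨K, hK⟩ := exists_sum_integral_paramRegion
  have hs : Summable fun n : ℕ => (n : ℝ) ^ (-(4 / 3) : ℝ) :=
    Real.summable_nat_rpow.2 (by norm_num)
  refine ⟨160000 * ∑' n : ℕ, (n : ℝ) ^ (-(4 / 3) : ℝ) + |J| * (|K| * 1), fun X hX => ?_⟩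
  have hX0 : 0 < X := by linarith
  have hκ0 : 0 < κ := by linarith
  set N := ⌊X ^ (1 / 4 : ℝ)⌋₊
  have hsq : √X / κ ≤ √X / 2 := by gcongr
  have hK' := hK (√X / κ) (by positivity) N fun a ha => by
    refine Nat.le_floor ?_
    have e : (X ^ (1 / 4 : ℝ)) ^ 2 = √X := by
      rw [← rpow_natCast, ← rpow_mul hX0.le, sqrt_eq_rpow]; norm_num
    refine (lt_of_pow_lt_pow_left₀ 2 (by positivity) ?_).le
    rw [e]
    linarith
  have hN : ∀ a ∈ Finset.Icc 1 N, (1 : ℝ) ≤ a ∧ (a : ℝ) ≤ X ^ (1 / 4 : ℝ) := by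
    intro a ha
    rw [Finset.mem_Icc] at ha
    exact ⟨by exact_mod_cast ha.1, (Nat.le_floor_iff (by positivity)).1 ha.2⟩
  have h1 : |∑ a ∈ Finset.Icc 1 N, (((latticePoints (R a X)).ncard : ℝ) -
      volume.real (R a X))| ≤
        160000 * (∑' n : ℕ, (n : ℝ) ^ (-(4 / 3) : ℝ)) * X ^ (5 / 6 : ℝ) := by
    calc _ ≤ ∑ a ∈ Finset.Icc 1 N, |((latticePoints (R a X)).ncard : ℝ) -
          volume.real (R a X)| := Finset.abs_sum_le_sum_abs _ _
      _ ≤ ∑ a ∈ Finset.Icc 1 N, 160000 * (X ^ (5 / 6 : ℝ) * (a : ℝ) ^ (-(4 / 3) : ℝ)) :=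
          Finset.sum_le_sum fun a ha => P.abs_ncard_sub_volume_le_rpow hκ (hN a ha).1 (hN a ha).2
            hX0.le (hR _ _) (hsub _ _)
      _ = 160000 * (∑ a ∈ Finset.Icc 1 N, (a : ℝ) ^ (-(4 / 3) : ℝ)) * X ^ (5 / 6 : ℝ) := by
          rw [← Finset.mul_sum, ← Finset.mul_sum]; ring
      _ ≤ _ := by
          gcongr
          exact hs.sum_le_tsum _ fun n _ => by positivity
  have h2 : ∑ a ∈ Finset.Icc 1 N, volume.real (R a X) = J * ∑ a ∈ Finset.Icc 1 N,
      (a : ℝ) ^ 3 * ∫ v in paramRegion a (√X / κ), v.2.2 * paramSize v := by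
    rw [Finset.mul_sum]
    refine Finset.sum_congr rfl fun a ha => ?_
    rw [hvol _ _ (by linarith [(hN a ha).1])]
    ring
  have h3 : J * π ^ 2 / (24 * κ ^ 2) * X = J * (π ^ 2 / 24 * (√X / κ) ^ 2) := by
    rw [div_pow, sq_sqrt hX0.le]
    field_simp
  have h4 : (√X / κ) ^ (5 / 3 : ℝ) ≤ 1 * X ^ (5 / 6 : ℝ) := by
    rw [one_mul]
    calc (√X / κ) ^ (5 / 3 : ℝ) ≤ (√X) ^ (5 / 3 : ℝ) := by
          refine rpow_le_rpow (by positivity) (div_le_self (sqrt_nonneg _) (by linarith))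
            (by norm_num)
      _ = _ := by rw [sqrt_eq_rpow, ← rpow_mul hX0.le]; norm_num
  have h5 : |J * ∑ a ∈ Finset.Icc 1 N, (a : ℝ) ^ 3 *
      (∫ v in paramRegion a (√X / κ), v.2.2 * paramSize v) -
      J * (π ^ 2 / 24 * (√X / κ) ^ 2)| ≤ |J| * (|K| * 1) * X ^ (5 / 6 : ℝ) := by
    rw [← mul_sub, abs_mul]
    calc _ ≤ |J| * (K * (√X / κ) ^ (5 / 3 : ℝ)) := by gcongr
      _ ≤ |J| * (|K| * (1 * X ^ (5 / 6 : ℝ))) := by gcongr; exact le_abs_self K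
      _ = _ := by ring
  rw [Finset.sum_sub_distrib, h2] at h1
  rw [h3, add_mul]
  refine le_trans ?_ (add_le_add h1 h5)
  refine le_trans (le_of_eq ?_) (abs_add_le _ _)
  congr 1
  ring

theorem exists_abs_sum_ncard_openRegion_sub_le (hκ : 2 ≤ κ) :
    ∃ K, ∀ X : ℝ, 1 ≤ X → |∑ a ∈ Finset.Icc 1 ⌊X ^ (1 / 4 : ℝ)⌋₊,
      ((latticePoints (P.openRegion a X)).ncard : ℝ) - J * π ^ 2 / (24 * κ ^ 2) * X| ≤
        K * X ^ (5 / 6 : ℝ) :=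
  P.exists_abs_sum_ncard_sub_le hκ P.sliceRegion_openRegion P.openRegion_subset_closedRegion
    fun _ X ha => P.volume_openRegion (by linarith) ha X

theorem exists_abs_sum_ncard_closedRegion_sub_le (hκ : 2 ≤ κ) :
    ∃ K, ∀ X : ℝ, 1 ≤ X → |∑ a ∈ Finset.Icc 1 ⌊X ^ (1 / 4 : ℝ)⌋₊,
      ((latticePoints (P.closedRegion a X)).ncard : ℝ) - J * π ^ 2 / (24 * κ ^ 2) * X| ≤
        K * X ^ (5 / 6 : ℝ) :=
  P.exists_abs_sum_ncard_sub_le hκ P.sliceRegion_closedRegion (fun _ _ => subset_rfl)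
    fun _ X ha => P.volume_closedRegion (by linarith) ha X

end FormChart

/-- The value of a binary cubic form at `(x, y)`. -/
def formVal (f : BinaryCubic) (x y : ℤ) : ℤ :=
  f.1 * x ^ 3 + f.2.1 * x ^ 2 * y + f.2.2.1 * x * y ^ 2 + f.2.2.2 * y ^ 3

/-- The twisted transform of a binary cubic form by the matrix `(p, q; r, s)` of
determinant `±1`. -/
def twist (p q r s : ℤ) (f : BinaryCubic) : BinaryCubic :=
  ((p * s - q * r) * (f.1 * p ^ 3 + f.2.1 * p ^ 2 * q + f.2.2.1 * p * q ^ 2 + f.2.2.2 * q ^ 3),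
    (p * s - q * r) * (3 * f.1 * p ^ 2 * r + f.2.1 * (p ^ 2 * s + 2 * p * q * r) +
      f.2.2.1 * (q ^ 2 * r + 2 * p * q * s) + 3 * f.2.2.2 * q ^ 2 * s),
    (p * s - q * r) * (3 * f.1 * p * r ^ 2 + f.2.1 * (q * r ^ 2 + 2 * p * r * s) +
      f.2.2.1 * (p * s ^ 2 + 2 * q * r * s) + 3 * f.2.2.2 * q * s ^ 2),
    (p * s - q * r) * (f.1 * r ^ 3 + f.2.1 * r ^ 2 * s + f.2.2.1 * r * s ^ 2 + f.2.2.2 * s ^ 3))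

theorem formVal_twist (p q r s : ℤ) (f : BinaryCubic) (x y : ℤ) :
    formVal (twist p q r s f) x y =
      (p * s - q * r) * formVal f (p * x + r * y) (q * x + s * y) := by
  simp only [formVal, twist]
  ring

theorem form_ext {f g : BinaryCubic} (h : ∀ x y, formVal f x y = formVal g x y) : f = g := by
  obtain ⟨a, b, c, d⟩ := f
  obtain ⟨a', b', c', d'⟩ := g
  have h1 := h 1 0
  have h2 := h 0 1
  have h3 := h 1 1
  have h4 := h 1 (-1)
  simp only [formVal] at h1 h2 h3 h4
  simp only [Prod.mk.injEq]
  refine ⟨?_, ?_, ?_, ?_⟩ <;> linarith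

theorem twist_twist (p q r s p' q' r' s' : ℤ) (f : BinaryCubic) :
    twist p' q' r' s' (twist p q r s f) =
      twist (p' * p + q' * r) (p' * q + q' * s) (r' * p + s' * r) (r' * q + s' * s) f := by
  refine form_ext fun x y => ?_
  simp only [formVal_twist]
  rw [show (p' * p + q' * r) * x + (r' * p + s' * r) * y = p * (p' * x + r' * y) +
    r * (q' * x + s' * y) by ring, show (p' * q + q' * s) * x + (r' * q + s' * s) * y =
    q * (p' * x + r' * y) + s * (q' * x + s' * y) by ring]
  ring

theorem twist_one (f : BinaryCubic) : twist 1 0 0 1 f = f := by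
  simp [twist]

theorem twist_neg (p q r s : ℤ) (f : BinaryCubic) :
    twist (-p) (-q) (-r) (-s) f = -twist p q r s f := by
  simp only [twist, Prod.neg_mk, Prod.mk.injEq]
  refine ⟨?_, ?_, ?_, ?_⟩ <;> ring

theorem discF_twist {p q r s : ℤ} (h : (p * s - q * r) ^ 2 = 1) (f : BinaryCubic) :
    discF (twist p q r s f) = discF f := by
  have : discF (twist p q r s f) = ((p * s - q * r) ^ 2) ^ 5 * discF f := by
    simp only [discF, twist]
    ring
  rw [this, h, one_pow, one_mul]

theorem formEquiv_iff (f g : BinaryCubic) :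
    FormEquiv f g ↔ ∃ p q r s : ℤ, (p * s - q * r) ^ 2 = 1 ∧ g = twist p q r s f := by
  constructor
  · rintro ⟨γ, hγ, hact⟩
    have hdet : γ 0 0 * γ 1 1 - γ 0 1 * γ 1 0 = γ.det := (Matrix.det_fin_two γ).symm
    have h1 : γ.det * γ.det = 1 := by
      rcases Int.isUnit_iff.1 hγ with h | h <;> rw [h] <;> rfl
    refine ⟨γ 0 0, γ 0 1, γ 1 0, γ 1 1, by rw [hdet, sq, h1], form_ext fun x y => ?_⟩
    have key := congrArg (MvPolynomial.eval ![x, y]) hact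
    simp only [toPoly, map_add, map_mul, map_pow, MvPolynomial.bind₁_X_right,
      MvPolynomial.bind₁_C_right, MvPolynomial.eval_C, MvPolynomial.eval_X,
      Matrix.cons_val_zero, Matrix.cons_val_one] at key
    rw [formVal_twist, hdet]
    simp only [formVal]
    linear_combination γ.det * key - (g.1 * x ^ 3 + g.2.1 * x ^ 2 * y + g.2.2.1 * x * y ^ 2 +
      g.2.2.2 * y ^ 3) * h1
  · rintro ⟨p, q, r, s, h, rfl⟩
    refine ⟨!![p, q; r, s], ?_, ?_⟩
    · rw [Matrix.det_fin_two_of]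
      exact IsUnit.of_mul_eq_one _ (by rw [← sq, h])
    · have h' : MvPolynomial.C (σ := Fin 2) ((p * s - q * r) ^ 2) = 1 := by rw [h, map_one]
      simp only [ActsTo, toPoly, twist, Matrix.det_fin_two_of, map_add, map_mul, map_pow, map_sub,
        MvPolynomial.bind₁_X_right, MvPolynomial.bind₁_C_right, Matrix.of_apply,
        Matrix.cons_val_zero, Matrix.cons_val_one, Matrix.cons_val', Matrix.cons_val_fin_one]
        at h' ⊢
      simp only [map_ofNat]
      generalize (MvPolynomial.X 0 : MvPolynomial (Fin 2) ℤ) = x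
      generalize (MvPolynomial.X 1 : MvPolynomial (Fin 2) ℤ) = y
      generalize (MvPolynomial.C p : MvPolynomial (Fin 2) ℤ) = p at *
      generalize (MvPolynomial.C q : MvPolynomial (Fin 2) ℤ) = q at *
      generalize (MvPolynomial.C r : MvPolynomial (Fin 2) ℤ) = r at *
      generalize (MvPolynomial.C s : MvPolynomial (Fin 2) ℤ) = s at *
      generalize (MvPolynomial.C f.1 : MvPolynomial (Fin 2) ℤ) = a
      generalize (MvPolynomial.C f.2.1 : MvPolynomial (Fin 2) ℤ) = b
      generalize (MvPolynomial.C f.2.2.1 : MvPolynomial (Fin 2) ℤ) = c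
      generalize (MvPolynomial.C f.2.2.2 : MvPolynomial (Fin 2) ℤ) = d
      linear_combination (a * (p * x + r * y) ^ 3 +
        b * (p * x + r * y) ^ 2 * (q * x + s * y) + c * (p * x + r * y) * (q * x + s * y) ^ 2 +
        d * (q * x + s * y) ^ 3) * h'

theorem formEquiv_equivalence : Equivalence FormEquiv where
  refl f := (formEquiv_iff _ _).2 ⟨1, 0, 0, 1, rfl, (twist_one f).symm⟩
  symm {f g} h := by
    obtain ⟨p, q, r, s, h, rfl⟩ := (formEquiv_iff _ _).1 h
    set e := p * s - q * r with he
    have h2 : e * e = 1 := by rw [← sq, h]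
    refine (formEquiv_iff _ _).2 ⟨e * s, -(e * q), -(e * r), e * p, ?_, ?_⟩
    · linear_combination (e ^ 4 + e ^ 2 + 1) * h - (e ^ 4) * (p * s - q * r + e) * he
    · rw [twist_twist]
      conv_lhs => rw [← twist_one f]
      congr 1
      · linear_combination -h2 + e * he
      · ring
      · ring
      · linear_combination -h2 + e * he
  trans {f g k} h h' := by
    obtain ⟨p, q, r, s, hd, rfl⟩ := (formEquiv_iff _ _).1 h
    obtain ⟨p', q', r', s', hd', rfl⟩ := (formEquiv_iff _ _).1 h'
    refine (formEquiv_iff _ _).2 ⟨_, _, _, _, ?_, twist_twist _ _ _ _ _ _ _ _ _⟩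
    linear_combination (p' * s' - q' * r') ^ 2 * hd + hd'

theorem map_toPoly (f : BinaryCubic) : MvPolynomial.map (Int.castRingHom ℚ) (toPoly f) =
    toPoly ((f.1 : ℚ), (f.2.1 : ℚ), (f.2.2.1 : ℚ), (f.2.2.2 : ℚ)) := by
  simp [toPoly]

theorem not_irreducible_of_eval_zero {f g h : MvPolynomial (Fin 2) ℚ} (hf : f = g * h)
    (hg : MvPolynomial.eval 0 g = 0) (hh : MvPolynomial.eval 0 h = 0) : ¬ Irreducible f := by
  intro hirr
  rcases hirr.isUnit_or_isUnit hf with hu | hu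
  · exact not_isUnit_zero (hg ▸ hu.map (MvPolynomial.eval 0))
  · exact not_isUnit_zero (hh ▸ hu.map (MvPolynomial.eval 0))

theorem IrredForm.eq_zero_of_formVal_eq_zero {f : BinaryCubic} (hf : IrredForm f) {x y : ℤ}
    (h : formVal f x y = 0) : x = 0 ∧ y = 0 := by
  obtain ⟨a, b, c, d⟩ := f
  rw [IrredForm, map_toPoly] at hf
  simp only [formVal] at h
  have hy : y = 0 := by
    by_contra hy
    have hyq : (y : ℚ) ≠ 0 := by exact_mod_cast hy
    have hq : (a : ℚ) * x ^ 3 + b * x ^ 2 * y + c * x * y ^ 2 + d * y ^ 3 = 0 := by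
      exact_mod_cast h
    let α : ℚ := a / y
    let β : ℚ := (b + x * α) / y
    let γ : ℚ := (c + x * β) / y
    have e1 : (a : ℚ) = y * α := by simp only [α]; field_simp
    have e2 : (b : ℚ) = y * β - x * α := by simp only [β]; field_simp; ring
    have e3 : (c : ℚ) = y * γ - x * β := by simp only [γ]; field_simp; ring
    have e4 : (d : ℚ) = -(x * γ) := by
      rw [e1, e2, e3] at hq
      have : (y : ℚ) ^ 3 * (d + x * γ) = 0 := by linear_combination hq
      rcases mul_eq_zero.1 this with h0 | h0
      · exact absurd h0 (pow_ne_zero 3 hyq)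
      · linear_combination h0
    refine not_irreducible_of_eval_zero
      (g := MvPolynomial.C (y : ℚ) * MvPolynomial.X 0 - MvPolynomial.C (x : ℚ) * MvPolynomial.X 1)
      (h := MvPolynomial.C α * MvPolynomial.X 0 ^ 2 +
        MvPolynomial.C β * MvPolynomial.X 0 * MvPolynomial.X 1 +
        MvPolynomial.C γ * MvPolynomial.X 1 ^ 2) ?_ (by simp) (by simp) hf
    simp only [toPoly, e1, e2, e3, e4, map_mul, map_sub, map_neg]
    ring
  subst hy
  refine ⟨?_, rfl⟩
  by_contra hx
  have ha : a = 0 := by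
    have : a * x ^ 3 = 0 := by linear_combination h
    exact (mul_eq_zero.1 this).resolve_right (pow_ne_zero 3 hx)
  subst ha
  refine not_irreducible_of_eval_zero
    (g := MvPolynomial.X 1)
    (h := MvPolynomial.C (b : ℚ) * MvPolynomial.X 0 ^ 2 +
      MvPolynomial.C (c : ℚ) * MvPolynomial.X 0 * MvPolynomial.X 1 +
      MvPolynomial.C (d : ℚ) * MvPolynomial.X 1 ^ 2) ?_ (by simp) (by simp) hf
  simp only [toPoly, Int.cast_zero, map_zero]
  ring

theorem totalDegree_toPoly_le (f : ℚ × ℚ × ℚ × ℚ) : (toPoly f).totalDegree ≤ 3 := by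
  have h : (toPoly f).IsHomogeneous 3 := by
    have hC := fun x : ℚ => MvPolynomial.isHomogeneous_C (Fin 2) x
    have h0 := MvPolynomial.isHomogeneous_X ℚ (0 : Fin 2)
    have h1 := MvPolynomial.isHomogeneous_X ℚ (1 : Fin 2)
    exact ((((hC _).mul (h0.pow 3)).add (((hC _).mul (h0.pow 2)).mul h1)).add
      (((hC _).mul h0).mul (h1.pow 2))).add ((hC _).mul (h1.pow 3))
  exact h.totalDegree_le

theorem one_le_totalDegree {g : MvPolynomial (Fin 2) ℚ} (h0 : g ≠ 0) (hu : ¬ IsUnit g) :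
    1 ≤ g.totalDegree := by
  by_contra h
  have h := MvPolynomial.totalDegree_eq_zero_iff_eq_C.1 (Nat.lt_one_iff.1 (not_le.1 h))
  rw [h] at hu h0
  exact hu ((isUnit_iff_ne_zero.2 fun h1 => h0 (by rw [h1, map_zero])).map MvPolynomial.C)

/-- Setting the second variable equal to one. -/
noncomputable def dehom : MvPolynomial (Fin 2) ℚ →ₐ[ℚ] Polynomial ℚ :=
  MvPolynomial.aeval ![Polynomial.X, 1]

theorem natDegree_dehom_le (g : MvPolynomial (Fin 2) ℚ) :
    (dehom g).natDegree ≤ g.totalDegree := by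
  have := MvPolynomial.aeval_natDegree_le g le_rfl ![(Polynomial.X : Polynomial ℚ), 1] (n := 1)
    fun i => by fin_cases i <;> simp
  simpa [dehom] using this

theorem dehom_toPoly (f : ℚ × ℚ × ℚ × ℚ) : dehom (toPoly f) =
    Polynomial.C f.1 * Polynomial.X ^ 3 + Polynomial.C f.2.1 * Polynomial.X ^ 2 +
      Polynomial.C f.2.2.1 * Polynomial.X + Polynomial.C f.2.2.2 := by
  simp [dehom, toPoly]

theorem exists_root_of_eq_mul {f : ℚ × ℚ × ℚ × ℚ} (ha : f.1 ≠ 0)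
    {g h : MvPolynomial (Fin 2) ℚ} (hgh : toPoly f = g * h) (hg : g.totalDegree = 1)
    (hh : h.totalDegree ≤ 2) : ∃ x : ℚ, (dehom (toPoly f)).eval x = 0 := by
  have hd : (dehom (toPoly f)).natDegree = 3 := by
    rw [dehom_toPoly]; exact Polynomial.natDegree_cubic ha
  have hd' : dehom (toPoly f) = dehom g * dehom h := by rw [hgh, map_mul]
  have h1 := natDegree_dehom_le g
  have h2 := natDegree_dehom_le h
  have h3 := Polynomial.natDegree_mul_le (p := dehom g) (q := dehom h)
  rw [← hd', hd] at h3
  have h4 : (dehom g).natDegree = 1 := by omega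
  have h5 : (dehom g).degree = 1 := (Polynomial.degree_eq_iff_natDegree_eq_of_pos one_pos).2 h4
  obtain ⟨x, hx⟩ := Polynomial.exists_root_of_degree_eq_one h5
  exact ⟨x, by rw [hd', Polynomial.eval_mul, hx.eq_zero, zero_mul]⟩

theorem exists_formVal_eq_zero {f : BinaryCubic} (ha : f.1 ≠ 0) (hf : ¬ IrredForm f) :
    ∃ m n : ℤ, 0 < n ∧ IsCoprime m n ∧ formVal f m n = 0 := by
  rw [IrredForm, map_toPoly] at hf
  set F : ℚ × ℚ × ℚ × ℚ := ((f.1 : ℚ), (f.2.1 : ℚ), (f.2.2.1 : ℚ), (f.2.2.2 : ℚ)) with hF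
  have haq : F.1 ≠ 0 := by simpa [hF] using ha
  have hd : (dehom (toPoly F)).natDegree = 3 := by
    rw [dehom_toPoly]; exact Polynomial.natDegree_cubic haq
  have hne : toPoly F ≠ 0 := by
    rintro h; rw [h, map_zero] at hd; simp at hd
  have hnu : ¬ IsUnit (toPoly F) := by
    intro h
    have := Polynomial.natDegree_eq_zero_of_isUnit (h.map dehom)
    omega
  have hroot : ∃ x : ℚ, (dehom (toPoly F)).eval x = 0 := by
    simp only [irreducible_iff, hnu, not_false_iff, true_and, not_forall, not_or] at hf
    obtain ⟨g, h, hgh, hg, hh⟩ := hf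
    have hg0 : g ≠ 0 := by rintro rfl; exact hne (by rw [hgh, zero_mul])
    have hh0 : h ≠ 0 := by rintro rfl; exact hne (by rw [hgh, mul_zero])
    have h1 := one_le_totalDegree hg0 hg
    have h2 := one_le_totalDegree hh0 hh
    have h3 := totalDegree_toPoly_le F
    rw [hgh, MvPolynomial.totalDegree_mul_of_isDomain hg0 hh0] at h3
    by_cases h4 : g.totalDegree = 1
    · exact exists_root_of_eq_mul haq hgh h4 (by omega)
    · exact exists_root_of_eq_mul haq (hgh.trans (mul_comm _ _)) (by omega) (by omega)
  obtain ⟨x, hx⟩ := hroot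
  refine ⟨x.num, x.den, by exact_mod_cast x.den_pos, Rat.isCoprime_num_den x, ?_⟩
  rw [dehom_toPoly] at hx
  simp only [hF, Polynomial.eval_add, Polynomial.eval_mul, Polynomial.eval_C,
    Polynomial.eval_pow, Polynomial.eval_X] at hx
  have hden : (x.den : ℚ) ≠ 0 := by exact_mod_cast x.den_nz
  have hx' : x * x.den = x.num := Rat.mul_den_eq_num x
  have : ((formVal f x.num x.den : ℤ) : ℚ) = 0 := by
    simp only [formVal]
    push_cast
    rw [← hx']
    linear_combination (x.den : ℚ) ^ 3 * hx
  exact_mod_cast this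

/-- The last three coefficients of an integral binary cubic form, as real numbers. -/
def lastCoeffs (f : BinaryCubic) : ℝ × ℝ × ℝ := ((f.2.1 : ℝ), (f.2.2.1 : ℝ), (f.2.2.2 : ℝ))

theorem discR_lastCoeffs (f : BinaryCubic) : discR f.1 (lastCoeffs f) = discF f := by
  simp only [discR, lastCoeffs, discF]
  push_cast
  ring

theorem transforms_twist (p q r s : ℤ) (f : BinaryCubic) :
    Transforms p q r s f.1 (lastCoeffs f) (twist p q r s f).1 (lastCoeffs (twist p q r s f)) := by
  simp only [Transforms, lastCoeffs, twist]
  push_cast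
  exact ⟨rfl, rfl, rfl, rfl⟩

theorem lastCoeffs_neg (f : BinaryCubic) : lastCoeffs (-f) = -lastCoeffs f := by
  simp [lastCoeffs]

theorem discF_neg (f : BinaryCubic) : discF (-f) = discF f := by
  simp only [discF, Prod.fst_neg, Prod.snd_neg]
  ring

theorem intCast_mul_add_ne_zero {p q r s : ℤ} (h : (p * s - q * r) ^ 2 = 1) {z : ℂ}
    (hz : z.im ≠ 0) : (q : ℂ) * z + s ≠ 0 := by
  intro h0
  have hi := congrArg Complex.im h0
  have hr := congrArg Complex.re h0
  simp at hi hr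
  have hq : q = 0 := hi.resolve_right hz
  subst hq
  have hs : s = 0 := by simpa using hr
  subst hs
  simp at h

theorem moebius_im (p q r s : ℤ) (z : ℂ) : ((p * z + r) / (q * z + s)).im =
    ((p * s - q * r : ℤ) : ℝ) * z.im / Complex.normSq (q * z + s) := by
  rw [Complex.div_im]
  simp
  ring

namespace FormChart

variable {σ κ J : ℝ} (P : FormChart σ κ J)

/-- The point `z` is a zero of the covariant of `f`. -/
def IsRoot (f : BinaryCubic) (z : ℂ) : Prop := P.cov f.1 (lastCoeffs f) z 1 = 0

theorem isRoot_neg (f : BinaryCubic) (z : ℂ) : P.IsRoot (-f) z ↔ P.IsRoot f z := by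
  rw [IsRoot, IsRoot, lastCoeffs_neg, Prod.fst_neg, Int.cast_neg, P.cov_neg]

theorem isRoot_conj (f : BinaryCubic) (z : ℂ) :
    P.IsRoot f (starRingEnd ℂ z) ↔ P.IsRoot f z := by
  rw [IsRoot, IsRoot, ← map_one (starRingEnd ℂ), P.cov_conj, map_one, map_eq_zero]

theorem isRoot_twist {p q r s : ℤ} (h : (p * s - q * r) ^ 2 = 1) (f : BinaryCubic) {z : ℂ}
    (hz : z.im ≠ 0) :
    P.IsRoot (twist p q r s f) z ↔ P.IsRoot f ((p * z + r) / (q * z + s)) := by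
  have hne := intCast_mul_add_ne_zero h hz
  have h' : ((p : ℝ) * s - q * r) ^ 2 = 1 := by exact_mod_cast h
  rw [IsRoot, P.cov_transforms p q r s _ _ _ _ _ _ h' (transforms_twist p q r s f), IsRoot,
    ← P.cov_smul _ _ ((p * z + r) / (q * z + s)) 1 _ hne, mul_div_cancel₀ _ hne]
  simp

theorem existsUnique_isRoot_of_pos {f : BinaryCubic} (ha : 0 < f.1)
    (hd : 0 < σ * (discF f : ℝ)) : ∃! z : ℂ, 0 < z.im ∧ P.IsRoot f z := by
  have ha' : (0 : ℝ) < f.1 := by exact_mod_cast ha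
  rw [← discR_lastCoeffs] at hd
  obtain ⟨v, hv, e⟩ := P.surj _ _ ha' hd
  simp only [IsRoot, ← e]
  refine ⟨⟨v.2.1, v.2.2⟩, ⟨hv, (P.cov_chart _ v _ ha' hv hv).2 ⟨rfl, rfl⟩⟩, fun z hz => ?_⟩
  have := (P.cov_chart _ v _ ha' hv hz.1).1 hz.2
  exact Complex.ext this.1 this.2

theorem existsUnique_isRoot {f : BinaryCubic} (ha : f.1 ≠ 0)
    (hd : 0 < σ * (discF f : ℝ)) : ∃! z : ℂ, 0 < z.im ∧ P.IsRoot f z := by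
  rcases lt_or_gt_of_ne ha with h | h
  · simpa only [isRoot_neg] using
      P.existsUnique_isRoot_of_pos (f := -f) (neg_pos.2 h) (by rwa [discF_neg])
  · exact P.existsUnique_isRoot_of_pos h hd

theorem lastCoeffs_mem_closedRegion {f : BinaryCubic} {X : ℝ} {z : ℂ} (ha : 0 < f.1)
    (hd : 0 < σ * (discF f : ℝ)) (hX : σ * (discF f : ℝ) < X) (hz : 0 < z.im)
    (hf : P.IsRoot f z) (h1 : 0 ≤ z.re) (h2 : z.re ≤ 1 / 2) (h3 : 1 ≤ ‖z‖) :
    lastCoeffs f ∈ P.closedRegion f.1 X := by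
  have ha' : (0 : ℝ) < f.1 := by exact_mod_cast ha
  rw [← discR_lastCoeffs] at hd hX
  obtain ⟨v, hv, e⟩ := P.surj _ _ ha' hd
  rw [IsRoot, ← e, P.cov_chart _ v _ ha' hv hz] at hf
  obtain ⟨k₁, hk₁, e₁⟩ := P.sign₁ _ v ha' hv
  obtain ⟨k₂, hk₂, e₂⟩ := P.sign₂ _ v ha' hv
  obtain ⟨k₃, hk₃, e₃⟩ := P.sign₃ _ v ha' hv
  have h4 : 1 ≤ z.re ^ 2 + z.im ^ 2 := by
    have : 1 ≤ ‖z‖ ^ 2 := one_le_pow₀ h3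
    rwa [← Complex.normSq_eq_norm_sq, Complex.normSq_apply, ← sq, ← sq] at this
  rw [hf.1, hf.2] at h4
  rw [hf.1] at h1 h2
  rw [e] at e₁ e₂ e₃
  refine ⟨hd, sub_pos.2 hX, ?_, ?_, ?_⟩
  · rw [mem_ofPred_eq, e₁]; positivity
  · rw [mem_ofPred_eq, e₂]; exact mul_nonneg hk₂.le (by linarith)
  · rw [mem_ofPred_eq, e₃]; exact mul_nonneg hk₃.le (by linarith)

theorem exists_isRoot_of_mem_openRegion {f : BinaryCubic} {X : ℝ} (ha : 0 < f.1)
    (h : lastCoeffs f ∈ P.openRegion f.1 X) : ∃ z : ℂ, 0 < z.im ∧ P.IsRoot f z ∧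
      0 < z.re ∧ z.re < 1 / 2 ∧ 1 < ‖z‖ := by
  have ha' : (0 : ℝ) < f.1 := by exact_mod_cast ha
  obtain ⟨hd, -, h1, h2, h3⟩ := h
  obtain ⟨v, hv, e⟩ := P.surj _ _ ha' hd
  obtain ⟨k₁, hk₁, e₁⟩ := P.sign₁ _ v ha' hv
  obtain ⟨k₂, hk₂, e₂⟩ := P.sign₂ _ v ha' hv
  obtain ⟨k₃, hk₃, e₃⟩ := P.sign₃ _ v ha' hv
  rw [e] at e₁ e₂ e₃
  rw [mem_ofPred_eq, e₁, mul_pos_iff_of_pos_left hk₁] at h1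
  rw [mem_ofPred_eq, e₂, mul_pos_iff_of_pos_left hk₂] at h2
  rw [mem_ofPred_eq, e₃, mul_pos_iff_of_pos_left hk₃] at h3
  refine ⟨⟨v.2.1, v.2.2⟩, hv, ?_, h1, by linarith, ?_⟩
  · rw [IsRoot, ← e]
    exact (P.cov_chart _ v _ ha' hv hv).2 ⟨rfl, rfl⟩
  · rw [← one_lt_sq_iff₀ (norm_nonneg _), ← Complex.normSq_eq_norm_sq, Complex.normSq_apply]
    simp only
    linarith

open UpperHalfPlane ModularGroup Modular MatrixGroups in
theorem exists_twist_reduced {f : BinaryCubic}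
    (h0 : ∀ x y, formVal f x y = 0 → x = 0 ∧ y = 0) (hd : 0 < σ * (discF f : ℝ)) :
    ∃ g, FormEquiv f g ∧ 0 < g.1 ∧
      ∀ X, σ * (discF f : ℝ) < X → lastCoeffs g ∈ P.closedRegion g.1 X := by
  have hlead : ∀ p q r s : ℤ, (p * s - q * r) ^ 2 = 1 → (twist p q r s f).1 ≠ 0 := by
    intro p q r s h h1
    have h2 : (p * s - q * r) * formVal f p q = 0 := by
      simpa [formVal, twist] using h1
    have h3 : p * s - q * r ≠ 0 := by rintro h4; simp [h4] at h
    obtain ⟨rfl, rfl⟩ := h0 _ _ ((mul_eq_zero.1 h2).resolve_left h3)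
    simp at h
  obtain ⟨z, ⟨hz, hfz⟩, -⟩ := P.existsUnique_isRoot
    (by simpa [twist_one] using hlead 1 0 0 1 rfl) hd
  -- moving the zero of the covariant to the right half of the fundamental domain
  obtain ⟨p, q, r, s, w, hdet, hw, hr, hw0, hw1, hw2⟩ : ∃ (p q r s : ℤ) (w : ℂ),
      (p * s - q * r) ^ 2 = 1 ∧ 0 < w.im ∧ P.IsRoot (twist p q r s f) w ∧ 0 ≤ w.re ∧
        w.re ≤ 1 / 2 ∧ 1 ≤ ‖w‖ := by
    obtain ⟨γ, hγ⟩ := exists_smul_mem_fd (⟨z, hz⟩ : ℍ)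
    set w : ℍ := γ • ⟨z, hz⟩ with hw
    have hinv : γ⁻¹ • w = ⟨z, hz⟩ := by rw [hw, inv_smul_smul]
    have hinv' := congrArg UpperHalfPlane.coe hinv
    rw [UpperHalfPlane.coe_specialLinearGroup_apply] at hinv'
    simp only [algebraMap_int_eq, eq_intCast, Complex.ofReal_intCast] at hinv'
    have hdet := Matrix.det_fin_two (γ⁻¹ : SL(2, ℤ)).1
    rw [Matrix.SpecialLinearGroup.det_coe] at hdet
    generalize (γ⁻¹ : SL(2, ℤ)).1 0 0 = p at *
    generalize (γ⁻¹ : SL(2, ℤ)).1 0 1 = r at *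
    generalize (γ⁻¹ : SL(2, ℤ)).1 1 0 = q at *
    generalize (γ⁻¹ : SL(2, ℤ)).1 1 1 = s at *
    have hdet' : (p * s - q * r) ^ 2 = 1 := by
      rw [show p * s - q * r = 1 by linear_combination -hdet, one_pow]
    have hroot : P.IsRoot (twist p q r s f) w := by
      rw [P.isRoot_twist hdet' f w.im_ne_zero, hinv']
      exact hfz
    obtain ⟨him, hnorm, hre⟩ : (w : ℂ) ∈ {z : ℂ | 0 < z.im ∧ 1 ≤ ‖z‖ ∧ |z.re| ≤ 1 / 2} := by
      rw [← coe_fd]; exact mem_image_of_mem _ hγ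
    rcases le_total 0 (w : ℂ).re with h | h
    · exact ⟨p, q, r, s, w, hdet', him, hroot, h, (le_abs_self _).trans hre, hnorm⟩
    · refine ⟨(-1) * p + 0 * r, (-1) * q + 0 * s, 0 * p + 1 * r, 0 * q + 1 * s,
        -starRingEnd ℂ (w : ℂ), ?_, by simpa using him, ?_, by simpa using h, ?_,
        by simpa using hnorm⟩
      rotate_left
      · rw [← twist_twist p q r s (-1) 0 0 1,
          P.isRoot_twist (by norm_num) _ (by simpa using him.ne')]
        simpa [isRoot_conj] using hroot
      · simpa using (neg_le_abs _).trans hre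
      · linear_combination hdet'
  have hdisc := discF_twist hdet f
  rcases lt_or_gt_of_ne (hlead p q r s hdet) with h | h
  · refine ⟨-twist p q r s f, (formEquiv_iff _ _).2 ⟨-p, -q, -r, -s, by linear_combination hdet,
      (twist_neg p q r s f).symm⟩, neg_pos.2 h, fun X hX => ?_⟩
    exact P.lastCoeffs_mem_closedRegion (neg_pos.2 h) (by rwa [discF_neg, hdisc])
      (by rwa [discF_neg, hdisc]) hw ((P.isRoot_neg _ _).2 hr) hw0 hw1 hw2
  · refine ⟨twist p q r s f, (formEquiv_iff _ _).2 ⟨p, q, r, s, hdet, rfl⟩, h, fun X hX => ?_⟩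
    exact P.lastCoeffs_mem_closedRegion h (by rwa [hdisc]) (by rwa [hdisc]) hw hr hw0 hw1 hw2

open UpperHalfPlane ModularGroup Modular MatrixGroups in
theorem eq_one_or_neg_one_of_mem_halfDomain {p q r s : ℤ} (h : p * s - q * r = 1) {z w : ℂ}
    (hz : 0 < z.im) (hz1 : 1 < ‖z‖) (hz2 : |z.re| < 1 / 2) (hw : 0 < w.im) (hw1 : 1 < ‖w‖)
    (hw2 : |w.re| < 1 / 2) (hzw : w = (p * z + r) / (q * z + s)) :
    (p = 1 ∧ q = 0 ∧ r = 0 ∧ s = 1) ∨ (p = -1 ∧ q = 0 ∧ r = 0 ∧ s = -1) := by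
  let γ : SL(2, ℤ) := ⟨!![p, r; q, s], by rw [Matrix.det_fin_two_of]; linear_combination h⟩
  have hmem : ∀ {z : ℂ} (hz : 0 < z.im), 1 < ‖z‖ → |z.re| < 1 / 2 → (⟨z, hz⟩ : ℍ) ∈ 𝒟ᵒ := by
    intro z hz h1 h2
    have : z ∈ (↑) '' 𝒟ᵒ := by rw [coe_fdo]; exact ⟨hz, h1, h2⟩
    obtain ⟨t, ht, e⟩ := this
    rwa [show (⟨z, hz⟩ : ℍ) = t from UpperHalfPlane.ext e.symm]
  have hγ : γ • (⟨z, hz⟩ : ℍ) = ⟨w, hw⟩ := by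
    refine UpperHalfPlane.ext ?_
    rw [UpperHalfPlane.coe_specialLinearGroup_apply, UpperHalfPlane.coe_mk]
    refine Eq.trans ?_ hzw.symm
    simp [γ]
  rcases eq_one_or_neg_one_of_mem_fdo_mem_fdo (hmem hz hz1 hz2)
    (hγ ▸ hmem hw hw1 hw2) with h1 | h1
  · left
    have e := fun i j => congrArg (fun A : SL(2, ℤ) => A.1 i j) h1
    exact ⟨by simpa [γ] using e 0 0, by simpa [γ] using e 1 0, by simpa [γ] using e 0 1,
      by simpa [γ] using e 1 1⟩
  · right
    have e := fun i j => congrArg (fun A : SL(2, ℤ) => A.1 i j) h1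
    exact ⟨by simpa [γ] using e 0 0, by simpa [γ] using e 1 0, by simpa [γ] using e 0 1,
      by simpa [γ] using e 1 1⟩

theorem eq_of_formEquiv {f g : BinaryCubic} {X : ℝ} (hf : 0 < f.1) (hg : 0 < g.1)
    (hfX : lastCoeffs f ∈ P.openRegion f.1 X) (hgX : lastCoeffs g ∈ P.openRegion g.1 X)
    (h : FormEquiv f g) : f = g := by
  obtain ⟨p, q, r, s, hdet, rfl⟩ := (formEquiv_iff _ _).1 h
  obtain ⟨z, hz, hz0, hz1, hz2, hz3⟩ := P.exists_isRoot_of_mem_openRegion hf hfX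
  obtain ⟨w, hw, hw0, hw1, hw2, hw3⟩ := P.exists_isRoot_of_mem_openRegion hg hgX
  have hu : ∀ t : ℂ, 0 < t.im → P.IsRoot f t → z = t := fun t ht hft =>
    (P.existsUnique_isRoot_of_pos hf (by rw [← discR_lastCoeffs]; exact hfX.1)).unique
      ⟨hz, hz0⟩ ⟨ht, hft⟩
  have hneg : twist (-1) 0 0 (-1) f ≠ twist p q r s f := by
    intro e
    rw [← e, ← neg_zero, twist_neg, neg_zero, twist_one] at hg
    exact absurd hg (by simpa using hf.le)
  rw [P.isRoot_twist hdet f hw.ne'] at hw0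
  have hne := Complex.normSq_pos.2 (intCast_mul_add_ne_zero hdet hw.ne')
  have him := moebius_im p q r s w
  have hwabs : |w.re| < 1 / 2 := by rwa [abs_of_pos hw1]
  have hzabs : |z.re| < 1 / 2 := by rwa [abs_of_pos hz1]
  rcases sq_eq_sq_iff_eq_or_eq_neg.1 (hdet.trans (one_pow 2).symm) with hdet' | hdet'
  · have e := hu _ (by rw [him, hdet', Int.cast_one]; positivity) hw0
    rcases eq_one_or_neg_one_of_mem_halfDomain hdet' hw hw3 hwabs hz hz3 hzabs e with
      ⟨rfl, rfl, rfl, rfl⟩ | ⟨rfl, rfl, rfl, rfl⟩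
    · exact (twist_one f).symm
    · exact absurd rfl hneg
  · have hpos : 0 < (starRingEnd ℂ ((p * w + r) / (q * w + s))).im := by
      rw [Complex.conj_im, him, hdet']
      push_cast
      rw [← neg_div]
      simp only [neg_mul, one_mul, neg_neg]
      positivity
    have e := hu _ hpos ((P.isRoot_conj _ _).2 hw0)
    have e' : z = ((-p : ℤ) * (-starRingEnd ℂ w) + r) / ((-q : ℤ) * (-starRingEnd ℂ w) + s) := by
      rw [e]; simp
    exfalso
    rcases eq_one_or_neg_one_of_mem_halfDomain (by linear_combination -hdet')
      (by simpa using hw) (by simpa using hw3) (by simpa using hwabs) hz hz3 hzabs e' with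
      ⟨h1, h2, rfl, rfl⟩ | ⟨h1, h2, rfl, rfl⟩ <;>
    · rw [h1, h2] at e'
      have := congrArg Complex.re e'
      simp [div_neg] at this
      linarith

end FormChart

theorem exists_card_quadruples_le : ∃ C : ℝ, 0 ≤ C ∧ ∀ Z : ℝ, 0 ≤ Z →
    ∀ T : Finset (ℤ × ℤ × ℤ × ℤ),
    (∀ t ∈ T, t.1 * (t.2.1 * (t.2.2.1 * t.2.2.2)) ≠ 0 ∧
      |((t.1 * (t.2.1 * (t.2.2.1 * t.2.2.2)) : ℤ) : ℝ)| ≤ Z) →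
    (T.card : ℝ) ≤ C * Z ^ (7 / 6 : ℝ) := by
  let w : ℤ → ℝ := fun n => |(n : ℝ)| ^ (-(7 / 6) : ℝ)
  have hw : Summable w := Real.summable_abs_int_rpow (by norm_num)
  have hw0 : 0 ≤ w := fun n => by positivity
  have h2 := hw.mul_of_nonneg hw hw0 hw0
  have h2' : (0 : ℤ × ℤ → ℝ) ≤ fun t => w t.1 * w t.2 :=
    fun t => mul_nonneg (hw0 _) (hw0 _)
  have h3 := hw.mul_of_nonneg h2 hw0 h2'
  have h3' : (0 : ℤ × ℤ × ℤ → ℝ) ≤ fun t => w t.1 * (w t.2.1 * w t.2.2) :=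
    fun t => mul_nonneg (hw0 _) (h2' _)
  have h4 := hw.mul_of_nonneg h3 hw0 h3'
  have h4' : ∀ t : ℤ × ℤ × ℤ × ℤ, 0 ≤ w t.1 * (w t.2.1 * (w t.2.2.1 * w t.2.2.2)) :=
    fun t => mul_nonneg (hw0 _) (h3' _)
  refine ⟨∑' t : ℤ × ℤ × ℤ × ℤ, w t.1 * (w t.2.1 * (w t.2.2.1 * w t.2.2.2)), tsum_nonneg h4',
    fun Z hZ T hT => ?_⟩
  calc (T.card : ℝ) = ∑ t ∈ T, (1 : ℝ) := by simp
    _ ≤ ∑ t ∈ T, w t.1 * (w t.2.1 * (w t.2.2.1 * w t.2.2.2)) * Z ^ (7 / 6 : ℝ) := by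
        refine Finset.sum_le_sum fun t ht => ?_
        obtain ⟨h0, hle⟩ := hT t ht
        have hpos : 0 < |((t.1 * (t.2.1 * (t.2.2.1 * t.2.2.2)) : ℤ) : ℝ)| := by
          rw [abs_pos]; exact_mod_cast h0
        have e : w t.1 * (w t.2.1 * (w t.2.2.1 * w t.2.2.2)) =
            |((t.1 * (t.2.1 * (t.2.2.1 * t.2.2.2)) : ℤ) : ℝ)| ^ (-(7 / 6) : ℝ) := by
          push_cast
          rw [abs_mul, abs_mul, abs_mul, mul_rpow, mul_rpow, mul_rpow] <;> positivity
        rw [e, rpow_neg hpos.le, ← div_eq_inv_mul, one_le_div (by positivity)]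
        exact rpow_le_rpow hpos.le hle (by norm_num)
    _ ≤ _ := by
        rw [← Finset.sum_mul]
        exact mul_le_mul_of_nonneg_right (h4.sum_le_tsum _ fun t _ => h4' t) (by positivity)

/-- The conditions on the coefficients of `f` satisfied by all reduced forms of discriminant less
than `p ^ 12` in absolute value. -/
def CoeffBounds (p : ℝ) (f : BinaryCubic) : Prop :=
  0 < f.1 ∧ (f.1 : ℝ) ≤ p ^ 3 ∧ |(f.2.1 : ℝ)| ≤ 18 * p ^ 3 ∧ |(f.2.2.1 : ℝ)| ≤ 18 * p ^ 4 ∧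
    |((f.1 * f.2.2.2 : ℤ) : ℝ)| ≤ 18 * p ^ 6

theorem card_le_of_last_eq_zero {p : ℝ} (hp : 1 ≤ p) (T : Finset BinaryCubic)
    (hT : ∀ f ∈ T, CoeffBounds p f ∧ f.2.2.2 = 0) : (T.card : ℝ) ≤ 8748 * p ^ 10 := by
  have hp3 : 1 ≤ p ^ 3 := one_le_pow₀ hp
  have hp4 : 1 ≤ p ^ 4 := one_le_pow₀ hp
  let I : ℝ → Finset ℤ := fun B => Finset.Icc (-⌊B⌋) ⌊B⌋
  have hsub : T ⊆ I (p ^ 3) ×ˢ I (18 * p ^ 3) ×ˢ I (18 * p ^ 4) ×ˢ {0} := by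
    intro f hf
    obtain ⟨⟨h0, h1, h2, h3, -⟩, h4⟩ := hT f hf
    have h0' : (0 : ℝ) < f.1 := by exact_mod_cast h0
    simp only [Finset.mem_product, Finset.mem_singleton]
    exact ⟨mem_Icc_neg_floor (by rwa [abs_of_pos h0']), mem_Icc_neg_floor h2,
      mem_Icc_neg_floor h3, h4⟩
  calc (T.card : ℝ) ≤ (I (p ^ 3)).card * ((I (18 * p ^ 3)).card * (I (18 * p ^ 4)).card) := by
        have := Finset.card_le_card hsub
        simp only [Finset.card_product, Finset.card_singleton, mul_one] at this
        exact_mod_cast this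
    _ ≤ (3 * p ^ 3) * ((3 * (18 * p ^ 3)) * (3 * (18 * p ^ 4))) := by
        gcongr
        · exact (card_Icc_neg_floor_le (by linarith)).trans (by linarith)
        · exact (card_Icc_neg_floor_le (by linarith)).trans (by linarith)
        · exact (card_Icc_neg_floor_le (by linarith)).trans (by linarith)
    _ = 8748 * p ^ 10 := by ring

theorem exists_root_parameters {f : BinaryCubic} (ha : f.1 ≠ 0) (hf : ¬ IrredForm f) :
    ∃ t : ℤ × ℤ × ℤ × ℤ, t.1 * (t.2.1 * (t.2.2.1 * t.2.2.2)) = f.1 * f.2.2.2 ∧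
      f.1 = t.1 * t.2.1 ∧ f.2.2.2 = t.2.2.1 * t.2.2.2 ∧ formVal f t.2.2.1 t.1 = 0 := by
  obtain ⟨m, n, hn, hmn, h⟩ := exists_formVal_eq_zero ha hf
  rw [formVal] at h
  obtain ⟨a', ha'⟩ : n ∣ f.1 := by
    refine (hmn.symm.pow_right (n := 3)).dvd_of_dvd_mul_right
      ⟨-(f.2.1 * m ^ 2 + f.2.2.1 * m * n + f.2.2.2 * n ^ 2), ?_⟩
    linear_combination h
  obtain ⟨d', hd'⟩ : m ∣ f.2.2.2 := by
    refine (hmn.pow_right (n := 3)).dvd_of_dvd_mul_right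
      ⟨-(f.1 * m ^ 2 + f.2.1 * m * n + f.2.2.1 * n ^ 2), ?_⟩
    linear_combination h
  exact ⟨(n, a', m, d'), by simp only [ha', hd']; ring, ha', hd', h⟩

theorem exists_card_reducible_le : ∃ K : ℝ, ∀ p : ℝ, 1 ≤ p → ∀ T : Finset BinaryCubic,
    (∀ f ∈ T, CoeffBounds p f ∧ ¬ IrredForm f) → (T.card : ℝ) ≤ K * p ^ 10 := by
  obtain ⟨C, hC0, hC⟩ := exists_card_quadruples_le
  refine ⟨8748 + 54 * (C * 18 ^ (7 / 6 : ℝ)), fun p hp T hT => ?_⟩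
  have hp3 : 1 ≤ p ^ 3 := one_le_pow₀ hp
  have h0 : ((T.filter fun f => f.2.2.2 = 0).card : ℝ) ≤ 8748 * p ^ 10 :=
    card_le_of_last_eq_zero hp _ fun f hf => by
      rw [Finset.mem_filter] at hf
      exact ⟨(hT f hf.1).1, hf.2⟩
  have h1 : ((T.filter fun f => ¬ f.2.2.2 = 0).card : ℝ) ≤
      54 * (C * 18 ^ (7 / 6 : ℝ)) * p ^ 10 := by
    set U := T.filter fun f => ¬ f.2.2.2 = 0 with hU
    have hex : ∀ f : BinaryCubic, ∃ t : ℤ × ℤ × ℤ × ℤ, f ∈ U →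
        t.1 * (t.2.1 * (t.2.2.1 * t.2.2.2)) = f.1 * f.2.2.2 ∧
        f.1 = t.1 * t.2.1 ∧ f.2.2.2 = t.2.2.1 * t.2.2.2 ∧ formVal f t.2.2.1 t.1 = 0 := by
      intro f
      by_cases hf : f ∈ U
      · have hf' := Finset.mem_filter.1 hf
        have hfT := hT f hf'.1
        obtain ⟨t, ht⟩ := exists_root_parameters hfT.1.1.ne' hfT.2
        exact ⟨t, fun _ => ht⟩
      · exact ⟨0, fun h => absurd h hf⟩
    choose t ht using hex
    have hinj : Set.InjOn (fun f : BinaryCubic => (f.2.1, t f)) U := by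
      intro f hf g hg hfg
      obtain ⟨hb, htt⟩ := Prod.mk.inj hfg
      obtain ⟨f1, f2, f3, f4⟩ := ht f hf
      obtain ⟨g1, g2, g3, g4⟩ := ht g hg
      rw [← htt] at g2 g3 g4
      have hfU := Finset.mem_filter.1 hf
      have ha : f.1 ≠ 0 := (hT f hfU.1).1.1.ne'
      have hn : (t f).1 ≠ 0 := fun h => ha (by rw [f2, h, zero_mul])
      have hm : (t f).2.2.1 ≠ 0 := fun h => hfU.2 (by rw [f3, h, zero_mul])
      have e1 : f.1 = g.1 := f2.trans g2.symm
      have e4 : f.2.2.2 = g.2.2.2 := f3.trans g3.symm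
      have e3 : f.2.2.1 = g.2.2.1 := by
        rw [formVal] at f4 g4
        rw [← hb, ← e1, ← e4] at g4
        refine mul_right_cancel₀ (mul_ne_zero hm (pow_ne_zero 2 hn)) ?_
        linear_combination f4 - g4
      exact Prod.ext e1 (Prod.ext hb (Prod.ext e3 e4))
    have hsub : U.image (fun f : BinaryCubic => (f.2.1, t f)) ⊆
        Finset.Icc (-⌊18 * p ^ 3⌋) ⌊18 * p ^ 3⌋ ×ˢ U.image t := by
      intro v hv
      obtain ⟨f, hf, rfl⟩ := Finset.mem_image.1 hv
      exact Finset.mem_product.2 ⟨mem_Icc_neg_floor (hT f (Finset.mem_filter.1 hf).1).1.2.2.1,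
        Finset.mem_image_of_mem t hf⟩
    have hquad := hC (18 * p ^ 6) (by positivity) (U.image t) fun v hv => by
      obtain ⟨f, hf, rfl⟩ := Finset.mem_image.1 hv
      have hfU := Finset.mem_filter.1 hf
      have hfT := (hT f hfU.1).1
      rw [(ht f hf).1]
      exact ⟨mul_ne_zero hfT.1.ne' hfU.2, hfT.2.2.2.2⟩
    have hcard := Finset.card_le_card hsub
    rw [Finset.card_image_of_injOn hinj, Finset.card_product] at hcard
    calc (U.card : ℝ) ≤ (Finset.Icc (-⌊18 * p ^ 3⌋) ⌊18 * p ^ 3⌋).card * (U.image t).card := by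
          exact_mod_cast hcard
      _ ≤ 3 * (18 * p ^ 3) * (C * (18 * p ^ 6) ^ (7 / 6 : ℝ)) := by
          gcongr
          exact (card_Icc_neg_floor_le (by linarith)).trans (by linarith)
      _ = _ := by
          rw [mul_rpow (by norm_num) (by positivity), ← rpow_natCast_mul (by positivity)]
          norm_num
          ring
  rw [← Finset.card_filter_add_card_filter_not (s := T) (fun f => f.2.2.2 = 0),
    Nat.cast_add, add_mul]
  exact add_le_add h0 h1

/-- The forms with positive first coefficient whose other coefficients lie in a given region
depending on it. -/
def formsIn (R : ℝ → Set (ℝ × ℝ × ℝ)) : Set BinaryCubic :=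
  {f | 0 < f.1 ∧ lastCoeffs f ∈ R f.1}

theorem finite_setOf_coeffBounds (p : ℝ) : {f | CoeffBounds p f}.Finite := by
  let I : ℝ → Finset ℤ := fun B => Finset.Icc (-⌊B⌋) ⌊B⌋
  refine (I (p ^ 3) ×ˢ I (18 * p ^ 3) ×ˢ I (18 * p ^ 4) ×ˢ I (18 * p ^ 6)).finite_toSet.subset ?_
  rintro f ⟨h0, h1, h2, h3, h4⟩
  have h0' : (1 : ℝ) ≤ f.1 := by exact_mod_cast h0
  simp only [Finset.coe_product, mem_prod, Finset.mem_coe]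
  refine ⟨mem_Icc_neg_floor (by rwa [abs_of_pos (by linarith)]), mem_Icc_neg_floor h2,
    mem_Icc_neg_floor h3, mem_Icc_neg_floor (le_trans ?_ h4)⟩
  push_cast
  rw [abs_mul]
  exact le_mul_of_one_le_left (abs_nonneg _) (h0'.trans (le_abs_self _))

theorem ncard_formsIn {R : ℝ → Set (ℝ × ℝ × ℝ)} (hfin : (formsIn R).Finite) {L : ℝ}
    (hL : ∀ f ∈ formsIn R, (f.1 : ℝ) ≤ L) :
    ((formsIn R).ncard : ℝ) = ∑ a ∈ Finset.Icc 1 ⌊L⌋₊, ((latticePoints (R a)).ncard : ℝ) := by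
  rw [ncard_eq_toFinset_card _ hfin, Finset.card_eq_sum_card_fiberwise (f := fun f => f.1.toNat)
    (t := Finset.Icc 1 ⌊L⌋₊), Nat.cast_sum]
  · refine Finset.sum_congr rfl fun a ha => ?_
    have ha1 := (Finset.mem_Icc.1 ha).1
    rw [← ncard_image_of_injective (latticePoints (R a)) (Prod.mk_right_injective (a : ℤ)),
      ← ncard_coe_finset]
    congr 2
    ext f
    obtain ⟨x, v⟩ := f
    simp only [Finset.coe_filter, Finite.mem_toFinset, mem_ofPred_eq, mem_image, formsIn]
    constructor
    · rintro ⟨⟨h0, h1⟩, h2⟩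
      have hx : x = a := by omega
      subst hx
      exact ⟨v, by simpa [latticePoints, lastCoeffs] using h1, rfl⟩
    · rintro ⟨w, hw, e⟩
      obtain ⟨rfl, rfl⟩ := Prod.mk.inj e
      exact ⟨⟨by omega, by simpa [latticePoints, lastCoeffs] using hw⟩, by simp⟩
  · intro f hf
    rw [Finset.mem_coe, Finite.mem_toFinset] at hf
    have h0 := hf.1
    rw [Finset.mem_coe, Finset.mem_Icc]
    refine ⟨by simp only; omega, Nat.le_floor ?_⟩
    have : ((f.1.toNat : ℤ) : ℝ) = f.1 := by rw [Int.toNat_of_nonneg h0.le]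
    rw [← Int.cast_natCast, this]
    exact hL f hf

/-- The irreducible forms of discriminant `D` with `0 < σD < X`. -/
abbrev FormsUpTo (σ X : ℝ) : Type :=
  {f : BinaryCubic // IrredForm f ∧ 0 < σ * (discF f : ℝ) ∧ σ * (discF f : ℝ) < X}

theorem quot_mk_eq_iff_formEquiv {Q : BinaryCubic → Prop} (f g : {f // Q f}) :
    Quot.mk (fun f g : {f // Q f} => FormEquiv f.1 g.1) f = Quot.mk _ g ↔ FormEquiv f.1 g.1 :=
  Equivalence.quot_mk_eq_iff (formEquiv_equivalence.comap Subtype.val) f g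

namespace FormChart

variable {σ κ J : ℝ} (P : FormChart σ κ J)

theorem coeffBounds_of_mem_closedRegion (hκ : 2 ≤ κ) {p : ℝ} (hp : 0 < p) {f : BinaryCubic}
    (hf : 0 < f.1) (h : lastCoeffs f ∈ P.closedRegion f.1 (p ^ 12)) : CoeffBounds p f := by
  have ha : (1 : ℝ) ≤ f.1 := by exact_mod_cast hf
  rw [show p ^ 12 = (p ^ 3) ^ 4 by ring] at h
  obtain ⟨h1, h2, h3, h4⟩ := P.closedRegion_bounds hκ (by linarith) (pow_pos hp 3) h
  refine ⟨hf, h1, h2, ?_, ?_⟩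
  · refine le_of_pow_le_pow_left₀ three_ne_zero (by positivity) ?_
    calc |(f.2.2.1 : ℝ)| ^ 3 ≤ f.1 * |(f.2.2.1 : ℝ)| ^ 3 := le_mul_of_one_le_left (by positivity) ha
      _ ≤ _ := h3
      _ = _ := by ring
  · push_cast
    rw [abs_mul, abs_of_pos (by linarith)]
    calc _ ≤ _ := h4
      _ = _ := by ring

theorem exists_injective_to_formsIn (X : ℝ) :
    ∃ φ : Quot (fun f g : FormsUpTo σ X => FormEquiv f.1 g.1) →
      formsIn fun a => P.closedRegion a X, φ.Injective := by
  have hex : ∀ c : Quot (fun f g : FormsUpTo σ X => FormEquiv f.1 g.1),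
      ∃ g : formsIn fun a => P.closedRegion a X, FormEquiv c.out.1 g.1 := by
    intro c
    obtain ⟨h1, h2, h3⟩ := c.out.2
    obtain ⟨g, hg, hg0, hgX⟩ := P.exists_twist_reduced
      (fun x y h => h1.eq_zero_of_formVal_eq_zero h) h2
    exact ⟨⟨g, hg0, hgX X h3⟩, hg⟩
  choose φ hφ using hex
  refine ⟨φ, fun c c' e => ?_⟩
  rw [← Quot.out_eq c, ← Quot.out_eq c', quot_mk_eq_iff_formEquiv]
  exact formEquiv_equivalence.trans (hφ c) (formEquiv_equivalence.symm (e ▸ hφ c'))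

theorem exists_injective_from_formsIn (X : ℝ) :
    ∃ ψ : ((formsIn fun a => P.openRegion a X) ∩ {f | IrredForm f} : Set BinaryCubic) →
      Quot (fun f g : FormsUpTo σ X => FormEquiv f.1 g.1), ψ.Injective := by
  have h : ∀ f ∈ (formsIn fun a => P.openRegion a X) ∩ {f | IrredForm f},
      IrredForm f ∧ 0 < σ * (discF f : ℝ) ∧ σ * (discF f : ℝ) < X := fun f hf => by
    rw [← discR_lastCoeffs]
    exact ⟨hf.2, hf.1.2.1, sub_pos.1 hf.1.2.2.1⟩
  refine ⟨fun f => Quot.mk _ ⟨f.1, h f.1 f.2⟩, fun f g hfg => Subtype.ext ?_⟩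
  exact P.eq_of_formEquiv f.2.1.1 g.2.1.1 f.2.1.2 g.2.1.2
    ((quot_mk_eq_iff_formEquiv (⟨f.1, h f.1 f.2⟩ : FormsUpTo σ X) ⟨g.1, h g.1 g.2⟩).1 hfg)

theorem exists_abs_countClasses_sub_le (P : FormChart σ κ J) (hκ : 2 ≤ κ) : ∃ K, ∀ X : ℝ, 1 ≤ X →
    |(countClasses (fun f => IrredForm f ∧ 0 < σ * (discF f : ℝ) ∧ σ * (discF f : ℝ) < X) : ℝ) -
      J * π ^ 2 / (24 * κ ^ 2) * X| ≤ K * X ^ (5 / 6 : ℝ) := by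
  obtain ⟨K₁, hK₁⟩ := P.exists_abs_sum_ncard_closedRegion_sub_le hκ
  obtain ⟨K₂, hK₂⟩ := P.exists_abs_sum_ncard_openRegion_sub_le hκ
  obtain ⟨K₃, hK₃⟩ := exists_card_reducible_le
  refine ⟨max K₁ (K₂ + K₃), fun X hX => ?_⟩
  have hX0 : 0 < X := by linarith
  have hp0 : 1 ≤ X ^ (1 / 12 : ℝ) := one_le_rpow hX (by norm_num)
  have hp12 : (X ^ (1 / 12 : ℝ)) ^ 12 = X := by
    rw [← rpow_mul_natCast hX0.le]; norm_num
  have hp10 : (X ^ (1 / 12 : ℝ)) ^ 10 = X ^ (5 / 6 : ℝ) := by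
    rw [← rpow_mul_natCast hX0.le]; norm_num
  set p := X ^ (1 / 12 : ℝ)
  have hcb : ∀ f ∈ formsIn fun a => P.closedRegion a X, CoeffBounds p f := fun f hf =>
    P.coeffBounds_of_mem_closedRegion hκ (by linarith) hf.1 (hp12.symm ▸ hf.2)
  have hoc : (formsIn fun a => P.openRegion a X) ⊆ formsIn fun a => P.closedRegion a X :=
    fun f hf => ⟨hf.1, P.openRegion_subset_closedRegion _ _ hf.2⟩
  have hcfin : (formsIn fun a => P.closedRegion a X).Finite :=
    (finite_setOf_coeffBounds p).subset hcb
  have hofin := hcfin.subset hoc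
  have hL : ∀ f ∈ formsIn fun a => P.closedRegion a X, (f.1 : ℝ) ≤ X ^ (1 / 4 : ℝ) := fun f hf =>
    P.le_rpow_of_mem_closedRegion hκ (by exact_mod_cast hf.1) hX0 hf.2
  have hc := ncard_formsIn hcfin hL
  have ho := ncard_formsIn hofin fun f hf => hL f (hoc hf)
  have hK₁' := hK₁ X hX
  have hK₂' := hK₂ X hX
  rw [← hc] at hK₁'
  rw [← ho] at hK₂'
  have : Finite (formsIn fun a => P.closedRegion a X) := hcfin
  obtain ⟨φ, hφ⟩ := P.exists_injective_to_formsIn X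
  have : Finite (Quot fun f g : FormsUpTo σ X => FormEquiv f.1 g.1) := Finite.of_injective φ hφ
  have hup := Nat.card_le_card_of_injective φ hφ
  obtain ⟨ψ, hψ⟩ := P.exists_injective_from_formsIn X
  have hlow := Nat.card_le_card_of_injective ψ hψ
  have hsplit := ncard_inter_add_ncard_sdiff_eq_ncard (formsIn fun a => P.openRegion a X)
    {f | IrredForm f} hofin
  have hred := hK₃ p hp0 (hofin.sdiff (t := {f | IrredForm f})).toFinset fun f hf => by
    rw [Finite.mem_toFinset] at hf
    exact ⟨hcb f (hoc hf.1), hf.2⟩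
  rw [← ncard_eq_toFinset_card _ hofin.sdiff, hp10] at hred
  rw [Nat.card_coe_set_eq] at hup hlow
  change countClasses (fun f => _ ∧ _ ∧ _) ≤ _ at hup
  change _ ≤ countClasses (fun f => _ ∧ _ ∧ _) at hlow
  have hup' := (Nat.cast_le (α := ℝ)).2 hup
  have hlow' := (Nat.cast_le (α := ℝ)).2 hlow
  have hsplit' := congrArg (Nat.cast (R := ℝ)) hsplit
  push_cast at hsplit'
  have hY : 0 ≤ X ^ (5 / 6 : ℝ) := by positivity
  have hm₁ := mul_le_mul_of_nonneg_right (le_max_left K₁ (K₂ + K₃)) hY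
  have hm₂ := mul_le_mul_of_nonneg_right (le_max_right K₁ (K₂ + K₃)) hY
  rw [abs_le] at hK₁' hK₂' ⊢
  constructor <;> linarith [hK₁'.2, hK₂'.1]

end FormChart

theorem isBigO_of_exists_abs_sub_le {F G : ℝ → ℝ}
    (h : ∃ K, ∀ X : ℝ, 1 ≤ X → |F X| ≤ K * G X) (hG : ∀ X, 1 ≤ X → 0 ≤ G X) :
    F =O[atTop] G := by
  obtain ⟨K, hK⟩ := h
  refine IsBigO.of_bound K ((eventually_ge_atTop 1).mono fun X hX => ?_)
  rw [norm_eq_abs, norm_eq_abs, abs_of_nonneg (hG X hX)]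
  exact hK X hX

end

theorem davenport_bcf_count :
    ((fun X : ℝ =>
        ((countClasses fun f => IrredForm f ∧ 0 < (discF f : ℝ) ∧ (discF f : ℝ) < X) : ℝ) -
          π ^ 2 / 72 * X) =O[atTop] fun X : ℝ => X ^ ((5 : ℝ) / 6)) ∧
    ((fun X : ℝ =>
        ((countClasses fun f => IrredForm f ∧ -X < (discF f : ℝ) ∧ (discF f : ℝ) < 0) : ℝ) -
          π ^ 2 / 24 * X) =O[atTop] fun X : ℝ => X ^ ((5 : ℝ) / 6)) := by
  have hG : ∀ X : ℝ, 1 ≤ X → 0 ≤ X ^ (5 / 6 : ℝ) := fun X hX => by positivity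
  have h3 : (√3) ^ 2 = 3 := sq_sqrt (by norm_num)
  have hκ : 2 ≤ 6 * √3 := by nlinarith [sqrt_nonneg 3]
  constructor
  · refine isBigO_of_exists_abs_sub_le ?_ hG
    obtain ⟨K, hK⟩ := posChart.exists_abs_countClasses_sub_le hκ
    refine ⟨K, fun X hX => ?_⟩
    have := hK X hX
    simp only [one_mul] at this
    rwa [mul_pow, h3, show 36 * π ^ 2 / (24 * (6 ^ 2 * 3)) = π ^ 2 / 72 by ring] at this
  · refine isBigO_of_exists_abs_sub_le ?_ hG
    obtain ⟨K, hK⟩ := negChart.exists_abs_countClasses_sub_le le_rfl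
    refine ⟨K, fun X hX => ?_⟩
    have := hK X hX
    rw [show 4 * π ^ 2 / (24 * 2 ^ 2) = π ^ 2 / 24 by ring] at this
    have e : (fun f : BinaryCubic => IrredForm f ∧ -X < (discF f : ℝ) ∧ (discF f : ℝ) < 0) =
        fun f => IrredForm f ∧ 0 < -1 * (discF f : ℝ) ∧ -1 * (discF f : ℝ) < X := by
      funext f
      refine propext (and_congr_right fun _ => ⟨fun h => ?_, fun h => ?_⟩) <;>
        constructor <;> linarith [h.1, h.2]
    rwa [e]
end

section
/- For every ε > 0, the number of GL₂(ℤ)-equivalence classes of irreducible integral binary cubic forms f with |Disc(f)| < X whose stabilizer in GL₂(ℤ) under the twisted action is nontrivial (equivalently, is cyclic of order 3) is O_ε(X^{3/4+ε}). -/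
open Filter Asymptotics Real

/-- The stabilizer of `f` in `GL₂(ℤ)` under the twisted action is nontrivial. -/
def HasNontrivialStab (f : BinaryCubic) : Prop :=
  ∃ γ : Matrix (Fin 2) (Fin 2) ℤ, IsUnit γ.det ∧ γ ≠ 1 ∧ ActsTo γ f f

/-- The value of a binary cubic form at a pair of integers. -/
def BinaryCubic.value (f : BinaryCubic) (x y : ℤ) : ℤ :=
  f.1 * x ^ 3 + f.2.1 * x ^ 2 * y + f.2.2.1 * x * y ^ 2 + f.2.2.2 * y ^ 3

theorem eval_toPoly {A : Type*} [CommRing A] (f : A × A × A × A) (v : Fin 2 → A) :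
    MvPolynomial.eval v (toPoly f) =
      f.1 * v 0 ^ 3 + f.2.1 * v 0 ^ 2 * v 1 + f.2.2.1 * v 0 * v 1 ^ 2 + f.2.2.2 * v 1 ^ 3 := by
  simp [toPoly]

theorem actsTo_iff_value (γ : Matrix (Fin 2) (Fin 2) ℤ) (f g : BinaryCubic) :
    ActsTo γ f g ↔ ∀ x y : ℤ, γ.det * g.value x y =
      f.value (γ 0 0 * x + γ 1 0 * y) (γ 0 1 * x + γ 1 1 * y) := by
  have key (v : Fin 2 → ℤ) : MvPolynomial.eval v (MvPolynomial.bind₁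
      (fun j : Fin 2 => MvPolynomial.C (γ 0 j) * MvPolynomial.X 0 +
        MvPolynomial.C (γ 1 j) * MvPolynomial.X 1) (toPoly f)) =
      f.value (γ 0 0 * v 0 + γ 1 0 * v 1) (γ 0 1 * v 0 + γ 1 1 * v 1) := by
    simp [toPoly, BinaryCubic.value]
  constructor
  · intro h x y
    have := congrArg (MvPolynomial.eval ![x, y]) h
    rw [key, map_mul, eval_toPoly] at this
    simpa [BinaryCubic.value] using this
  · intro h
    refine MvPolynomial.funext fun v => ?_
    rw [key, ← h, map_mul, eval_toPoly, MvPolynomial.eval_C]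
    rfl

theorem FormEquiv.of_common {f f' g : BinaryCubic} (h : FormEquiv f g) (h' : FormEquiv f' g) :
    FormEquiv f f' := by
  obtain ⟨M, hM, h⟩ := h
  obtain ⟨M', hM', h'⟩ := h'
  rw [actsTo_iff_value] at h h'
  have hsq : M'.det * M'.det = 1 := Int.isUnit_mul_self hM'
  have hdet : (M'.det • (M'.adjugate * M)).det = M'.det * M.det := by
    rw [Matrix.det_smul, Matrix.det_mul, Matrix.det_adjugate]
    simp only [Fintype.card_fin]
    linear_combination (M'.det * M.det) * hsq
  refine ⟨M'.det • (M'.adjugate * M), by rw [hdet]; exact hM'.mul hM, ?_⟩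
  rw [actsTo_iff_value, hdet]
  intro x y
  have e' := h' (M'.det * (M' 1 1 * x - M' 1 0 * y)) (M'.det * (-M' 0 1 * x + M' 0 0 * y))
  have e := h (M'.det * (M' 1 1 * x - M' 1 0 * y)) (M'.det * (-M' 0 1 * x + M' 0 0 * y))
  have hx : M' 0 0 * (M'.det * (M' 1 1 * x - M' 1 0 * y)) +
      M' 1 0 * (M'.det * (-M' 0 1 * x + M' 0 0 * y)) = x := by
    have := M'.det_fin_two
    linear_combination (-M'.det * x) * this + x * hsq
  have hy : M' 0 1 * (M'.det * (M' 1 1 * x - M' 1 0 * y)) +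
      M' 1 1 * (M'.det * (-M' 0 1 * x + M' 0 0 * y)) = y := by
    have := M'.det_fin_two
    linear_combination (-M'.det * y) * this + y * hsq
  rw [hx, hy] at e'
  rw [← e']
  calc M'.det * M.det * (M'.det * g.value _ _)
      = (M'.det * M'.det) * (M.det * g.value _ _) := by ring
    _ = _ := by
      rw [hsq, one_mul, e]
      congr 1 <;>
      · simp only [Matrix.smul_apply, Matrix.mul_apply, Fin.sum_univ_two,
          Matrix.adjugate_fin_two, Matrix.of_apply, Matrix.cons_val', Matrix.cons_val_zero,
          Matrix.cons_val_one, Matrix.cons_val_fin_one, smul_eq_mul]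
        ring

theorem IrredForm.value_ne_zero {f : BinaryCubic} (hf : IrredForm f) {u v : ℤ}
    (huv : u ≠ 0 ∨ v ≠ 0) : f.value u v ≠ 0 := by
  intro h0
  have not_unit (w : Fin 2 → ℚ) (P : MvPolynomial (Fin 2) ℚ)
      (hP : MvPolynomial.eval w P = 0) : ¬ IsUnit P := fun hu =>
    not_isUnit_zero (hP ▸ hu.map (MvPolynomial.eval w))
  obtain ⟨α, β, κ, ha, hb, hc, hd⟩ : ∃ α β κ : ℚ, (f.1 : ℚ) = v * α ∧
      (f.2.1 : ℚ) = v * β - u * α ∧ (f.2.2.1 : ℚ) = v * κ - u * β ∧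
      (f.2.2.2 : ℚ) = - u * κ := by
    have h0' : (f.1 : ℚ) * u ^ 3 + f.2.1 * u ^ 2 * v + f.2.2.1 * u * v ^ 2 +
        f.2.2.2 * v ^ 3 = 0 := by
      exact_mod_cast h0
    by_cases hv : v = 0
    · have hu : (u : ℚ) ≠ 0 := by
        simpa [hv] using huv
      subst hv
      have ha : (f.1 : ℚ) = 0 := by simpa [hu] using h0'
      refine ⟨-f.2.1 / u, -f.2.2.1 / u, -f.2.2.2 / u, by simp [ha], ?_, ?_, ?_⟩ <;>
        field_simp <;> simp
    · have hv' : (v : ℚ) ≠ 0 := by exact_mod_cast hv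
      refine ⟨f.1 / v, (f.2.1 + u * (f.1 / v)) / v,
        (f.2.2.1 + u * ((f.2.1 + u * (f.1 / v)) / v)) / v, ?_, ?_, ?_, ?_⟩
      · field_simp
      · field_simp; ring
      · field_simp; ring
      · field_simp
        linear_combination h0'
  have hfac : MvPolynomial.map (Int.castRingHom ℚ) (toPoly f) =
      (MvPolynomial.C (v : ℚ) * MvPolynomial.X 0 - MvPolynomial.C (u : ℚ) * MvPolynomial.X 1) *
      (MvPolynomial.C α * MvPolynomial.X 0 ^ 2 +
        MvPolynomial.C β * (MvPolynomial.X 0 * MvPolynomial.X 1) +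
        MvPolynomial.C κ * MvPolynomial.X 1 ^ 2) := by
    refine MvPolynomial.funext fun w => ?_
    simp only [toPoly, map_add, map_mul, map_sub, map_pow, MvPolynomial.map_C,
      MvPolynomial.map_X, MvPolynomial.eval_C, MvPolynomial.eval_X]
    simp only [eq_intCast, ha, hb, hc, hd]
    ring
  rcases hf.isUnit_or_isUnit hfac with h | h
  · refine not_unit ![(u : ℚ), v] _ ?_ h
    simp [mul_comm]
  · refine not_unit 0 _ ?_ h
    simp

/-- A binary quadratic form of discriminant `-3` represents `1` or `-1`. -/
theorem exists_quadratic_value_sq_eq_one (A B C : ℤ) (h : B ^ 2 - 4 * A * C = -3) :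
    ∃ x y : ℤ, (A * x ^ 2 + B * x * y + C * y ^ 2) ^ 2 = 1 := by
  induction hn : A.natAbs using Nat.strong_induction_on generalizing A B C with
  | _ n ih =>
    have hA : A ≠ 0 := by
      rintro rfl
      nlinarith [sq_nonneg B]
    obtain ⟨k, hk⟩ : ∃ k : ℤ, |B + 2 * A * k| ≤ |A| := by
      have hpos := abs_pos.mpr hA
      have hm := Int.emod_add_mul_ediv (B + |A|) (2 * |A|)
      have h1 := Int.emod_nonneg (B + |A|) (b := 2 * |A|) (by positivity)
      have h2 := Int.emod_lt_of_pos (B + |A|) (b := 2 * |A|) (by positivity)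
      set m := (B + |A|) / (2 * |A|)
      rcases abs_choice A with hc | hc
      · have hAm : |A| * m = A * m := by rw [hc]
        refine ⟨-m, abs_le.mpr ?_⟩
        constructor <;> linarith
      · have hAm : |A| * m = -A * m := by rw [hc]
        refine ⟨m, abs_le.mpr ?_⟩
        constructor <;> linarith
    set B' := B + 2 * A * k with hB'
    set C' := A * k ^ 2 + B * k + C with hC'
    have hdisc : B' ^ 2 - 4 * A * C' = -3 := by
      rw [hB', hC']
      linear_combination h
    by_cases hlt : C'.natAbs < n
    · obtain ⟨x, y, hxy⟩ := ih _ hlt C' B' A (by linear_combination hdisc) rfl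
      refine ⟨y + k * x, x, ?_⟩
      rw [← hxy, hB', hC']
      ring
    · refine ⟨1, 0, ?_⟩
      have hle : |A| ≤ |C'| := by
        rw [Int.abs_eq_natAbs, Int.abs_eq_natAbs]
        omega
      have h4 : 4 * (|A| * |C'|) = B' ^ 2 + 3 := by
        rw [← abs_mul, abs_of_nonneg]
        · linarith
        · nlinarith [sq_nonneg B']
      have hB2 : B' ^ 2 ≤ |A| ^ 2 := by
        rw [sq_abs]
        exact sq_le_sq.mpr hk
      have hpos := abs_pos.mpr hA
      have : |A| = 1 := by nlinarith
      have : A ^ 2 = 1 := by rw [← sq_abs, this, one_pow]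
      linear_combination this

/-- A matrix with trace `t` and determinant `δ` that stabilizes a binary cubic form without
nontrivial zeros and is not scalar has `δ = 1` and `t = -1`. -/
theorem det_eq_one_and_trace_eq_neg_one {A B C D t δ : ℤ} (hA : A ≠ 0) (hδ : δ = 1 ∨ δ = -1)
    (hne : ∀ x : ℤ, BinaryCubic.value (A, B, C, D) x 1 ≠ 0)
    (h : ∀ x y : ℤ, BinaryCubic.value (A, B, C, D) (-δ * y) (x + t * y) =
      δ * BinaryCubic.value (A, B, C, D) x y) : δ = 1 ∧ t = -1 := by
  have h10 := h 1 0
  have h01 := h 0 1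
  have h11 := h 1 1
  have h12 := h 1 (-1)
  have hm := hne (-1)
  have hp := hne 1
  simp only [BinaryCubic.value] at h10 h01 h11 h12 hm hp
  rcases hδ with rfl | rfl
  · refine ⟨rfl, ?_⟩
    have hD : D = A := by linarith
    subst hD
    have hB : B = 3 * t * D - C := by linarith
    have hC : (t + 1) * (3 * t * D - 2 * C) = 0 := by linarith
    by_contra ht
    have ht' : t + 1 ≠ 0 := fun h => ht (by linarith)
    have hC' : 3 * t * D - 2 * C = 0 := (mul_eq_zero.mp hC).resolve_left ht'
    have h2 : D * ((t + 1) * (t - 2) ^ 2) = 0 := by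
      linear_combination -2 * h01 + 2 * t * hB + (t + t ^ 2) * hC'
    have h3 : t - 2 = 0 := by simpa [hA, ht'] using h2
    have : t = 2 := by linarith
    subst this
    exact hm (by linarith)
  · exfalso
    have hD : D = -A := by linarith
    subst hD
    have hB : B = 3 * t * A - C := by linarith
    have hC : t * (3 * A + 2 * C - 3 * t * A) = 0 := by linarith
    rcases mul_eq_zero.mp hC with ht | hC'
    · subst ht
      exact hp (by linarith)
    · have h2 : A * (t * (t ^ 2 + 3)) = 0 := by
        linear_combination 2 * h01 - 2 * t * hB + (t - t ^ 2) * hC'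
      have h3 : t = 0 := by
        have : t ^ 2 + 3 ≠ 0 := by positivity
        simpa [hA, this] using h2
      subst h3
      exact hp (by linarith)

theorem IrredForm.stabilizer_det_trace {f : BinaryCubic} (hf : IrredForm f)
    {γ : Matrix (Fin 2) (Fin 2) ℤ} (hγ : IsUnit γ.det) (hne : γ ≠ 1) (h : ActsTo γ f f) :
    γ.det = 1 ∧ γ 0 0 + γ 1 1 = -1 := by
  rw [actsTo_iff_value] at h
  have hδ := Int.isUnit_iff.mp hγ
  have hdet := γ.det_fin_two
  have ha : f.1 ≠ 0 := by
    simpa [BinaryCubic.value] using hf.value_ne_zero (u := 1) (v := 0) (by simp)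
  by_cases hq : γ 0 1 = 0
  · exfalso
    rw [hq] at hdet h
    have h10 := h 1 0
    have h11 := h 1 1
    have h12 := h 1 (-1)
    have hps : γ 0 0 * γ 1 1 = 1 ∨ γ 0 0 * γ 1 1 = -1 := by
      have : γ.det = γ 0 0 * γ 1 1 := by linarith
      rwa [this] at hδ
    have hp2 : γ 0 0 = 1 ∨ γ 0 0 = -1 :=
      Int.isUnit_iff.mp (isUnit_of_dvd_unit ⟨γ 1 1, by linarith⟩ hγ)
    have hpδ : γ 0 0 = γ.det := by
      have : f.1 * (γ.det - γ 0 0) = 0 := by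
        simp only [BinaryCubic.value] at h10
        rcases hp2 with e | e <;> rw [e] at h10 ⊢ <;> linarith
      have := (mul_eq_zero.mp this).resolve_left ha
      linarith
    have hs : γ 1 1 = 1 := by
      rcases hp2 with e | e <;> rw [e] at hdet hpδ <;> linarith
    rcases hδ with e | e
    · have hp : γ 0 0 = 1 := by rw [hpδ, e]
      have hr : γ 1 0 = 0 := by
        have h01 := h 0 1
        rw [e, hp, hs] at h01 h11 h12
        simp only [BinaryCubic.value] at h01 h11 h12
        have : f.1 * γ 1 0 = 0 := by linarith
        exact (mul_eq_zero.mp this).resolve_left ha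
      apply hne
      ext i j
      fin_cases i <;> fin_cases j <;> simp [hp, hq, hr, hs]
    · have hp : γ 0 0 = -1 := by rw [hpδ, e]
      have := h (γ 1 0) 2
      rw [e, hp, hs] at this
      refine hf.value_ne_zero (u := γ 1 0) (v := 2) (by simp) ?_
      have e1 : -1 * γ 1 0 + γ 1 0 * 2 = γ 1 0 := by ring
      have e2 : 0 * γ 1 0 + 1 * 2 = (2 : ℤ) := by ring
      rw [e1, e2] at this
      linarith
  · set p := γ 0 0
    set q := γ 0 1
    have key (x y : ℤ) : BinaryCubic.value (f.1, 3 * f.1 * p + f.2.1 * q,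
        3 * f.1 * p ^ 2 + 2 * f.2.1 * p * q + f.2.2.1 * q ^ 2, f.value p q) x y =
        f.value (x + p * y) (q * y) := by
      simp only [BinaryCubic.value]
      ring
    refine det_eq_one_and_trace_eq_neg_one (A := f.1) (B := 3 * f.1 * p + f.2.1 * q)
      (C := 3 * f.1 * p ^ 2 + 2 * f.2.1 * p * q + f.2.2.1 * q ^ 2) (D := f.value p q)
      ha hδ (fun x => ?_) (fun x y => ?_)
    · rw [key]
      exact hf.value_ne_zero (Or.inr (by simpa using hq))
    · rw [key, key, h]
      congr 1
      · rw [hdet]; ring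
      · ring

theorem discF_substitution (a b c d x y z w : ℤ) :
    discF (a * x ^ 3 + b * x ^ 2 * y + c * x * y ^ 2 + d * y ^ 3,
      3 * a * x ^ 2 * z + b * (x ^ 2 * w + 2 * x * y * z) + c * (2 * x * y * w + y ^ 2 * z) +
        3 * d * y ^ 2 * w,
      3 * a * x * z ^ 2 + b * (z ^ 2 * y + 2 * x * z * w) + c * (x * w ^ 2 + 2 * y * z * w) +
        3 * d * y * w ^ 2,
      a * z ^ 3 + b * z ^ 2 * w + c * z * w ^ 2 + d * w ^ 3) =
      (x * w - y * z) ^ 6 * discF (a, b, c, d) := by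
  simp only [discF]
  ring

theorem IrredForm.exists_formEquiv_cyclic {f : BinaryCubic} (hf : IrredForm f)
    (hs : HasNontrivialStab f) : ∃ A B : ℤ, FormEquiv f (A, B, -3 * A - B, A) ∧
      discF f = (B ^ 2 + 3 * A * B + 9 * A ^ 2) ^ 2 := by
  obtain ⟨γ, hγ, hne, h⟩ := hs
  obtain ⟨hd, ht⟩ := hf.stabilizer_det_trace hγ hne h
  rw [actsTo_iff_value, hd] at h
  have hdet := γ.det_fin_two
  rw [hd] at hdet
  set p := γ 0 0
  set q := γ 0 1
  set r := γ 1 0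
  obtain ⟨s, hs⟩ : ∃ s, s = γ 1 1 := ⟨_, rfl⟩
  rw [← hs] at h hdet ht
  obtain rfl : s = -1 - p := by linarith
  obtain ⟨x, y, hxy⟩ := exists_quadratic_value_sq_eq_one q (-1 - 2 * p) (-r)
    (by linear_combination 4 * hdet)
  obtain ⟨z, hz⟩ : ∃ z, z = p * x + r * y := ⟨_, rfl⟩
  obtain ⟨w, hw⟩ : ∃ w, w = q * x + (-1 - p) * y := ⟨_, rfl⟩
  have he : (x * w - y * z) ^ 2 = 1 := by
    rw [← hxy, hz, hw]
    ring
  have h1 := h x y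
  have h2 := h z w
  have hz2 : p * z + r * w = -x - z := by
    rw [hz, hw]; linear_combination x * hdet
  have hw2 : q * z + (-1 - p) * w = -y - w := by
    rw [hz, hw]; linear_combination y * hdet
  rw [← hz, ← hw] at h1
  rw [hz2, hw2] at h2
  obtain ⟨a, b, c, d⟩ := f
  set e := x * w - y * z with hedef
  have hdisc := discF_substitution a b c d x y z w
  rw [← hedef] at hdisc
  set A := a * x ^ 3 + b * x ^ 2 * y + c * x * y ^ 2 + d * y ^ 3 with hA
  set B := 3 * a * x ^ 2 * z + b * (x ^ 2 * w + 2 * x * y * z) +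
    c * (2 * x * y * w + y ^ 2 * z) + 3 * d * y ^ 2 * w with hB
  set C := 3 * a * x * z ^ 2 + b * (z ^ 2 * y + 2 * x * z * w) +
    c * (x * w ^ 2 + 2 * y * z * w) + 3 * d * y * w ^ 2 with hC
  set D := a * z ^ 3 + b * z ^ 2 * w + c * z * w ^ 2 + d * w ^ 3 with hD
  have hval (X Y : ℤ) : BinaryCubic.value (a, b, c, d) (x * X + z * Y) (y * X + w * Y) =
      A * X ^ 3 + B * X ^ 2 * Y + C * X * Y ^ 2 + D * Y ^ 3 := by
    simp only [BinaryCubic.value, hA, hB, hC, hD]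
    ring
  have hDA : D = A := by
    simp only [BinaryCubic.value] at h1
    linarith
  have hCA : C = -3 * A - B := by
    have := hval (-1) (-1)
    rw [show x * -1 + z * -1 = -x - z by ring,
      show y * -1 + w * -1 = -y - w by ring, ← h2] at this
    have hzw : BinaryCubic.value (a, b, c, d) z w = D := rfl
    rw [hzw] at this
    linarith
  refine ⟨e * A, e * B, ⟨!![x, y; z, w], ?_, ?_⟩, ?_⟩
  · rw [Matrix.det_fin_two_of, ← hedef]
    exact IsUnit.of_mul_eq_one e (by linear_combination he)
  · rw [actsTo_iff_value]
    intro X Y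
    rw [Matrix.det_fin_two_of, ← hedef]
    have := hval X Y
    rw [hCA, hDA] at this
    simp only [Matrix.of_apply, Matrix.cons_val', Matrix.cons_val_zero, Matrix.cons_val_one,
      Matrix.cons_val_fin_one]
    rw [this]
    simp only [BinaryCubic.value]
    linear_combination (A * X ^ 3 + B * X ^ 2 * Y + (-3 * A - B) * X * Y ^ 2 + A * Y ^ 3) * he
  · have he6 : e ^ 6 = 1 := by
      rw [show e ^ 6 = (e ^ 2) ^ 3 by ring, he, one_pow]
    have he4 : e ^ 4 = 1 := by
      rw [show e ^ 4 = (e ^ 2) ^ 2 by ring, he, one_pow]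
    rw [he6, one_mul, hCA, hDA] at hdisc
    rw [← hdisc]
    simp only [discF]
    linear_combination -((B ^ 2 + 3 * A * B + 9 * A ^ 2) ^ 2) * he4

theorem countClasses_le {P : BinaryCubic → Prop} {N : ℕ}
    (h : ∀ f, P f → ∃ A B : ℤ, |A| ≤ N ∧ |B| ≤ N ∧ FormEquiv f (A, B, -3 * A - B, A)) :
    countClasses P ≤ (2 * N + 1) ^ 2 := by
  choose A B hA hB hAB using fun f : { f : BinaryCubic // P f } => h f.1 f.2
  let S := Finset.Icc (-(N : ℤ)) N ×ˢ Finset.Icc (-(N : ℤ)) N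
  have hS : S.card = (2 * N + 1) ^ 2 := by
    simp only [S, Finset.card_product, Int.card_Icc]
    rw [← sq]
    congr 1
    omega
  rw [← hS, ← Nat.card_eq_finsetCard]
  refine Nat.card_le_card_of_injective (fun q => ⟨(A q.out, B q.out), ?_⟩) ?_
  · simpa [S, ← abs_le] using ⟨hA q.out, hB q.out⟩
  · intro q q' hq
    simp only [Subtype.mk.injEq, Prod.mk.injEq] at hq
    have h1 := hAB q.out
    rw [hq.1, hq.2] at h1
    rw [← Quot.out_eq q, ← Quot.out_eq q']
    exact Quot.sound (h1.of_common (hAB q'.out))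

theorem count_C3_points (ε : ℝ) (hε : 0 < ε) :
    (fun X : ℝ =>
        ((countClasses fun f =>
            IrredForm f ∧ |(discF f : ℝ)| < X ∧ HasNontrivialStab f) : ℝ)) =O[atTop]
      fun X : ℝ => X ^ ((3 : ℝ) / 4 + ε) := by
  refine IsBigO.of_bound 25 ?_
  filter_upwards [eventually_ge_atTop 1] with X hX
  have hX0 : 0 ≤ X := by linarith
  set T : ℝ := X ^ ((1 : ℝ) / 4) with hT
  have hT1 : 1 ≤ T := Real.one_le_rpow hX (by norm_num)
  have hT4 : T ^ 4 = X := by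
    rw [hT, ← Real.rpow_natCast, ← Real.rpow_mul hX0]
    norm_num
  have le_floor {m : ℤ} (hm : (m : ℝ) ^ 4 ≤ 16 * X) : |m| ≤ (⌊2 * T⌋₊ : ℤ) := by
    have h1 : |(m : ℝ)| ≤ 2 * T := by
      refine le_of_pow_le_pow_left₀ (n := 4) (by norm_num) (by positivity) ?_
      rw [mul_pow, hT4, Even.pow_abs (by decide)]
      linarith
    have h2 : m.natAbs ≤ ⌊2 * T⌋₊ := Nat.le_floor (by rwa [Nat.cast_natAbs, Int.cast_abs])
    rw [Int.abs_eq_natAbs]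
    exact_mod_cast h2
  have hcount : countClasses (fun f =>
      IrredForm f ∧ |(discF f : ℝ)| < X ∧ HasNontrivialStab f) ≤ (2 * ⌊2 * T⌋₊ + 1) ^ 2 := by
    refine countClasses_le ?_
    rintro f ⟨hf, hdisc, hs⟩
    obtain ⟨A, B, hAB, hd⟩ := hf.exists_formEquiv_cyclic hs
    have hlt : ((B : ℝ) ^ 2 + 3 * A * B + 9 * A ^ 2) ^ 2 < X := by
      have := lt_of_le_of_lt (le_abs_self _) hdisc
      rw [hd] at this
      exact_mod_cast this
    refine ⟨A, B, le_floor ?_, le_floor ?_, hAB⟩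
    · have h1 : (A : ℝ) ^ 2 ≤ (B : ℝ) ^ 2 + 3 * A * B + 9 * A ^ 2 := by
        nlinarith [sq_nonneg ((B : ℝ) + 3 / 2 * A), sq_nonneg (A : ℝ)]
      have h2 := pow_le_pow_left₀ (sq_nonneg (A : ℝ)) h1 2
      linarith [show ((A : ℝ) ^ 2) ^ 2 = (A : ℝ) ^ 4 by ring]
    · have h1 : (B : ℝ) ^ 2 ≤ 2 * ((B : ℝ) ^ 2 + 3 * A * B + 9 * A ^ 2) := by
        nlinarith [sq_nonneg ((B : ℝ) + 3 * A), sq_nonneg (A : ℝ)]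
      have h2 := pow_le_pow_left₀ (sq_nonneg (B : ℝ)) h1 2
      linarith [show ((B : ℝ) ^ 2) ^ 2 = (B : ℝ) ^ 4 by ring]
  have hpow : T ^ 2 ≤ X ^ ((3 : ℝ) / 4 + ε) := by
    rw [hT, ← Real.rpow_natCast, ← Real.rpow_mul hX0]
    exact Real.rpow_le_rpow_of_exponent_le hX (by norm_num; linarith)
  rw [Real.norm_of_nonneg (Nat.cast_nonneg _), Real.norm_of_nonneg (by positivity)]
  have hfl : (⌊2 * T⌋₊ : ℝ) ≤ 2 * T := Nat.floor_le (by positivity)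
  calc ((countClasses _ : ℕ) : ℝ) ≤ (2 * (⌊2 * T⌋₊ : ℝ) + 1) ^ 2 := by exact_mod_cast hcount
    _ ≤ (5 * T) ^ 2 := by
      gcongr
      linarith
    _ = 25 * T ^ 2 := by ring
    _ ≤ 25 * X ^ ((3 : ℝ) / 4 + ε) := by gcongr
end
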